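/- arXiv:2007.09275 — 3 statements merged into one kernel-verified Lean document; each statement's English description precedes it below -/
import Mathlib

section
/- For any positive real numbers a and b, as n → ∞ one has S_{a,b}(n) ∼ [Γ(a+1)Γ(b+1)/Γ(a+b+2)]·[ζ(a+1)ζ(b+1)/ζ(a+b+2)]·σ_{a+b+1}(n); that is, the ratio of S_{a,b}(n) to the displayed main term tends to 1 as n tends to infinity. -/
open Finset Filter

/-- `σ_a(n) = ∑_{d ∣ n} d^a` for real `a`. -/
noncomputable def sigmaR (a : ℝ) (n : ℕ) : ℝ := ∑ d ∈ n.divisors, (d : ℝ) ^ a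

/-- `S_{a,b}(n) = ∑_{k=1}^{n-1} σ_a(k) σ_b(n-k)`. -/
noncomputable def SR (a b : ℝ) (n : ℕ) : ℝ :=
  ∑ k ∈ Finset.Ico 1 n, sigmaR a k * sigmaR b (n - k)

/-- The Riemann zeta function at a real argument (it takes real values there). -/
noncomputable def zetaR (x : ℝ) : ℝ := (riemannZeta (x : ℂ)).re


/-- weight -/
noncomputable def cW (a b : ℝ) (p : ℕ × ℕ) : ℝ :=
  (p.1 : ℝ) ^ (-a) * (p.2 : ℝ) ^ (-b) / (Nat.lcm p.1 p.2 : ℝ)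

lemma cW_nonneg (a b : ℝ) (p : ℕ × ℕ) : 0 ≤ cW a b p := by
  unfold cW; positivity

def iotaW (p : ℕ × ℕ) : ℕ × ℕ × ℕ :=
  (Nat.gcd p.1 p.2, p.1 / Nat.gcd p.1 p.2, p.2 / Nat.gcd p.1 p.2)

lemma iotaW_inj : Function.Injective iotaW := by
  rintro ⟨d, e⟩ ⟨d', e'⟩ h
  simp only [iotaW, Prod.mk.injEq] at h
  obtain ⟨h1, h2, h3⟩ := h
  have e1 := Nat.mul_div_cancel' (Nat.gcd_dvd_left d e)
  have e2 := Nat.mul_div_cancel' (Nat.gcd_dvd_right d e)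
  have e3 := Nat.mul_div_cancel' (Nat.gcd_dvd_left d' e')
  have e4 := Nat.mul_div_cancel' (Nat.gcd_dvd_right d' e')
  rw [h2, h1, e3] at e1
  rw [h3, h1, e4] at e2
  simp [e1, e2]

/-- the transformed function -/
noncomputable def vW (u : ℕ × ℕ → ℝ) (t : ℕ × ℕ × ℕ) : ℝ :=
  if Nat.Coprime t.2.1 t.2.2 then u (t.1 * t.2.1, t.1 * t.2.2) else 0

lemma vW_iota (u : ℕ × ℕ → ℝ) (h0 : ∀ d e, d = 0 ∨ e = 0 → u (d, e) = 0) (p : ℕ × ℕ) :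
    vW u (iotaW p) = u p := by
  obtain ⟨d, e⟩ := p
  have e1 := Nat.mul_div_cancel' (Nat.gcd_dvd_left d e)
  have e2 := Nat.mul_div_cancel' (Nat.gcd_dvd_right d e)
  have key : vW u (iotaW (d, e)) = if Nat.Coprime (d / Nat.gcd d e) (e / Nat.gcd d e) then
      u (Nat.gcd d e * (d / Nat.gcd d e), Nat.gcd d e * (e / Nat.gcd d e)) else 0 := rfl
  rw [key, e1, e2]
  by_cases hd : d = 0
  · rw [h0 d e (Or.inl hd)]; simp
  · rw [if_pos]
    exact Nat.coprime_div_gcd_div_gcd (Nat.gcd_pos_of_pos_left _ (Nat.pos_of_ne_zero hd))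

lemma vW_support (u : ℕ × ℕ → ℝ) (h0 : ∀ d e, d = 0 ∨ e = 0 → u (d, e) = 0) :
    Function.support (vW u) ⊆ Set.range iotaW := by
  rintro ⟨g, x, y⟩ h
  simp only [Function.mem_support, vW] at h
  by_cases hc : Nat.Coprime x y
  · rw [if_pos hc] at h
    have hg : g ≠ 0 := by rintro rfl; exact h (h0 _ _ (by simp))
    refine ⟨(g * x, g * y), ?_⟩
    have : Nat.gcd (g * x) (g * y) = g := by
      rw [Nat.gcd_mul_left, hc.gcd_eq_one, mul_one]
    simp only [iotaW, this]
    rw [Nat.mul_div_cancel_left _ (Nat.pos_of_ne_zero hg),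
      Nat.mul_div_cancel_left _ (Nat.pos_of_ne_zero hg)]
  · rw [if_neg hc] at h; exact absurd rfl h

lemma vW_tsum (u : ℕ × ℕ → ℝ) (h0 : ∀ d e, d = 0 ∨ e = 0 → u (d, e) = 0) :
    ∑' p, u p = ∑' t, vW u t := by
  rw [← iotaW_inj.tsum_eq (vW_support u h0)]
  exact tsum_congr (fun p => (vW_iota u h0 p).symm)

/-- coprime part -/
noncomputable def coW (a b : ℝ) (p : ℕ × ℕ) : ℝ :=
  if Nat.Coprime p.1 p.2 then (p.1 : ℝ) ^ (-(a + 1)) * (p.2 : ℝ) ^ (-(b + 1)) else 0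

lemma summable_pW {s : ℝ} (hs : 1 < s) : Summable (fun n : ℕ => (n : ℝ) ^ (-s)) :=
  Real.summable_nat_rpow.2 (by linarith)

lemma summable_prodW {a b : ℝ} (ha : 0 < a) (hb : 0 < b) :
    Summable (fun p : ℕ × ℕ => (p.1 : ℝ) ^ (-(a + 1)) * (p.2 : ℝ) ^ (-(b + 1))) :=
  (summable_pW (by linarith : 1 < a + 1)).mul_of_nonneg (summable_pW (by linarith : 1 < b + 1))
    (fun n => by positivity) (fun n => by positivity)

lemma coW_nonneg (a b : ℝ) (p : ℕ × ℕ) : 0 ≤ coW a b p := by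
  unfold coW; split_ifs <;> positivity

lemma summable_coW {a b : ℝ} (ha : 0 < a) (hb : 0 < b) : Summable (coW a b) := by
  refine Summable.of_nonneg_of_le (coW_nonneg a b) (fun p => ?_) (summable_prodW ha hb)
  unfold coW; split_ifs
  · exact le_rfl
  · positivity

lemma cW_zero {a b : ℝ} (ha : 0 < a) (hb : 0 < b) (d e : ℕ) (h : d = 0 ∨ e = 0) :
    cW a b (d, e) = 0 := by
  rcases h with rfl | rfl <;> simp [cW]

lemma cW_scale {a b : ℝ} (ha : 0 < a) (hb : 0 < b) (g x y : ℕ) (hc : Nat.Coprime x y) :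
    cW a b (g * x, g * y) = (g : ℝ) ^ (-(a + b + 1)) * coW a b (x, y) := by
  by_cases hz : g = 0 ∨ x = 0 ∨ y = 0
  · rw [cW_zero ha hb _ _ (by rcases hz with h | h | h <;> simp [h])]
    unfold coW
    rcases hz with rfl | rfl | rfl
    · rw [Nat.cast_zero, Real.zero_rpow (by linarith)]; simp
    · simp only [Nat.cast_zero]
      rw [Real.zero_rpow (by linarith : -(a + 1) ≠ 0)]; simp
    · simp only [Nat.cast_zero]
      rw [Real.zero_rpow (by linarith : -(b + 1) ≠ 0)]; simp
  · push Not at hz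
    obtain ⟨hg, hx, hy⟩ := hz
    have hg' : (0 : ℝ) < g := by exact_mod_cast Nat.pos_of_ne_zero hg
    have hx' : (0 : ℝ) < x := by exact_mod_cast Nat.pos_of_ne_zero hx
    have hy' : (0 : ℝ) < y := by exact_mod_cast Nat.pos_of_ne_zero hy
    simp only [cW, coW, if_pos hc, Nat.lcm_mul_left, hc.lcm_eq_mul]
    push_cast
    rw [Real.mul_rpow hg'.le hx'.le, Real.mul_rpow hg'.le hy'.le,
      show -(a + b + 1) = -a + -b + -1 by ring, Real.rpow_add hg', Real.rpow_add hg',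
      show -(a + 1) = -a + -1 by ring, show -(b + 1) = -b + -1 by ring,
      Real.rpow_add hx', Real.rpow_add hy']
    simp only [Real.rpow_neg_one]
    field_simp

lemma summable_cW {a b : ℝ} (ha : 0 < a) (hb : 0 < b) : Summable (cW a b) := by
  have h1 : Summable (fun t : ℕ × ℕ × ℕ => (t.1 : ℝ) ^ (-(a + b + 1)) * coW a b t.2) :=
    (summable_pW (by linarith)).mul_of_nonneg (summable_coW ha hb)
      (fun n => by positivity) (coW_nonneg a b)
  have h2 : Summable (vW (cW a b)) := by
    refine Summable.of_nonneg_of_le (fun t => ?_) (fun t => ?_) h1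
    · unfold vW; split_ifs
      · exact cW_nonneg _ _ _
      · exact le_rfl
    · unfold vW; split_ifs with h
      · rw [cW_scale ha hb _ _ _ h]
      · have := coW_nonneg a b t.2
        positivity
  have := h2.comp_injective iotaW_inj
  refine this.congr (fun p => ?_)
  exact (vW_iota _ (cW_zero ha hb) p)

lemma zetaR_eq {s : ℝ} (hs : 1 < s) : zetaR s = ∑' n : ℕ, (n : ℝ) ^ (-s) := by
  unfold zetaR
  rw [zeta_eq_tsum_one_div_nat_cpow (by simpa using hs)]
  have : ∀ n : ℕ, (1 : ℂ) / (n : ℂ) ^ (s : ℂ) = (((n : ℝ) ^ (-s) : ℝ) : ℂ) := by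
    intro n
    rw [Real.rpow_neg (by positivity), Complex.ofReal_inv, Complex.ofReal_cpow (by positivity)]
    simp
  simp_rw [this]
  rw [← Complex.ofReal_tsum, Complex.ofReal_re]

lemma zetaR_pos {s : ℝ} (hs : 1 < s) : 0 < zetaR s := by
  rw [zetaR_eq hs]
  exact (summable_pW hs).tsum_pos (fun n => by positivity) 1 (by simp)

lemma tsum_coW {a b : ℝ} (ha : 0 < a) (hb : 0 < b) :
    ∑' p, coW a b p = zetaR (a + 1) * zetaR (b + 1) / zetaR (a + b + 2) := by
  have hz := zetaR_pos (by linarith : 1 < a + b + 2)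
  rw [eq_div_iff hz.ne']
  rw [zetaR_eq (by linarith : 1 < a + b + 2), zetaR_eq (by linarith : 1 < a + 1),
    zetaR_eq (by linarith : 1 < b + 1)]
  rw [tsum_mul_tsum_of_summable_norm (summable_pW (by linarith)).norm
    (summable_pW (by linarith)).norm, mul_comm,
    tsum_mul_tsum_of_summable_norm (summable_pW (by linarith)).norm (summable_coW ha hb).norm]
  have ha1 : -(a + 1) ≠ 0 := by linarith
  have hb1 : -(b + 1) ≠ 0 := by linarith
  rw [vW_tsum (fun p : ℕ × ℕ => (p.1 : ℝ) ^ (-(a + 1)) * (p.2 : ℝ) ^ (-(b + 1)))]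
  · refine tsum_congr (fun t => ?_)
    obtain ⟨g, x, y⟩ := t
    simp only [vW, coW]
    split_ifs with h
    · push_cast
      rw [Real.mul_rpow (by positivity) (by positivity),
        Real.mul_rpow (by positivity) (by positivity)]
      rcases Nat.eq_zero_or_pos g with rfl | hg
      · rw [Nat.cast_zero, Real.zero_rpow ha1, Real.zero_rpow (by linarith)]; simp
      · have hg' : (0 : ℝ) < g := by exact_mod_cast hg
        rw [show -(a + b + 2) = -(a + 1) + -(b + 1) by ring, Real.rpow_add hg']
        ring
    · simp
  · rintro d e (rfl | rfl)
    · simp only [Nat.cast_zero, Real.zero_rpow ha1, zero_mul]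
    · simp only [Nat.cast_zero, Real.zero_rpow hb1, mul_zero]

lemma tsum_gcdW {a b : ℝ} (ha : 0 < a) (hb : 0 < b) (n : ℕ) (hn : n ≠ 0) :
    ∑' p : ℕ × ℕ, (if Nat.gcd p.1 p.2 ∣ n then cW a b p else 0) =
      zetaR (a + 1) * zetaR (b + 1) / zetaR (a + b + 2) * sigmaR (-(a + b + 1)) n := by
  rw [← tsum_coW ha hb]
  have hs : sigmaR (-(a + b + 1)) n =
      ∑' g : ℕ, (if g ∣ n then (g : ℝ) ^ (-(a + b + 1)) else 0) := by
    unfold sigmaR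
    rw [tsum_eq_sum (s := n.divisors)]
    · refine Finset.sum_congr rfl (fun d hd => ?_)
      rw [if_pos (Nat.dvd_of_mem_divisors hd)]
    · intro d hd
      rw [if_neg]
      intro h; exact hd (Nat.mem_divisors.2 ⟨h, hn⟩)
  have hsum : Summable (fun g : ℕ => (if g ∣ n then (g : ℝ) ^ (-(a + b + 1)) else 0)) := by
    refine Summable.of_nonneg_of_le (fun g => ?_) (fun g => ?_)
      (summable_pW (by linarith : 1 < a + b + 1))
    · split_ifs <;> positivity
    · split_ifs
      · exact le_rfl
      · positivity
  rw [hs, mul_comm, tsum_mul_tsum_of_summable_norm hsum.norm (summable_coW ha hb).norm]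
  rw [vW_tsum (fun p : ℕ × ℕ => (if Nat.gcd p.1 p.2 ∣ n then cW a b p else 0))]
  · refine tsum_congr (fun t => ?_)
    obtain ⟨g, x, y⟩ := t
    simp only [vW]
    by_cases h : Nat.Coprime x y
    · rw [if_pos h, cW_scale ha hb _ _ _ h, Nat.gcd_mul_left, h.gcd_eq_one, mul_one]
      split_ifs <;> simp
    · rw [if_neg h]
      simp [coW, h]
  · intro d e h
    simp only [cW_zero ha hb d e h, ite_self]

lemma sigmaR_neg (s : ℝ) (n : ℕ) : sigmaR s n = (n : ℝ) ^ s * sigmaR (-s) n := by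
  unfold sigmaR
  rw [← Nat.sum_div_divisors, Finset.mul_sum]
  refine Finset.sum_congr rfl (fun d hd => ?_)
  have hd0 : (0 : ℝ) < d := by exact_mod_cast Nat.pos_of_mem_divisors hd
  rw [Nat.cast_div (Nat.dvd_of_mem_divisors hd) hd0.ne', Real.div_rpow (by positivity) hd0.le,
    Real.rpow_neg hd0.le]
  rfl

lemma sigmaR_ge_one (s : ℝ) (n : ℕ) (hn : n ≠ 0) : 1 ≤ sigmaR s n := by
  unfold sigmaR
  calc (1 : ℝ) = ((1 : ℕ) : ℝ) ^ s := by simp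
    _ ≤ _ := Finset.single_le_sum (f := fun d : ℕ => (d : ℝ) ^ s) (fun i _ => by positivity)
      (by simp [hn])

/-- the beta density, extended by zero -/
noncomputable def FW (a b x : ℝ) : ℝ := (max x 0) ^ a * (max (1 - x) 0) ^ b

lemma FW_cont {a b : ℝ} (ha : 0 < a) (hb : 0 < b) : Continuous (FW a b) := by
  unfold FW
  refine Continuous.mul ?_ ?_
  · exact Continuous.rpow_const (by fun_prop) (fun _ => Or.inr ha.le)
  · exact Continuous.rpow_const (by fun_prop) (fun _ => Or.inr hb.le)

lemma FW_zero_left {a : ℝ} (b : ℝ) (ha : 0 < a) {x : ℝ} (hx : x ≤ 0) : FW a b x = 0 := by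
  unfold FW
  rw [max_eq_right hx, Real.zero_rpow ha.ne', zero_mul]

lemma FW_zero_right {b : ℝ} (a : ℝ) (hb : 0 < b) {x : ℝ} (hx : 1 ≤ x) : FW a b x = 0 := by
  unfold FW
  rw [max_eq_right (by linarith : 1 - x ≤ 0), Real.zero_rpow hb.ne', mul_zero]

lemma FW_nonneg (a b x : ℝ) : 0 ≤ FW a b x := by
  unfold FW
  have h1 := le_max_right x 0
  have h2 := le_max_right (1 - x) 0
  positivity

lemma FW_le_one {a b : ℝ} (ha : 0 < a) (hb : 0 < b) (x : ℝ) : FW a b x ≤ 1 := by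
  rcases le_total x 0 with h | h
  · rw [FW_zero_left b ha h]; norm_num
  rcases le_total 1 x with h' | h'
  · rw [FW_zero_right a hb h']; norm_num
  unfold FW
  rw [max_eq_left h, max_eq_left (by linarith : 0 ≤ 1 - x)]
  exact mul_le_one₀ (Real.rpow_le_one h h' ha.le) (Real.rpow_nonneg (by linarith) _)
    (Real.rpow_le_one (by linarith) (by linarith) hb.le)

lemma FW_unif {a b : ℝ} (ha : 0 < a) (hb : 0 < b) : UniformContinuous (FW a b) := by
  refine (FW_cont ha hb).uniformContinuous_of_tendsto_cocompact (x := 0) ?_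
  refine tendsto_const_nhds.congr' ?_
  have : (Set.Icc (0 : ℝ) 1)ᶜ ∈ cocompact ℝ := isCompact_Icc.compl_mem_cocompact
  filter_upwards [this] with x hx
  by_cases h : x ≤ 0
  · rw [FW_zero_left b ha h]
  · rw [FW_zero_right a hb]
    by_contra h'
    push Not at h h'
    exact hx ⟨h.le, h'.le⟩

lemma FW_integral {a b : ℝ} (ha : 0 < a) (hb : 0 < b) :
    ∫ x in (0 : ℝ)..1, FW a b x =
      Real.Gamma (a + 1) * Real.Gamma (b + 1) / Real.Gamma (a + b + 2) := by
  have h := ProbabilityTheory.beta_eq_betaIntegralReal (a + 1) (b + 1) (by linarith) (by linarith)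
  unfold ProbabilityTheory.beta at h
  rw [show a + b + 2 = a + 1 + (b + 1) by ring, h]
  unfold Complex.betaIntegral
  have : ∫ x in (0 : ℝ)..1, (x : ℂ) ^ (((a + 1 : ℝ) : ℂ) - 1) * (1 - (x : ℂ)) ^ (((b + 1 : ℝ) : ℂ) - 1)
      = ∫ x in (0 : ℝ)..1, ((FW a b x : ℝ) : ℂ) := by
    refine intervalIntegral.integral_congr (fun x hx => ?_)
    rw [Set.uIcc_of_le zero_le_one] at hx
    simp only [FW]
    rw [max_eq_left hx.1, max_eq_left (by linarith [hx.2] : 0 ≤ 1 - x)]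
    push_cast
    rw [Complex.ofReal_cpow hx.1, Complex.ofReal_cpow (by linarith [hx.2])]
    push_cast
    simp
  rw [this, intervalIntegral.integral_ofReal, Complex.ofReal_re]

lemma riemannW {a b : ℝ} (ha : 0 < a) (hb : 0 < b) (q : ℕ) (hq : 0 < q) {ε : ℝ} (hε : 0 < ε) :
    ∃ N : ℕ, ∀ n ≥ N, ∀ r < q,
      |(q : ℝ) / n * ∑ j ∈ Finset.range n, FW a b ((r + q * j : ℕ) / n)
        - ∫ x in (0 : ℝ)..1, FW a b x| ≤ ε := by
  have hq' : (0 : ℝ) < q := by exact_mod_cast hq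
  obtain ⟨δ, hδ, H⟩ := Metric.uniformContinuous_iff.1 (FW_unif ha hb) (ε / (2 * q)) (by positivity)
  obtain ⟨N, hN⟩ := exists_nat_gt (max (q / δ) (2 * q / ε))
  refine ⟨N + 1, fun n hn r hr => ?_⟩
  have hn0 : (0 : ℝ) < n := by exact_mod_cast (by omega : 0 < n)
  have hNn : (N : ℝ) < n := by exact_mod_cast (by omega : N < n)
  have h1 : q / δ < n := lt_trans (lt_of_le_of_lt (le_max_left _ _) hN) hNn
  have h2 : 2 * q / ε < n := lt_trans (lt_of_le_of_lt (le_max_right _ _) hN) hNn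
  have hqn : (q : ℝ) / n < δ := by
    rw [div_lt_iff₀ hδ] at h1; rw [div_lt_iff₀ hn0]; linarith
  have hqn2 : (q : ℝ) / n ≤ ε / 2 := by
    rw [div_lt_iff₀ hε] at h2; rw [div_le_iff₀ hn0]; linarith
  have hint : ∀ u v : ℝ, IntervalIntegrable (FW a b) MeasureTheory.volume u v :=
    fun u v => (FW_cont ha hb).intervalIntegrable u v
  set pt : ℕ → ℝ := fun j => ((r + q * j : ℕ) : ℝ) / n with hpt
  have hstep : ∀ j, pt (j + 1) = pt j + q / n := by
    intro j; simp only [hpt]; push_cast; field_simp; ring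
  have hsum := intervalIntegral.sum_integral_adjacent_intervals (f := FW a b)
    (μ := MeasureTheory.volume) (a := pt) (n := n) (fun k _ => hint _ _)
  have hone : (1 : ℝ) ≤ pt n := by
    simp only [hpt]
    rw [le_div_iff₀ hn0, one_mul]
    exact_mod_cast (by nlinarith : n ≤ r + q * n)
  have htail : ∫ x in (1 : ℝ)..(pt n), FW a b x = 0 := by
    rw [intervalIntegral.integral_congr (g := fun _ => (0 : ℝ))]
    · simp
    · intro x hx
      rw [Set.uIcc_of_le hone] at hx
      exact FW_zero_right a hb hx.1
  have hp0 : pt 0 ≤ q / n ∧ 0 ≤ pt 0 := by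
    simp only [hpt]
    constructor
    · gcongr; simpa using hr.le
    · positivity
  have hhead : ‖∫ x in (0 : ℝ)..(pt 0), FW a b x‖ ≤ 1 * |pt 0 - 0| := by
    refine intervalIntegral.norm_integral_le_of_norm_le_const (fun x _ => ?_)
    rw [Real.norm_of_nonneg (FW_nonneg _ _ _)]
    exact FW_le_one ha hb x
  rw [sub_zero, abs_of_nonneg hp0.2, one_mul, Real.norm_eq_abs] at hhead
  have hI : ∫ x in (0 : ℝ)..1, FW a b x =
      (∫ x in (0 : ℝ)..(pt 0), FW a b x) + ∑ k ∈ Finset.range n, ∫ x in (pt k)..(pt (k + 1)), FW a b x := by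
    rw [hsum, intervalIntegral.integral_add_adjacent_intervals (hint _ _) (hint _ _),
      ← intervalIntegral.integral_add_adjacent_intervals (hint 0 1) (hint 1 (pt n)), htail, add_zero]
  have hterm : ∀ k, |(q : ℝ) / n * FW a b (pt k) - ∫ x in (pt k)..(pt (k + 1)), FW a b x|
      ≤ ε / (2 * q) * (q / n) := by
    intro k
    have hc : (q : ℝ) / n * FW a b (pt k) = ∫ x in (pt k)..(pt (k + 1)), FW a b (pt k) := by
      rw [intervalIntegral.integral_const, hstep]; simp
    rw [hc, ← intervalIntegral.integral_sub (by simp) (hint _ _)]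
    have := intervalIntegral.norm_integral_le_of_norm_le_const (a := pt k) (b := pt (k + 1))
      (C := ε / (2 * q)) (f := fun x => FW a b (pt k) - FW a b x) (fun x hx => ?_)
    · rw [hstep k, add_sub_cancel_left, abs_of_nonneg (by positivity : (0 : ℝ) ≤ q / n)] at this
      rw [hstep k]
      exact this
    · have hle : pt k ≤ pt (k + 1) := by rw [hstep]; linarith [div_pos hq' hn0]
      rw [Set.uIoc_of_le hle, hstep] at hx
      have hd : dist (pt k) x < δ := by
        rw [Real.dist_eq, abs_sub_comm, abs_of_pos (by linarith [hx.1])]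
        linarith [hx.2]
      have := H hd
      rw [Real.dist_eq] at this
      exact this.le
  rw [hI, Finset.mul_sum]
  have hb1 : |∑ k ∈ Finset.range n, ((q : ℝ) / n * FW a b (pt k) -
      ∫ x in (pt k)..(pt (k + 1)), FW a b x)| ≤ ε / 2 := by
    refine (Finset.abs_sum_le_sum_abs _ _).trans ?_
    refine (Finset.sum_le_sum (fun k _ => hterm k)).trans ?_
    rw [Finset.sum_const, Finset.card_range, nsmul_eq_mul]
    apply le_of_eq; field_simp
  rw [Finset.sum_sub_distrib] at hb1
  rw [abs_le] at hb1 hhead ⊢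
  constructor <;> linarith [hb1.1, hb1.2, hhead.1, hhead.2, hp0.1]

/-- normalized sum over a residue class -/
noncomputable def AW (a b : ℝ) (n d e : ℕ) : ℝ :=
  1 / (n : ℝ) * ∑ k ∈ (Finset.Ico 1 n).filter (fun k => d ∣ k ∧ e ∣ n - k), FW a b (k / n)

lemma AW_class {a b : ℝ} (ha : 0 < a) (hb : 0 < b) (n d e : ℕ) (hn : 0 < n) (hd : 0 < d) (he : 0 < e)
    (hg : Nat.gcd d e ∣ n) : ∃ r < Nat.lcm d e, 
      ∑ k ∈ (Finset.Ico 1 n).filter (fun k => d ∣ k ∧ e ∣ n - k), FW a b (k / n)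
      = ∑ j ∈ Finset.range n, FW a b ((r + Nat.lcm d e * j : ℕ) / n) := by
  have hn0 : (0 : ℝ) < n := by exact_mod_cast hn
  have hmod : 0 ≡ n [MOD Nat.gcd d e] := ((Nat.modEq_zero_iff_dvd).2 hg).symm
  have hq : 0 < Nat.lcm d e := Nat.lcm_pos hd he
  obtain ⟨hr1, hr2⟩ := (Nat.chineseRemainder' hmod).2
  have hr3 := Nat.chineseRemainder'_lt_lcm hmod hd.ne' he.ne'
  set r : ℕ := (Nat.chineseRemainder' hmod : ℕ) with hr
  refine ⟨r, hr3, ?_⟩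
  have hiff : ∀ k, k ≤ n → ((d ∣ k ∧ e ∣ n - k) ↔ k ≡ r [MOD Nat.lcm d e]) := by
    intro k hk
    have e1 : d ∣ k ↔ k ≡ r [MOD d] := by
      rw [← Nat.modEq_zero_iff_dvd]
      exact ⟨fun h => h.trans hr1.symm, fun h => h.trans hr1⟩
    have e2 : e ∣ n - k ↔ k ≡ r [MOD e] := by
      rw [← Nat.modEq_iff_dvd' hk]
      exact ⟨fun h => h.trans hr2.symm, fun h => h.trans hr2⟩
    rw [e1, e2]
    exact ⟨fun h => Nat.mod_lcm h.1 h.2, fun h => ⟨h.of_dvd (Nat.dvd_lcm_left d e),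
      h.of_dvd (Nat.dvd_lcm_right d e)⟩⟩
  have hinj : Set.InjOn (fun j : ℕ => r + Nat.lcm d e * j) (Finset.range n : Set ℕ) := by
    intro x _ y _ h
    simp only [add_right_inj] at h
    exact Nat.eq_of_mul_eq_mul_left hq h
  rw [← Finset.sum_image (g := fun j : ℕ => r + Nat.lcm d e * j) (f := fun k : ℕ => FW a b (k / n)) hinj]
  refine Finset.sum_subset (fun k hk => ?_) (fun k hk hk' => ?_)
  · simp only [Finset.mem_filter, Finset.mem_Ico] at hk
    have h3 := (hiff k hk.1.2.le).1 hk.2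
    have hkr : k % Nat.lcm d e = r := by
      have := h3; unfold Nat.ModEq at this; rwa [Nat.mod_eq_of_lt hr3] at this
    refine Finset.mem_image.2 ⟨k / Nat.lcm d e, ?_, ?_⟩
    · exact Finset.mem_range.2 (lt_of_le_of_lt (Nat.div_le_self _ _) hk.1.2)
    · have := Nat.mod_add_div k (Nat.lcm d e)
      rw [hkr] at this; exact this
  · obtain ⟨j, _, hj⟩ := Finset.mem_image.1 hk
    rcases Nat.eq_zero_or_pos k with h0 | h0
    · apply FW_zero_left b ha; simp [h0]
    · apply FW_zero_right a hb
      rw [le_div_iff₀ hn0, one_mul]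
      by_contra hlt
      push Not at hlt
      have hlt' : k < n := by exact_mod_cast hlt
      apply hk'
      simp only [Finset.mem_filter, Finset.mem_Ico]
      refine ⟨⟨h0, hlt'⟩, (hiff k hlt'.le).2 ?_⟩
      rw [← hj]
      simp [Nat.ModEq]

lemma AW_tendsto {a b : ℝ} (ha : 0 < a) (hb : 0 < b) (d e : ℕ) (hd : 0 < d) (he : 0 < e) :
    Tendsto (fun n : ℕ => AW a b n d e - (∫ x in (0 : ℝ)..1, FW a b x) *
      (if Nat.gcd d e ∣ n then 1 / (Nat.lcm d e : ℝ) else 0)) atTop (nhds 0) := by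
  rw [Metric.tendsto_atTop]
  intro ε hε
  have hq : 0 < Nat.lcm d e := Nat.lcm_pos hd he
  have hq' : (0 : ℝ) < (Nat.lcm d e : ℕ) := by exact_mod_cast hq
  obtain ⟨N, hN⟩ := riemannW ha hb (Nat.lcm d e) hq (ε := ε * Nat.lcm d e / 2) (by positivity)
  refine ⟨N + 1, fun n hn => ?_⟩
  rw [Real.dist_eq, sub_zero]
  have hn0 : (0 : ℝ) < n := by exact_mod_cast (by omega : 0 < n)
  by_cases hg : Nat.gcd d e ∣ n
  · rw [if_pos hg]
    obtain ⟨r, hr, h⟩ := AW_class ha hb n d e (by omega) hd he hg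
    have := hN n (by omega) r hr
    unfold AW
    rw [h]
    set s := ∑ j ∈ Finset.range n, FW a b ((r + Nat.lcm d e * j : ℕ) / n)
    set I := ∫ x in (0 : ℝ)..1, FW a b x
    have e1 : 1 / (n : ℝ) * s - I * (1 / (Nat.lcm d e : ℝ)) =
      ((Nat.lcm d e : ℝ) / n * s - I) / (Nat.lcm d e : ℝ) := by field_simp
    rw [e1, abs_div, abs_of_pos hq', div_lt_iff₀ hq']
    have : 0 < ε * (Nat.lcm d e : ℝ) := by positivity
    linarith
  · rw [if_neg hg]
    unfold AW
    rw [Finset.filter_false_of_mem]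
    · simpa using hε
    · intro k hk h
      apply hg
      have hk' := Finset.mem_Ico.1 hk
      have h1 := (Nat.gcd_dvd_left d e).trans h.1
      have h2 := (Nat.gcd_dvd_right d e).trans h.2
      have := dvd_add h1 h2
      rwa [Nat.add_sub_cancel' hk'.2.le] at this

/-- tail of the divisor sum -/
noncomputable def tW (a : ℝ) (D k : ℕ) : ℝ := ∑ d ∈ k.divisors.filter (fun d => D < d), (d : ℝ) ^ (-a)

/-- truncated divisor sum -/
noncomputable def lW (a : ℝ) (D k : ℕ) : ℝ := ∑ d ∈ k.divisors.filter (fun d => ¬ D < d), (d : ℝ) ^ (-a)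

lemma tW_nonneg (a : ℝ) (D k : ℕ) : 0 ≤ tW a D k := Finset.sum_nonneg (fun d _ => by positivity)
lemma lW_nonneg (a : ℝ) (D k : ℕ) : 0 ≤ lW a D k := Finset.sum_nonneg (fun d _ => by positivity)
lemma sigmaR_nonneg (a : ℝ) (k : ℕ) : 0 ≤ sigmaR a k := Finset.sum_nonneg (fun d _ => by positivity)

lemma sigmaR_split (a : ℝ) (D k : ℕ) : sigmaR (-a) k = tW a D k + lW a D k :=
  (Finset.sum_filter_add_sum_filter_not _ _ _).symm

lemma tW_zero (a : ℝ) (k : ℕ) : tW a 0 k = sigmaR (-a) k := by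
  unfold tW sigmaR
  rw [Finset.filter_true_of_mem]
  intro d hd; exact Nat.pos_of_mem_divisors hd

lemma tW_eq (a : ℝ) (D n k : ℕ) (hk : k ∈ Finset.Ico 1 n) :
    tW a D k = ∑ d ∈ Finset.Ioo D n, if d ∣ k then (d : ℝ) ^ (-a) else 0 := by
  rw [Finset.mem_Ico] at hk
  rw [← Finset.sum_filter]
  unfold tW
  refine Finset.sum_congr ?_ (fun _ _ => rfl)
  ext d
  simp only [Finset.mem_filter, Nat.mem_divisors, Finset.mem_Ioo]
  constructor
  · rintro ⟨⟨h1, h2⟩, h3⟩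
    exact ⟨⟨h3, lt_of_le_of_lt (Nat.le_of_dvd (by omega) h1) hk.2⟩, h1⟩
  · rintro ⟨⟨h1, h2⟩, h3⟩
    exact ⟨⟨h3, by omega⟩, h1⟩

lemma lW_eq (a : ℝ) (D k : ℕ) (hk : 0 < k) :
    lW a D k = ∑ d ∈ Finset.Icc 1 D, if d ∣ k then (d : ℝ) ^ (-a) else 0 := by
  rw [← Finset.sum_filter]
  unfold lW
  refine Finset.sum_congr ?_ (fun _ _ => rfl)
  ext d
  simp only [Finset.mem_filter, Nat.mem_divisors, Finset.mem_Icc]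
  constructor
  · rintro ⟨⟨h1, h2⟩, h3⟩
    exact ⟨⟨Nat.pos_of_dvd_of_pos h1 hk, by omega⟩, h1⟩
  · rintro ⟨⟨h1, h2⟩, h3⟩
    exact ⟨⟨h3, by omega⟩, by omega⟩

lemma count_lcm (n d e : ℕ) (hd : 0 < d) (he : 0 < e) :
    (∑ k ∈ Finset.Ico 1 n, if d ∣ k ∧ e ∣ k then (1 : ℝ) else 0) ≤ n / (Nat.lcm d e : ℝ) := by
  have hq' : (0 : ℝ) < (Nat.lcm d e : ℕ) := by exact_mod_cast Nat.lcm_pos hd he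
  rw [← Finset.sum_filter, Finset.sum_const, nsmul_eq_mul, mul_one]
  have h1 : ((Finset.Ico 1 n).filter (fun k => d ∣ k ∧ e ∣ k)).card ≤ n / Nat.lcm d e := by
    rw [← Nat.Ioc_filter_dvd_card_eq_div]
    refine Finset.card_le_card (fun k hk => ?_)
    simp only [Finset.mem_filter, Finset.mem_Ico, Finset.mem_Ioc] at hk ⊢
    exact ⟨⟨by omega, by omega⟩, Nat.lcm_dvd hk.2.1 hk.2.2⟩
  calc (((Finset.Ico 1 n).filter (fun k => d ∣ k ∧ e ∣ k)).card : ℝ) ≤ ((n / Nat.lcm d e : ℕ) : ℝ) := by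
        exact_mod_cast h1
    _ ≤ _ := Nat.cast_div_le

lemma tW_sq (a : ℝ) (D n : ℕ) :
    ∑ k ∈ Finset.Ico 1 n, tW a D k ^ 2 ≤
      n * ∑ p ∈ Finset.Ioo D n ×ˢ Finset.Ioo D n, cW a a p := by
  have h1 : ∀ k ∈ Finset.Ico 1 n, tW a D k ^ 2 = ∑ p ∈ Finset.Ioo D n ×ˢ Finset.Ioo D n,
      ((p.1 : ℝ) ^ (-a) * (p.2 : ℝ) ^ (-a)) * (if p.1 ∣ k ∧ p.2 ∣ k then (1 : ℝ) else 0) := by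
    intro k hk
    rw [sq, tW_eq a D n k hk, Finset.sum_mul_sum, Finset.sum_product]
    refine Finset.sum_congr rfl (fun d _ => Finset.sum_congr rfl (fun e _ => ?_))
    by_cases h1 : d ∣ k <;> by_cases h2 : e ∣ k <;> simp [h1, h2]
  rw [Finset.sum_congr rfl h1, Finset.sum_comm, Finset.mul_sum]
  refine Finset.sum_le_sum (fun p hp => ?_)
  simp only [Finset.mem_product, Finset.mem_Ioo] at hp
  rw [← Finset.mul_sum]
  refine (mul_le_mul_of_nonneg_left (count_lcm n p.1 p.2 (by omega) (by omega))
    (by positivity)).trans (le_of_eq ?_)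
  unfold cW; ring

lemma cW_tail {a b : ℝ} (ha : 0 < a) (hb : 0 < b) {ε : ℝ} (hε : 0 < ε) :
    ∃ D0 : ℕ, ∀ D ≥ D0, ∀ t : Finset (ℕ × ℕ), (∀ p ∈ t, D < p.1 ∨ D < p.2) →
      ∑ p ∈ t, cW a b p ≤ ε := by
  obtain ⟨s, hs⟩ := summable_iff_vanishing_norm.1 (summable_cW ha hb) ε hε
  refine ⟨s.sup (fun p => max p.1 p.2), fun D hD t ht => ?_⟩
  have := hs t (Finset.disjoint_left.2 (fun p hp hps => ?_))
  · exact (le_abs_self _).trans this.le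
  · have h1 : max p.1 p.2 ≤ _ := Finset.le_sup (f := fun p : ℕ × ℕ => max p.1 p.2) hps
    have h2 := ht p hp
    have h3 := le_max_left p.1 p.2
    have h4 := le_max_right p.1 p.2
    omega

lemma reflectW (f : ℕ → ℕ → ℝ) (n : ℕ) :
    ∑ k ∈ Finset.Ico 1 n, f k (n - k) = ∑ k ∈ Finset.Ico 1 n, f (n - k) k := by
  refine Finset.sum_nbij' (fun k => n - k) (fun k => n - k) ?_ ?_ ?_ ?_ ?_
  · intro k hk; simp only [Finset.mem_Ico] at hk ⊢; omega
  · intro k hk; simp only [Finset.mem_Ico] at hk ⊢; omega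
  · intro k hk; simp only [Finset.mem_Ico] at hk; omega
  · intro k hk; simp only [Finset.mem_Ico] at hk; omega
  · intro k hk; simp only [Finset.mem_Ico] at hk
    rw [Nat.sub_sub_self (by omega)]

lemma tail_cross {a b : ℝ} (ha : 0 < a) (hb : 0 < b) {η : ℝ} (hη : 0 < η) :
    ∃ D0 : ℕ, ∀ D ≥ D0, ∀ n : ℕ,
      ∑ k ∈ Finset.Ico 1 n, tW a D k * sigmaR (-b) (n - k) ≤ n * η := by
  set M := (∑' p, cW b b p) + 1 with hM
  have hM0 : 0 < M := by
    have : 0 ≤ ∑' p, cW b b p := tsum_nonneg (cW_nonneg b b)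
    linarith
  obtain ⟨D0, hD0⟩ := cW_tail ha ha (ε := η ^ 2 / M) (by positivity)
  refine ⟨D0, fun D hD n => ?_⟩
  have h1 : ∑ k ∈ Finset.Ico 1 n, tW a D k ^ 2 ≤ n * (η ^ 2 / M) := by
    refine (tW_sq a D n).trans (mul_le_mul_of_nonneg_left (hD0 D hD _ ?_) (by positivity))
    intro p hp
    simp only [Finset.mem_product, Finset.mem_Ioo] at hp
    exact Or.inl hp.1.1
  have h2 : ∑ k ∈ Finset.Ico 1 n, sigmaR (-b) (n - k) ^ 2 ≤ n * M := by
    rw [reflectW (fun _ m => sigmaR (-b) m ^ 2) n]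
    simp_rw [← tW_zero]
    refine (tW_sq b 0 n).trans (mul_le_mul_of_nonneg_left ?_ (by positivity))
    have := (summable_cW hb hb).sum_le_tsum (Finset.Ioo 0 n ×ˢ Finset.Ioo 0 n)
      (fun p _ => cW_nonneg b b p)
    linarith
  have h3 := Finset.sum_mul_sq_le_sq_mul_sq (Finset.Ico 1 n) (fun k => tW a D k)
    (fun k => sigmaR (-b) (n - k))
  have h4 : (∑ k ∈ Finset.Ico 1 n, tW a D k * sigmaR (-b) (n - k)) ^ 2 ≤ (n * η) ^ 2 := by
    refine h3.trans ((mul_le_mul h1 h2 (Finset.sum_nonneg (fun _ _ => sq_nonneg _))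
      (by positivity)).trans (le_of_eq ?_))
    field_simp
  exact le_of_sq_le_sq h4 (by positivity)

/-- normalized convolution -/
noncomputable def XW (a b : ℝ) (n : ℕ) : ℝ :=
  1 / (n : ℝ) * ∑ k ∈ Finset.Ico 1 n, FW a b (k / n) * (sigmaR (-a) k * sigmaR (-b) (n - k))

lemma SR_eq (a b : ℝ) (n : ℕ) (hn : 0 < n) : SR a b n = (n : ℝ) ^ (a + b + 1) * XW a b n := by
  have hn0 : (0 : ℝ) < n := by exact_mod_cast hn
  unfold SR XW
  rw [← mul_assoc, Finset.mul_sum]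
  refine Finset.sum_congr rfl (fun k hk => ?_)
  rw [Finset.mem_Ico] at hk
  have hk0 : (0 : ℝ) < k := by exact_mod_cast hk.1
  have hkn : (k : ℝ) < n := by exact_mod_cast hk.2
  have hx : 1 - (k : ℝ) / n = ((n : ℝ) - k) / n := by field_simp
  rw [sigmaR_neg a k, sigmaR_neg b (n - k), FW, hx, Nat.cast_sub hk.2.le,
    max_eq_left (by positivity), max_eq_left (div_nonneg (by linarith) hn0.le),
    Real.div_rpow hk0.le hn0.le, Real.div_rpow (by linarith) hn0.le, Real.rpow_add hn0,
    Real.rpow_add hn0, Real.rpow_one]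
  have := (Real.rpow_pos_of_pos hn0 a).ne'
  have := (Real.rpow_pos_of_pos hn0 b).ne'
  field_simp

/-- truncated convolution -/
noncomputable def YW (a b : ℝ) (D n : ℕ) : ℝ :=
  1 / (n : ℝ) * ∑ k ∈ Finset.Ico 1 n, FW a b (k / n) * (lW a D k * lW b D (n - k))

lemma YW_eq (a b : ℝ) (D n : ℕ) : YW a b D n = ∑ p ∈ Finset.Icc 1 D ×ˢ Finset.Icc 1 D,
    (p.1 : ℝ) ^ (-a) * (p.2 : ℝ) ^ (-b) * AW a b n p.1 p.2 := by
  unfold YW AW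
  have h1 : ∀ k ∈ Finset.Ico 1 n, FW a b (k / n) * (lW a D k * lW b D (n - k)) =
      ∑ p ∈ Finset.Icc 1 D ×ˢ Finset.Icc 1 D, (p.1 : ℝ) ^ (-a) * (p.2 : ℝ) ^ (-b) *
        (if p.1 ∣ k ∧ p.2 ∣ n - k then FW a b (k / n) else 0) := by
    intro k hk
    rw [Finset.mem_Ico] at hk
    rw [lW_eq a D k (by omega), lW_eq b D (n - k) (by omega), Finset.sum_mul_sum,
      Finset.sum_product, Finset.mul_sum]
    refine Finset.sum_congr rfl (fun d _ => ?_)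
    rw [Finset.mul_sum]
    refine Finset.sum_congr rfl (fun e _ => ?_)
    by_cases h1 : d ∣ k <;> by_cases h2 : e ∣ n - k <;> simp [h1, h2]
    ring
  rw [Finset.sum_congr rfl h1, Finset.sum_comm, Finset.mul_sum]
  refine Finset.sum_congr rfl (fun p _ => ?_)
  rw [← Finset.mul_sum, ← Finset.sum_filter]
  ring

lemma XY_bound {a b : ℝ} (ha : 0 < a) (hb : 0 < b) {η : ℝ} (hη : 0 < η) :
    ∃ D0 : ℕ, ∀ D ≥ D0, ∀ n : ℕ, 0 < n → |XW a b n - YW a b D n| ≤ η := by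
  obtain ⟨D1, h1⟩ := tail_cross ha hb (half_pos hη)
  obtain ⟨D2, h2⟩ := tail_cross hb ha (half_pos hη)
  refine ⟨max D1 D2, fun D hD n hn => ?_⟩
  have hn0 : (0 : ℝ) < n := by exact_mod_cast hn
  have k1 := h1 D (le_trans (le_max_left _ _) hD) n
  have k2 := h2 D (le_trans (le_max_right _ _) hD) n
  rw [reflectW (fun x y => tW b D x * sigmaR (-a) y) n] at k2
  unfold XW YW
  rw [← mul_sub, ← Finset.sum_sub_distrib]
  have hle : ∀ k ∈ Finset.Ico 1 n, FW a b (k / n) * (sigmaR (-a) k * sigmaR (-b) (n - k)) -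
      FW a b (k / n) * (lW a D k * lW b D (n - k)) ≤
      tW a D k * sigmaR (-b) (n - k) + tW b D (n - k) * sigmaR (-a) k ∧
      0 ≤ FW a b (k / n) * (sigmaR (-a) k * sigmaR (-b) (n - k)) -
      FW a b (k / n) * (lW a D k * lW b D (n - k)) := by
    intro k _
    rw [← mul_sub]
    have f0 := FW_nonneg a b (k / n)
    have f1 := FW_le_one ha hb ((k : ℝ) / n)
    have p1 := tW_nonneg a D k
    have p2 := tW_nonneg b D (n - k)
    have p3 := lW_nonneg a D k
    have p4 := lW_nonneg b D (n - k)
    rw [sigmaR_split a D k, sigmaR_split b D (n - k)]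
    set x := tW a D k
    set y := tW b D (n - k)
    set z := lW a D k
    set w := lW b D (n - k)
    have e : (x + z) * (y + w) - z * w = x * (y + w) + z * y := by ring
    have e0 : 0 ≤ x * (y + w) + z * y := by positivity
    rw [e]
    refine ⟨?_, by positivity⟩
    refine (mul_le_of_le_one_left e0 f1).trans ?_
    have : 0 ≤ y * x := by positivity
    linarith
  have hs := Finset.sum_le_sum (fun k hk => (hle k hk).1)
  have hs0 := Finset.sum_nonneg (fun k hk => (hle k hk).2)
  rw [Finset.sum_add_distrib] at hs
  rw [abs_of_nonneg (by positivity), one_div, inv_mul_le_iff₀ hn0]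
  linarith

lemma box_bound {a b : ℝ} (ha : 0 < a) (hb : 0 < b) {η : ℝ} (hη : 0 < η) :
    ∃ D0 : ℕ, ∀ D ≥ D0, ∀ n : ℕ,
      |∑' p : ℕ × ℕ, (if Nat.gcd p.1 p.2 ∣ n then cW a b p else 0) -
        ∑ p ∈ Finset.Icc 1 D ×ˢ Finset.Icc 1 D, (if Nat.gcd p.1 p.2 ∣ n then cW a b p else 0)|
        ≤ η := by
  obtain ⟨D0, h⟩ := cW_tail ha hb hη
  refine ⟨D0, fun D hD n => ?_⟩
  set u : ℕ × ℕ → ℝ := fun p => if Nat.gcd p.1 p.2 ∣ n then cW a b p else 0 with hu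
  have u0 : ∀ p, 0 ≤ u p := by
    intro p; simp only [hu]; split_ifs
    · exact cW_nonneg _ _ _
    · exact le_rfl
  have u1 : ∀ p, u p ≤ cW a b p := by
    intro p; simp only [hu]; split_ifs
    · exact le_rfl
    · exact cW_nonneg _ _ _
  have us : Summable u := Summable.of_nonneg_of_le u0 u1 (summable_cW ha hb)
  have g1 := us.sum_le_tsum (Finset.Icc 1 D ×ˢ Finset.Icc 1 D) (fun p _ => u0 p)
  have g2 : ∑' p, u p ≤ ∑ p ∈ Finset.Icc 1 D ×ˢ Finset.Icc 1 D, u p + η := by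
    refine us.tsum_le_of_sum_le (fun t => ?_)
    rw [← Finset.sum_filter_add_sum_filter_not t (fun p => D < p.1 ∨ D < p.2), add_comm]
    refine add_le_add ?_ ((Finset.sum_le_sum (fun p _ => u1 p)).trans
      (h D hD _ (fun p hp => (Finset.mem_filter.1 hp).2)))
    rw [← Finset.sum_filter_ne_zero]
    refine Finset.sum_le_sum_of_subset_of_nonneg (fun p hp' => ?_) (fun p _ _ => u0 p)
    obtain ⟨hp, hne⟩ := Finset.mem_filter.1 hp'
    have hp2 := (Finset.mem_filter.1 hp).2
    push Not at hp2
    have : ¬ (p.1 = 0 ∨ p.2 = 0) := by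
      intro h0
      apply hne
      have := cW_zero ha hb p.1 p.2 h0
      simp only [hu, Prod.mk.eta] at this ⊢
      rw [this, ite_self]
    simp only [Finset.mem_product, Finset.mem_Icc]
    omega
  change |∑' p, u p - ∑ p ∈ Finset.Icc 1 D ×ˢ Finset.Icc 1 D, u p| ≤ η
  rw [abs_of_nonneg (by linarith)]
  linarith

lemma Y_tendsto {a b : ℝ} (ha : 0 < a) (hb : 0 < b) (D : ℕ) :
    Tendsto (fun n : ℕ => YW a b D n - (∫ x in (0 : ℝ)..1, FW a b x) *
      ∑ p ∈ Finset.Icc 1 D ×ˢ Finset.Icc 1 D, (if Nat.gcd p.1 p.2 ∣ n then cW a b p else 0))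
      atTop (nhds 0) := by
  have h : Tendsto (fun n : ℕ => ∑ p ∈ Finset.Icc 1 D ×ˢ Finset.Icc 1 D,
      (p.1 : ℝ) ^ (-a) * (p.2 : ℝ) ^ (-b) * (AW a b n p.1 p.2 - (∫ x in (0 : ℝ)..1, FW a b x) *
      (if Nat.gcd p.1 p.2 ∣ n then 1 / (Nat.lcm p.1 p.2 : ℝ) else 0))) atTop
      (nhds (∑ p ∈ Finset.Icc 1 D ×ˢ Finset.Icc 1 D, (p.1 : ℝ) ^ (-a) * (p.2 : ℝ) ^ (-b) * 0)) := by
    refine tendsto_finsetSum _ (fun p hp => ?_)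
    simp only [Finset.mem_product, Finset.mem_Icc] at hp
    exact (AW_tendsto ha hb p.1 p.2 (by omega) (by omega)).const_mul _
  simp only [mul_zero, Finset.sum_const_zero] at h
  refine h.congr (fun n => ?_)
  rw [YW_eq, Finset.mul_sum, ← Finset.sum_sub_distrib]
  refine Finset.sum_congr rfl (fun p _ => ?_)
  unfold cW
  split_ifs <;> ring

lemma X_tendsto {a b : ℝ} (ha : 0 < a) (hb : 0 < b) :
    Tendsto (fun n : ℕ => XW a b n - (∫ x in (0 : ℝ)..1, FW a b x) *
      (zetaR (a + 1) * zetaR (b + 1) / zetaR (a + b + 2) * sigmaR (-(a + b + 1)) n))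
      atTop (nhds 0) := by
  rw [Metric.tendsto_atTop]
  intro ε hε
  set I := ∫ x in (0 : ℝ)..1, FW a b x with hI
  obtain ⟨D1, h1⟩ := XY_bound ha hb (η := ε / 4) (by positivity)
  obtain ⟨D2, h2⟩ := box_bound ha hb (η := ε / 4 / (|I| + 1)) (by positivity)
  set D := max D1 D2
  obtain ⟨N, hN⟩ := Metric.tendsto_atTop.1 (Y_tendsto ha hb D) (ε / 4) (by positivity)
  refine ⟨N + 1, fun n hn => ?_⟩
  have k1 := h1 D (le_max_left _ _) n (by omega)
  have k2 := h2 D (le_max_right _ _) n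
  have k3 := hN n (by omega)
  rw [tsum_gcdW ha hb n (by omega)] at k2
  rw [Real.dist_eq, sub_zero] at k3 ⊢
  rw [← hI] at k3
  set K := zetaR (a + 1) * zetaR (b + 1) / zetaR (a + b + 2) * sigmaR (-(a + b + 1)) n
  set B := ∑ p ∈ Finset.Icc 1 D ×ˢ Finset.Icc 1 D, (if Nat.gcd p.1 p.2 ∣ n then cW a b p else 0)
  have k4 : |I * (K - B)| ≤ ε / 4 := by
    rw [abs_mul]
    calc |I| * |K - B| ≤ (|I| + 1) * (ε / 4 / (|I| + 1)) := by
          gcongr; linarith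
      _ = ε / 4 := by field_simp
  have e : XW a b n - I * K = (XW a b n - YW a b D n) + (YW a b D n - I * B) - I * (K - B) := by ring
  rw [e]
  rw [abs_le] at k1 k4
  rw [abs_lt] at k3 ⊢
  constructor <;> linarith [k1.1, k1.2, k3.1, k3.2, k4.1, k4.2]

theorem stmt3 (a b : ℝ) (ha : 0 < a) (hb : 0 < b) :
    Tendsto (fun n : ℕ =>
        SR a b n /
          ((Real.Gamma (a + 1) * Real.Gamma (b + 1) / Real.Gamma (a + b + 2))
            * (zetaR (a + 1) * zetaR (b + 1) / zetaR (a + b + 2)) * sigmaR (a + b + 1) n))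
      atTop (nhds 1) := by
  have h := X_tendsto ha hb
  rw [FW_integral ha hb] at h
  have hI : 0 < Real.Gamma (a + 1) * Real.Gamma (b + 1) / Real.Gamma (a + b + 2) :=
    div_pos (mul_pos (Real.Gamma_pos_of_pos (by linarith)) (Real.Gamma_pos_of_pos (by linarith)))
      (Real.Gamma_pos_of_pos (by linarith))
  have hK : 0 < zetaR (a + 1) * zetaR (b + 1) / zetaR (a + b + 2) :=
    div_pos (mul_pos (zetaR_pos (by linarith)) (zetaR_pos (by linarith))) (zetaR_pos (by linarith))
  set I := Real.Gamma (a + 1) * Real.Gamma (b + 1) / Real.Gamma (a + b + 2)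
  set K := zetaR (a + 1) * zetaR (b + 1) / zetaR (a + b + 2)
  rw [tendsto_iff_norm_sub_tendsto_zero]
  have h' := (h.abs).div_const (I * K)
  rw [abs_zero, zero_div] at h'
  refine squeeze_zero' (Eventually.of_forall fun n => norm_nonneg _) ?_ h'
  filter_upwards [eventually_gt_atTop 0] with n hn
  have hn0 : (0 : ℝ) < n := by exact_mod_cast hn
  have hs := sigmaR_ge_one (-(a + b + 1)) n hn.ne'
  rw [SR_eq a b n hn, sigmaR_neg (a + b + 1) n]
  set s := sigmaR (-(a + b + 1)) n
  have hs0 : 0 < s := by linarith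
  have hp := Real.rpow_pos_of_pos hn0 (a + b + 1)
  set w := (n : ℝ) ^ (a + b + 1)
  have e : w * XW a b n / (I * K * (w * s)) - 1 = (XW a b n - I * (K * s)) / (I * K * s) := by
    field_simp
  rw [e, Real.norm_eq_abs, abs_div, abs_of_pos (by positivity : 0 < I * K * s)]
  exact div_le_div_of_nonneg_left (abs_nonneg _) (by positivity)
    (le_mul_of_one_le_right (by positivity) hs)
end

section
/- Let b be a complex number with Re(b) > 0, let c > 0 be real, and let t > 0 be a real number with t ≠ 1. Then (1/(2π)) ∫_{−∞}^{∞} [Γ(c+iy)/Γ(c+iy+b+1)]·t^{c+iy} dy equals 0 if 0 < t < 1, and equals (1 − t^{−1})^b / Γ(b+1) if t > 1. -/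
open Complex MeasureTheory

lemma beta_bound (b : ℂ) (δ : ℝ) (hδ : 0 < δ) (hδ1 : δ < 1) (hδb : δ ≤ b.re) (w : ℂ)
    (hw : 1 < w.re) :
    ‖betaIntegral w b‖ ≤ (1 / δ + (1 + ‖b - 1‖ / (1 - δ))) * ‖w‖ ^ (-δ) := by
  have hb : 0 < b.re := hδ.trans_le hδb
  have hw0 : 0 < w.re := by linarith
  have hwn : 1 < ‖w‖ := hw.trans_le (re_le_norm w)
  have hwn0 : 0 < ‖w‖ := by linarith
  have hwne : w ≠ 0 := norm_pos_iff.mp hwn0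
  set ε : ℝ := ‖w‖⁻¹ with hε
  have hε0 : 0 < ε := by positivity
  have hε1 : ε < 1 := inv_lt_one_of_one_lt₀ hwn
  have hconv := betaIntegral_convergent hw0 hb
  have hc1 := hconv.mono_set (c := 0) (d := 1 - ε) (by
    rw [Set.uIcc_of_le (by linarith), Set.uIcc_of_le (by linarith)]
    exact Set.Icc_subset_Icc le_rfl (by linarith))
  have hc2 := hconv.mono_set (c := 1 - ε) (d := 1) (by
    rw [Set.uIcc_of_le (by linarith), Set.uIcc_of_le (by linarith)]
    exact Set.Icc_subset_Icc (by linarith) le_rfl)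
  have hsplit : betaIntegral w b = (∫ x : ℝ in (0:ℝ)..(1 - ε), (x : ℂ) ^ (w - 1) * (1 - (x : ℂ)) ^ (b - 1))
      + ∫ x : ℝ in (1 - ε)..1, (x : ℂ) ^ (w - 1) * (1 - (x : ℂ)) ^ (b - 1) :=
    (intervalIntegral.integral_add_adjacent_intervals hc1 hc2).symm
  -- norm bounds
  have hnx : ∀ x : ℝ, 0 < x → x ≤ 1 → ∀ z : ℂ, 0 ≤ z.re → ‖(x : ℂ) ^ z‖ ≤ 1 := by
    intro x hx hx1 z hz
    rw [norm_cpow_eq_rpow_re_of_pos hx]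
    exact Real.rpow_le_one hx.le hx1 hz
  have hn1 : ∀ x : ℝ, 0 ≤ x → x < 1 → ∀ k : ℝ, ∀ z : ℂ, δ - k ≤ z.re →
      ‖(1 - (x : ℂ)) ^ z‖ ≤ (1 - x) ^ (δ - k) := by
    intro x hx hx1 k z hz
    have : (1 - (x : ℂ)) = ((1 - x : ℝ) : ℂ) := by push_cast; rfl
    rw [this, norm_cpow_eq_rpow_re_of_pos (by linarith)]
    exact Real.rpow_le_rpow_of_exponent_ge (by linarith) (by linarith) hz
  have hεδ : ε ^ δ = ‖w‖ ^ (-δ) := by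
    rw [hε, Real.inv_rpow hwn0.le, Real.rpow_neg hwn0.le]
  -- near part
  have hnear : ‖∫ x : ℝ in (1 - ε)..1, (x : ℂ) ^ (w - 1) * (1 - (x : ℂ)) ^ (b - 1)‖
      ≤ 1 / δ * ‖w‖ ^ (-δ) := by
    have hval : ∫ x : ℝ in (1 - ε)..1, (1 - x) ^ (δ - 1) = 1 / δ * ‖w‖ ^ (-δ) := by
      rw [intervalIntegral.integral_comp_sub_left (fun x : ℝ => x ^ (δ - 1)) 1,
        integral_rpow (Or.inl (by linarith)), ← hεδ]
      simp only [sub_self, sub_sub_cancel, sub_add_cancel]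
      rw [Real.zero_rpow hδ.ne']; ring
    rw [← hval]
    refine intervalIntegral.norm_integral_le_of_norm_le (by linarith) ?_ ?_
    · have : ∀ᵐ x : ℝ, x ≠ 1 := by simp [ae_iff]
      filter_upwards [this] with x hx1 hx
      have hx0 : 0 < x := by linarith [hx.1]
      have hx1' : x < 1 := lt_of_le_of_ne hx.2 hx1
      rw [norm_mul]
      calc _ ≤ 1 * (1 - x) ^ (δ - 1) := mul_le_mul (hnx x hx0 hx.2 _ (by simp; linarith))
            (hn1 x hx0.le hx1' 1 _ (by simp; linarith)) (norm_nonneg _) zero_le_one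
        _ = _ := one_mul _
    · have := (intervalIntegral.intervalIntegrable_rpow' (a := ε) (b := 0) (r := δ - 1)
        (by linarith)).comp_sub_left 1
      simpa using this
  have hεm : ‖w‖⁻¹ * ε ^ (δ - 1) = ‖w‖ ^ (-δ) := by
    rw [← hεδ, Real.rpow_sub hε0, Real.rpow_one, ← hε]; field_simp
  -- far part
  have hfar : ‖∫ x : ℝ in (0:ℝ)..(1 - ε), (x : ℂ) ^ (w - 1) * (1 - (x : ℂ)) ^ (b - 1)‖
      ≤ (1 + ‖b - 1‖ / (1 - δ)) * ‖w‖ ^ (-δ) := by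
    have hne : ∀ x ∈ Set.uIcc 0 (1 - ε), (1 - (x : ℂ)) ∈ slitPlane := by
      intro x hx
      rw [Set.uIcc_of_le (by linarith)] at hx
      left; simp; linarith [hx.2]
    have hcpow : ∀ z : ℂ, ContinuousOn (fun x : ℝ => (1 - (x : ℂ)) ^ z) (Set.uIcc 0 (1 - ε)) := by
      intro z
      exact ContinuousOn.cpow_const (by fun_prop) hne
    have hxpow : ∀ z : ℂ, 0 < z.re → Continuous (fun x : ℝ => (x : ℂ) ^ z) :=
      fun z hz => continuous_ofReal_cpow_const hz
    have hibp := intervalIntegral.integral_mul_deriv_eq_deriv_mul_of_hasDerivAt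
      (a := 0) (b := 1 - ε) (u := fun x : ℝ => (1 - (x : ℂ)) ^ (b - 1))
      (v := fun x : ℝ => (x : ℂ) ^ w / w)
      (u' := fun x : ℝ => -((b - 1) * (1 - (x : ℂ)) ^ (b - 2)))
      (v' := fun x : ℝ => (x : ℂ) ^ (w - 1))
      (hcpow _) ((hxpow w hw0).div_const w).continuousOn
      (by
        intro x hx
        have hx' := hne x (Set.Ioo_subset_Icc_self hx)
        have h1 : HasDerivAt (fun y : ℂ => 1 - y) (-1) (x : ℂ) := by
          simpa using (hasDerivAt_id (x : ℂ)).const_sub 1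
        have := (h1.cpow_const (c := b - 1) hx').comp_ofReal
        convert! this using 1
        rw [show b - 1 - 1 = b - 2 by ring]; ring)
      (by
        intro x hx
        rw [min_eq_left (by linarith)] at hx
        have := (hasDerivAt_ofReal_cpow_const (r := w) hx.1.ne' hwne).div_const w
        convert! this using 1
        field_simp)
      ((hcpow _).const_mul _ |>.neg).intervalIntegrable
      ((hxpow (w - 1) (by simp; linarith)).intervalIntegrable _ _)
    have hcomm : (∫ x : ℝ in (0:ℝ)..(1 - ε), (x : ℂ) ^ (w - 1) * (1 - (x : ℂ)) ^ (b - 1))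
      = ∫ x : ℝ in (0:ℝ)..(1 - ε), (1 - (x : ℂ)) ^ (b - 1) * (x : ℂ) ^ (w - 1) := by
      simp_rw [mul_comm]
    rw [hcomm, hibp]
    have h0 : ((0 : ℝ) : ℂ) ^ w / w = 0 := by simp [hwne]
    simp only [h0, mul_zero, sub_zero]
    have hA : ‖(1 - ((1 - ε : ℝ) : ℂ)) ^ (b - 1) * ((((1 - ε : ℝ) : ℂ)) ^ w / w)‖
        ≤ ‖w‖ ^ (-δ) := by
      rw [norm_mul, norm_div, ← hεm, mul_comm, div_eq_inv_mul]
      have h1 := hnx (1 - ε) (by linarith) (by linarith) w hw0.le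
      have h2 := hn1 (1 - ε) (by linarith) (by linarith) 1 (b - 1) (by simp; linarith)
      rw [sub_sub_cancel] at h2
      calc _ ≤ (‖w‖⁻¹ * 1) * ε ^ (δ - 1) := by gcongr
        _ = _ := by ring
    have hB : ‖∫ x : ℝ in (0:ℝ)..(1 - ε), -((b - 1) * (1 - (x : ℂ)) ^ (b - 2)) * ((x : ℂ) ^ w / w)‖
        ≤ ‖b - 1‖ / (1 - δ) * ‖w‖ ^ (-δ) := by
      have hint : ∫ x : ℝ in (0:ℝ)..(1 - ε), (1 - x) ^ (δ - 2) ≤ ε ^ (δ - 1) / (1 - δ) := by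
        rw [intervalIntegral.integral_comp_sub_left (fun x : ℝ => x ^ (δ - 2)) 1,
          integral_rpow (Or.inr ⟨by linarith, by
            rw [Set.uIcc_of_le (by linarith)]; intro h; linarith [h.1]⟩)]
        simp only [sub_zero, sub_sub_cancel, Real.one_rpow]
        rw [show δ - 2 + 1 = -(1 - δ) by ring, div_neg, ← neg_div, show δ - 1 = -(1 - δ) by ring]
        apply div_le_div_of_nonneg_right _ (by linarith)
        linarith
      have hcr : ContinuousOn (fun x : ℝ => (1 - x) ^ (δ - 2)) (Set.uIcc 0 (1 - ε)) := by
        refine ContinuousOn.rpow_const (by fun_prop) fun x hx => Or.inl ?_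
        rw [Set.uIcc_of_le (by linarith)] at hx
        linarith [hx.2]
      calc _ ≤ ∫ x : ℝ in (0:ℝ)..(1 - ε), (‖b - 1‖ * ‖w‖⁻¹) * (1 - x) ^ (δ - 2) := by
            refine intervalIntegral.norm_integral_le_of_norm_le (by linarith) ?_
              (hcr.intervalIntegrable.const_mul _)
            refine Filter.Eventually.of_forall fun x hx => ?_
            rw [norm_mul, norm_neg, norm_mul, norm_div, div_eq_inv_mul]
            have h1 := hnx x hx.1 (by linarith [hx.2]) w hw0.le
            have h2 := hn1 x hx.1.le (by linarith [hx.2]) 2 (b - 2) (by simp; linarith)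
            calc _ ≤ ‖b - 1‖ * (1 - x) ^ (δ - 2) * (‖w‖⁻¹ * 1) := by
                  have : 0 ≤ (1 - x) ^ (δ - 2) := (norm_nonneg _).trans h2
                  gcongr
              _ = _ := by ring
        _ ≤ (‖b - 1‖ * ‖w‖⁻¹) * (ε ^ (δ - 1) / (1 - δ)) := by
            rw [intervalIntegral.integral_const_mul]; gcongr
        _ = _ := by rw [← hεm]; ring
    refine (norm_sub_le _ _).trans ?_
    linarith
  rw [hsplit]
  refine (norm_add_le _ _).trans ?_
  linarith

lemma gamma_ratio_eq {b s : ℂ} (hb : 0 < b.re) (hs : 0 < s.re) :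
    betaIntegral s (b + 1) = Gamma (b + 1) * (Gamma s / Gamma (s + b + 1)) := by
  have h := Gamma_mul_Gamma_eq_betaIntegral (s := s) (t := b + 1) hs (by simp; linarith)
  have hne : Gamma (s + b + 1) ≠ 0 := Gamma_ne_zero_of_re_pos (by simp; linarith)
  rw [← add_assoc] at h
  field_simp
  linear_combination -h

lemma vert_int (b : ℂ) (hb : 0 < b.re) (c : ℝ) (hc : 0 < c) :
    Integrable (fun y : ℝ => betaIntegral (c + y * I) (b + 1)) := by
  obtain ⟨δ, hδ, hδ1, hδb⟩ : ∃ δ : ℝ, 0 < δ ∧ δ < 1 ∧ δ ≤ b.re :=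
    ⟨min b.re (1/2), by positivity, (min_le_right _ _).trans_lt (by norm_num), min_le_left _ _⟩
  set K : ℝ := (1 / δ + (1 + ‖b - 1‖ / (1 - δ))) with hK
  have hK0 : 0 ≤ K := by
    have : 0 < 1 - δ := by linarith
    positivity
  have hre : ∀ y : ℝ, (c + y * I : ℂ).re = c := by intro y; simp
  have hsm := (integrable_rpow_neg_one_add_norm_sq (E := ℝ) (μ := volume) (r := 1 + δ)
    (by simp; linarith)).const_mul (‖b‖ * ((1 + c) / c) * K)
  refine hsm.mono' ?_ (Filter.Eventually.of_forall fun y => ?_)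
  · have : Continuous (fun y : ℝ => Gamma (b + 1) * (Gamma (c + y * I) / Gamma (c + y * I + b + 1))) := by
      have hG : ∀ f : ℝ → ℂ, Continuous f → (∀ y, 0 < (f y).re) → Continuous (fun y => Gamma (f y)) := by
        intro f hf hp
        rw [continuous_iff_continuousAt]
        intro y
        refine ContinuousAt.comp (g := Gamma) (DifferentiableAt.continuousAt (𝕜 := ℂ) (differentiableAt_Gamma _ ?_)) hf.continuousAt
        intro m h
        have := hp y
        rw [h] at this
        simp at this
        linarith [m.cast_nonneg (α := ℝ)]
      refine continuous_const.mul ((hG _ (by fun_prop) ?_).div (hG _ (by fun_prop) ?_) ?_)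
      · intro y; simpa using hc
      · intro y; simp; linarith
      · intro y; exact Gamma_ne_zero_of_re_pos (by simp; linarith)
    refine this.aestronglyMeasurable.congr (Filter.Eventually.of_forall fun y => ?_)
    exact (gamma_ratio_eq hb (by simpa using hc)).symm
  · set s : ℂ := c + y * I with hs
    have hsre : s.re = c := hre y
    have hcs : c ≤ ‖s‖ := hsre ▸ re_le_norm s
    have hs0 : 0 < ‖s‖ := by linarith
    have hsne : s ≠ 0 := norm_pos_iff.mp hs0
    have hrec := betaIntegral_recurrence (u := s) (v := b) (by linarith) hb
    have hbd := beta_bound b δ hδ hδ1 hδb (s + 1) (by simp [hsre, hc])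
    have heq : ‖betaIntegral s (b + 1)‖ = ‖b‖ * ‖s‖⁻¹ * ‖betaIntegral (s + 1) b‖ := by
      have := congrArg norm hrec
      rw [norm_mul, norm_mul] at this
      field_simp
      linarith
    have h1 : ‖s + 1‖ ≤ (1 + c) / c * ‖s‖ := by
      calc ‖s + 1‖ ≤ ‖s‖ + 1 := by simpa using norm_add_le s 1
        _ ≤ ‖s‖ + ‖s‖ / c := by gcongr; rwa [one_le_div hc]
        _ = _ := by field_simp; ring
    have hs1 : 1 < ‖s + 1‖ := lt_of_lt_of_le (by simp [hsre, hc]) (re_le_norm (s + 1))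
    have hs10 : 0 < ‖s + 1‖ := by linarith
    have h2 : ‖s‖⁻¹ ≤ (1 + c) / c * ‖s + 1‖⁻¹ := by
      rw [← div_eq_mul_inv, le_div_iff₀ hs10, inv_mul_le_iff₀ hs0]
      linarith
    have h3 : ‖s + 1‖⁻¹ * ‖s + 1‖ ^ (-δ) ≤ (1 + ‖y‖ ^ 2) ^ (-(1 + δ) / 2) := by
      have e : ‖s + 1‖⁻¹ * ‖s + 1‖ ^ (-δ) = (‖s + 1‖ ^ 2) ^ (-(1 + δ) / 2) := by
        rw [← Real.rpow_neg_one, ← Real.rpow_add hs10, ← Real.rpow_natCast, ← Real.rpow_mul hs10.le]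
        congr 1; push_cast; ring
      rw [e]
      refine Real.rpow_le_rpow_of_nonpos (by positivity) ?_ (by linarith)
      rw [← normSq_eq_norm_sq, normSq_apply, Real.norm_eq_abs, sq_abs]
      simp [hs]
      nlinarith
    rw [heq]
    calc _ ≤ ‖b‖ * ((1 + c) / c * ‖s + 1‖⁻¹) * (K * ‖s + 1‖ ^ (-δ)) := by gcongr
      _ = ‖b‖ * ((1 + c) / c) * K * (‖s + 1‖⁻¹ * ‖s + 1‖ ^ (-δ)) := by ring
      _ ≤ _ := by gcongr

/-- The beta kernel. -/
noncomputable def kern (b : ℂ) : ℝ → ℂ := Set.indicator (Set.Ioc 0 1) fun x => (1 - (x : ℂ)) ^ b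

lemma kern_mul (b s : ℂ) : (fun x : ℝ => (x : ℂ) ^ (s - 1) • kern b x) =
    Set.indicator (Set.Ioc 0 1) fun x : ℝ => (x : ℂ) ^ (s - 1) * (1 - (x : ℂ)) ^ ((b + 1) - 1) := by
  ext x
  by_cases hx : x ∈ Set.Ioc (0 : ℝ) 1 <;> simp [kern, hx]

lemma kern_conv (b s : ℂ) (hb : 0 < b.re) (hs : 0 < s.re) : MellinConvergent (kern b) s := by
  have h := betaIntegral_convergent (u := s) (v := b + 1) hs (by simp; linarith)
  rw [intervalIntegrable_iff_integrableOn_Ioc_of_le zero_le_one] at h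
  rw [MellinConvergent, kern_mul]
  exact ((integrable_indicator_iff measurableSet_Ioc).mpr h).integrableOn

lemma kern_mellin (b s : ℂ) : mellin (kern b) s = betaIntegral s (b + 1) := by
  rw [mellin, kern_mul, setIntegral_indicator measurableSet_Ioc, betaIntegral,
    intervalIntegral.integral_of_le zero_le_one]
  congr 2
  ext x; simp

lemma kern_cont (b : ℂ) (x : ℝ) (hx : 0 < x) (hx1 : x ≠ 1) : ContinuousAt (kern b) x := by
  rcases lt_or_gt_of_ne hx1 with h | h
  · have : kern b =ᶠ[nhds x] fun x : ℝ => (1 - (x : ℂ)) ^ b := by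
      filter_upwards [Ioo_mem_nhds hx h] with y hy
      simp [kern, hy.1, hy.2.le]
    refine ContinuousAt.congr ?_ this.symm
    refine ContinuousAt.cpow (by fun_prop) continuousAt_const (Or.inl (by simpa using h))
  · have : kern b =ᶠ[nhds x] fun x : ℝ => 0 := by
      filter_upwards [Ioi_mem_nhds h] with y hy
      simp only [kern]
      exact Set.indicator_of_notMem (fun h' => absurd h'.2 (not_le.mpr hy)) _
    exact ContinuousAt.congr continuousAt_const this.symm

theorem stmt6 (b : ℂ) (hb : 0 < b.re) (c : ℝ) (hc : 0 < c) (t : ℝ) (ht : 0 < t) (ht1 : t ≠ 1) :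
    Integrable (fun y : ℝ =>
        Complex.Gamma (c + y * I) / Complex.Gamma (c + y * I + b + 1)
          * (t : ℂ) ^ ((c : ℂ) + y * I)) ∧
    (1 / (2 * Real.pi) : ℂ) *
        ∫ y : ℝ, Complex.Gamma (c + y * I) / Complex.Gamma (c + y * I + b + 1)
          * (t : ℂ) ^ ((c : ℂ) + y * I)
      = if t < 1 then 0 else ((1 - t⁻¹ : ℝ) : ℂ) ^ b / Complex.Gamma (b + 1) := by
  have hG : Gamma (b + 1) ≠ 0 := Gamma_ne_zero_of_re_pos (by simp; linarith)
  have hV := vert_int b hb c hc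
  have hR : ∀ y : ℝ, Gamma (c + y * I) / Gamma (c + y * I + b + 1)
      = (Gamma (b + 1))⁻¹ * betaIntegral (c + y * I) (b + 1) := by
    intro y
    rw [gamma_ratio_eq hb (by simpa using hc), inv_mul_cancel_left₀ hG]
  simp_rw [hR]
  have ht0 : (t : ℂ) ≠ 0 := ofReal_ne_zero.mpr ht.ne'
  constructor
  · refine (hV.const_mul _).mul_bdd (c := t ^ c) ?_ ?_
    · refine Continuous.aestronglyMeasurable ?_
      exact Continuous.const_cpow (by fun_prop) (Or.inl ht0)
    · refine Filter.Eventually.of_forall fun y => ?_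
      rw [norm_cpow_eq_rpow_re_of_pos ht]; simp
  · have hinv := mellinInv_mellin_eq c (kern b) (x := t⁻¹) (by positivity)
      (kern_conv b c hb (by simpa using hc))
      (by simpa only [VerticalIntegrable, kern_mellin] using hV)
      (kern_cont b _ (by positivity) (by simpa using ht1))
    rw [mellinInv] at hinv
    simp_rw [kern_mellin] at hinv
    have hp : ∀ y : ℝ, ((t⁻¹ : ℝ) : ℂ) ^ (-(c + y * I : ℂ)) = (t : ℂ) ^ (c + y * I : ℂ) := by
      intro y
      rw [cpow_neg, ofReal_inv, inv_cpow _ _ (by rw [arg_ofReal_of_nonneg ht.le]; exact Real.pi_pos.ne), inv_inv]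
    simp_rw [hp, smul_eq_mul] at hinv
    have hk : kern b t⁻¹ = if t < 1 then 0 else ((1 - t⁻¹ : ℝ) : ℂ) ^ b := by
      split_ifs with h
      · exact Set.indicator_of_notMem (fun h' => absurd h'.2 (not_le.mpr (one_lt_inv_iff₀.mpr ⟨ht, h⟩))) _
      · rw [kern, Set.indicator_of_mem (show t⁻¹ ∈ Set.Ioc (0 : ℝ) 1 from
          ⟨by positivity, inv_le_one_of_one_le₀ (not_lt.mp h)⟩)]
        push_cast; rfl
    have hfin : (if t < 1 then 0 else ((1 - t⁻¹ : ℝ) : ℂ) ^ b / Complex.Gamma (b + 1))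
        = (Gamma (b + 1))⁻¹ * kern b t⁻¹ := by
      rw [hk]; split_ifs <;> ring
    rw [hfin, ← hinv]
    have : ∀ y : ℝ, (Gamma (b + 1))⁻¹ * betaIntegral (c + y * I) (b + 1) * (t : ℂ) ^ ((c : ℂ) + y * I)
      = (Gamma (b + 1))⁻¹ * ((t : ℂ) ^ ((c : ℂ) + y * I) * betaIntegral (c + y * I) (b + 1)) := by
      intro y; ring
    simp_rw [this]
    rw [integral_const_mul, real_smul]
    push_cast
    ring
end

section
/- For every ε > 0 there is a constant C = C(ε) such that for every positive integer d and all integers m, k, n, one has |S_n(m, k; d)| ≤ C · d^{1/2+ε} · gcd(d, k)^{1/2} · gcd(d, m)^{1/2}. -/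
open Finset

/-- `e(x) = exp(2πix)`. -/
noncomputable def eexp (x : ℝ) : ℂ := Complex.exp (2 * Real.pi * Complex.I * x)

/-- The exponential sum `S_n(m, k; d)`: sum over residues `e₁ e₂ ≡ n (mod d)` of
`e((m e₁ + k e₂)/d)`. -/
noncomputable def expSum (n m k : ℤ) (d : ℕ) : ℂ :=
  ∑ e ∈ (Finset.range d ×ˢ Finset.range d).filter
      (fun e : ℕ × ℕ => (e.1 * e.2 : ℤ) ≡ n [ZMOD (d : ℤ)]),
    eexp ((m * e.1 + k * e.2) / d)


namespace Kl
open Polynomial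

section weights
variable {F : Type*} [Field F]

/-- Weighted degree bound: `X` has weight `p`, `Y` has weight `p+1`. -/
def Wt (p N : ℕ) (P : F[X][X]) : Prop :=
  ∀ h d, (P.coeff h).coeff d ≠ 0 → p * d + (p + 1) * h ≤ N

lemma Wt.mono {p N M : ℕ} {P : F[X][X]} (h : Wt p N P) (hNM : N ≤ M) : Wt p M P :=
  fun a d hd => (h a d hd).trans hNM

lemma Wt.add {p N : ℕ} {P R : F[X][X]} (hP : Wt p N P) (hR : Wt p N R) : Wt p N (P + R) := by
  intro h d hd
  by_cases h1 : (P.coeff h).coeff d = 0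
  · apply hR h d
    intro h2
    apply hd
    simp [h1, h2]
  · exact hP h d h1

lemma Wt.neg {p N : ℕ} {P : F[X][X]} (hP : Wt p N P) : Wt p N (-P) := by
  intro h d hd
  apply hP h d
  simpa using hd

lemma Wt.sub {p N : ℕ} {P R : F[X][X]} (hP : Wt p N P) (hR : Wt p N R) : Wt p N (P - R) := by
  rw [sub_eq_add_neg]; exact hP.add hR.neg

lemma Wt.mul {p N M : ℕ} {P R : F[X][X]} (hP : Wt p N P) (hR : Wt p M R) :
    Wt p (N + M) (P * R) := by
  intro h d hd
  rw [coeff_mul, finsetSum_coeff] at hd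
  obtain ⟨⟨h1, h2⟩, hh, hd1⟩ := Finset.exists_ne_zero_of_sum_ne_zero hd
  rw [coeff_mul] at hd1
  obtain ⟨⟨d1, d2⟩, hdd, hd2⟩ := Finset.exists_ne_zero_of_sum_ne_zero hd1
  have e1 := hP h1 d1 (left_ne_zero_of_mul hd2)
  have e2 := hR h2 d2 (right_ne_zero_of_mul hd2)
  rw [Finset.HasAntidiagonal.mem_antidiagonal] at hh hdd
  simp only at hh hdd
  subst hh hdd
  nlinarith

lemma Wt.one {p : ℕ} : Wt p 0 (1 : F[X][X]) := by
  intro h d hd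
  rw [coeff_one] at hd
  split_ifs at hd with h0
  · rw [coeff_one] at hd
    split_ifs at hd with h1
    · subst h1 h0; simp
    · simp at hd
  · simp at hd

lemma Wt.pow {p N : ℕ} {P : F[X][X]} (hP : Wt p N P) (n : ℕ) : Wt p (n * N) (P ^ n) := by
  induction n with
  | zero => simpa using Wt.one
  | succ n ih =>
    rw [pow_succ]
    have := ih.mul hP
    refine this.mono (by nlinarith)

lemma Wt.C {p n : ℕ} {P : F[X]} (hP : P.natDegree ≤ n) : Wt p (p * n) (Polynomial.C P) := by
  intro h d hd
  rw [coeff_C] at hd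
  split_ifs at hd with h0
  · have := le_natDegree_of_ne_zero hd
    subst h0
    simp only [mul_zero, add_zero]
    exact Nat.mul_le_mul_left _ (this.trans hP)
  · simp at hd

lemma Wt.X {p : ℕ} : Wt p (p + 1) (Polynomial.X : F[X][X]) := by
  intro h d hd
  rw [coeff_X] at hd
  split_ifs at hd with h0
  · rw [coeff_one] at hd
    split_ifs at hd with h1
    · subst h1 h0; simp
    · simp at hd
  · simp at hd

lemma Wt.natDegree {p N : ℕ} {P : F[X][X]} (hP : Wt p N P) (h : ℕ) :
    p * (P.coeff h).natDegree ≤ N := by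
  by_cases h0 : P.coeff h = 0
  · simp [h0]
  · have := hP h (P.coeff h).natDegree (by simpa using h0)
    omega

lemma Wt.leadingTerm {p N : ℕ} {P : F[X][X]} (hP : Wt p N P) (hd : p ≤ P.natDegree) :
    Wt p (N - (p + 1) * p) (Polynomial.C P.leadingCoeff * Polynomial.X ^ (P.natDegree - p)) := by
  intro h d hc
  rw [coeff_C_mul_X_pow] at hc
  split_ifs at hc with h0
  · have := hP P.natDegree d hc
    subst h0
    obtain ⟨c, hc⟩ := Nat.exists_eq_add_of_le hd
    rw [hc] at this ⊢
    rw [Nat.add_sub_cancel_left]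
    apply Nat.le_sub_of_add_le
    linarith
  · simp at hc

lemma Wt.modByMonic {p N : ℕ} {g : F[X][X]} (hg : g.Monic) (hgd : g.natDegree = p)
    (hp : 0 < p) (hgW : Wt p ((p + 1) * p) g) :
    ∀ n, ∀ P : F[X][X], P.natDegree < n → Wt p N P → Wt p N (P %ₘ g) := by
  intro n
  induction n with
  | zero => intro P h; omega
  | succ n ih =>
    intro P hn hP
    by_cases hlt : P.natDegree < p
    · rw [(modByMonic_eq_self_iff hg).2]
      · exact hP
      · exact degree_lt_degree (by omega)
    push Not at hlt
    have hP0 : P ≠ 0 := by rintro rfl; simp at hlt; omega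
    set S := Polynomial.C P.leadingCoeff * Polynomial.X ^ (P.natDegree - p) with hS
    have hlc := hP P.natDegree P.leadingCoeff.natDegree (by simpa using hP0)
    have hWt : Wt p N (P - S * g) := by
      apply hP.sub
      refine ((hP.leadingTerm hlt).mul hgW).mono ?_
      have : (p + 1) * p ≤ (p + 1) * P.natDegree := Nat.mul_le_mul_left _ hlt
      omega
    have hmod : (P - S * g) %ₘ g = P %ₘ g := by
      rw [sub_modByMonic, mul_self_modByMonic hg, sub_zero]
    have hdeg : (P - S * g).natDegree < n ∨ P - S * g = 0 := by
      by_cases h0 : P - S * g = 0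
      · exact Or.inr h0
      left
      have : (P - g * (Polynomial.C P.leadingCoeff * Polynomial.X ^ (P.natDegree - g.natDegree))).degree < P.degree :=
        div_wf_lemma ⟨by
          rw [degree_eq_natDegree hg.ne_zero, degree_eq_natDegree hP0, hgd]
          exact_mod_cast hlt, hP0⟩ hg
      rw [hgd, mul_comm g] at this
      have := natDegree_lt_natDegree h0 this
      omega
    rcases hdeg with hdeg | hdeg
    · rw [← hmod]; exact ih _ hdeg hWt
    · rw [← hmod, hdeg, zero_modByMonic]
      intro h d hd; simp at hd

end weights
end Kl

namespace Kl
open Polynomial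

section phi
variable {F : Type*} [Field F]

/-- degree at most `N` with `N`-th coefficient `c`. -/
def IsTop {R : Type*} [CommRing R] (P : R[X]) (N : ℕ) (c : R) : Prop :=
  P.natDegree ≤ N ∧ P.coeff N = c

lemma IsTop.mul {R : Type*} [CommRing R] {P P' : R[X]} {N N' : ℕ} {c c' : R}
    (h : IsTop P N c) (h' : IsTop P' N' c') : IsTop (P * P') (N + N') (c * c') := by
  refine ⟨natDegree_mul_le_of_le h.1 h'.1, ?_⟩
  rw [coeff_mul_add_eq_of_natDegree_le h.1 h'.1, h.2, h'.2]

lemma IsTop.pow {R : Type*} [CommRing R] {P : R[X]} {N : ℕ} {c : R}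
    (h : IsTop P N c) (n : ℕ) : IsTop (P ^ n) (n * N) (c ^ n) := by
  refine ⟨natDegree_pow_le_of_le n h.1, ?_⟩
  rw [coeff_pow_of_natDegree_le h.1, h.2]

lemma IsTop.add_lt {R : Type*} [CommRing R] {P P' : R[X]} {N : ℕ} {c : R}
    (h : IsTop P N c) (h' : P'.natDegree < N) : IsTop (P + P') N c := by
  refine ⟨natDegree_add_le_of_degree_le h.1 h'.le, ?_⟩
  rw [coeff_add, h.2, coeff_eq_zero_of_natDegree_lt h', add_zero]

lemma IsTop.natDegree_eq {R : Type*} [CommRing R] {P : R[X]} {N : ℕ} {c : R}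
    (h : IsTop P N c) (hc : c ≠ 0) : P.natDegree = N :=
  natDegree_eq_of_le_of_coeff_ne_zero h.1 (by rw [h.2]; exact hc)

lemma IsTop.leadingCoeff_eq {R : Type*} [CommRing R] {P : R[X]} {N : ℕ} {c : R}
    (h : IsTop P N c) (hc : c ≠ 0) : P.leadingCoeff = c := by
  rw [leadingCoeff, h.natDegree_eq hc, h.2]

lemma isTop_X_pow {R : Type*} [CommRing R] (n : ℕ) : IsTop (X ^ n : R[X]) n 1 :=
  ⟨natDegree_X_pow_le n, by simp⟩

lemma isTop_C {R : Type*} [CommRing R] (c : R) : IsTop (C c : R[X]) 0 c := ⟨by simp, by simp⟩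

/-- substitution `X ↦ Z^p`, `Y ↦ W Z^(p+1)`. -/
noncomputable def Phi (p : ℕ) : F[X][X] →+* F[X][X] :=
  eval₂RingHom ((expand F[X] p).toRingHom.comp (mapRingHom C)) (C X * X ^ (p + 1))

lemma Phi_C (p : ℕ) (P : F[X]) : Phi p (C P) = expand F[X] p (P.map C) := by
  simp [Phi]

lemma Phi_X (p : ℕ) : Phi p (X : F[X][X]) = C X * X ^ (p + 1) := by
  simp [Phi]

lemma isTop_Phi_C {p : ℕ} (hp : 0 < p) {P : F[X]} {N : ℕ} {c : F} (h : IsTop P N c) :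
    IsTop (Phi p (C P)) (p * N) (C c) := by
  rw [Phi_C]
  constructor
  · rw [natDegree_expand, mul_comm]
    exact Nat.mul_le_mul_left _ (natDegree_map_le.trans h.1)
  · rw [mul_comm, coeff_expand_mul hp, coeff_map, h.2]

lemma isTop_Phi_X {p : ℕ} : IsTop (Phi p (X : F[X][X])) (p + 1) X := by
  rw [Phi_X]
  have := (isTop_C (X : F[X])).mul (isTop_X_pow (R := F[X]) (p + 1))
  simpa using this

/-- the defining polynomial of the curve. -/
noncomputable def gP (p : ℕ) (a s b : F) : F[X][X] :=
  X ^ p - (C (X ^ (p - 1)) * X + C (X ^ (p - 1) * (C a * X ^ 2 + C s * X + C b)))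

noncomputable def T2 (p μ : ℕ) (a s b : F) : F[X] :=
  ∑ n ∈ Finset.range μ, X ^ (p ^ μ - p ^ n) * (C a * X ^ 2 + C s * X + C b) ^ (p ^ n)

noncomputable def UP (p μ : ℕ) (a s b : F) : F[X][X] :=
  C (X ^ (p ^ μ - 1)) * X + C (T2 p μ a s b)

noncomputable def MP (p μ : ℕ) (a s b : F) (n j l : ℕ) : F[X][X] :=
  C (X ^ n) * UP p μ a s b ^ j * X ^ l

lemma isTop_quad (a s b : F) : IsTop (C a * X ^ 2 + C s * X + C b : F[X]) 2 a := by
  refine ⟨natDegree_quadratic_le, ?_⟩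
  simp

lemma gP_low (p : ℕ) (hp : 2 ≤ p) (a s b : F) :
    (C (X ^ (p - 1)) * X + C (X ^ (p - 1) * (C a * X ^ 2 + C s * X + C b)) : F[X][X]).degree
      < p := by
  refine lt_of_le_of_lt degree_linear_le ?_
  exact_mod_cast (by omega : 1 < p)

lemma gP_monic (p : ℕ) (hp : 2 ≤ p) (a s b : F) : (gP p a s b).Monic := by
  unfold gP
  exact monic_X_pow_sub (by
    have := gP_low p hp a s b
    exact this)

lemma gP_natDegree (p : ℕ) (hp : 2 ≤ p) (a s b : F) : (gP p a s b).natDegree = p := by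
  unfold gP
  rw [natDegree_sub_eq_left_of_natDegree_lt]
  · simp
  · rw [natDegree_X_pow]
    exact lt_of_le_of_lt natDegree_linear_le (by omega)

lemma gP_Wt (p : ℕ) (hp : 2 ≤ p) (a s b : F) : Wt p ((p + 1) * p) (gP p a s b) := by
  unfold gP
  apply Wt.sub
  · exact (Wt.X.pow p).mono (by nlinarith)
  apply Wt.add
  · refine ((Wt.C (n := p - 1) (by simp)).mul Wt.X).mono ?_
    obtain ⟨q, rfl⟩ := Nat.exists_eq_add_of_le' (show 1 ≤ p by omega)
    simp only [Nat.add_sub_cancel]; nlinarith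
  · refine (Wt.C (n := p + 1) ?_).mono (by nlinarith)
    have := ((isTop_X_pow (R := F) (p - 1)).mul (isTop_quad a s b)).1
    omega

lemma isTop_Phi_gP (p : ℕ) (hp : 2 ≤ p) (a s b : F) :
    IsTop (Phi p (gP p a s b)) (p * (p + 1)) (X ^ p - C a) := by
  have h1 := (isTop_Phi_X (F := F) (p := p)).pow p
  have h2 := isTop_Phi_C (p := p) (by omega)
    ((isTop_X_pow (R := F) (p - 1)).mul (isTop_quad a s b))
  have h3 := (isTop_Phi_C (p := p) (by omega) (isTop_X_pow (R := F) (p - 1))).mul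
    (isTop_Phi_X (F := F) (p := p))
  have e : p - 1 + 2 = p + 1 := by omega
  rw [e, one_mul] at h2
  have : Phi p (gP p a s b) = (Phi p X ^ p - Phi p (C (X ^ (p - 1) * (C a * X ^ 2 + C s * X + C b))))
      + -(Phi p (C (X ^ (p - 1))) * Phi p X) := by
    unfold gP
    rw [map_sub, map_add, map_pow, map_mul]
    ring
  rw [this]
  apply IsTop.add_lt
  · refine ⟨natDegree_sub_le_of_le h1.1 h2.1 |>.trans (by simp), ?_⟩
    rw [coeff_sub, h1.2, h2.2]
  · rw [natDegree_neg]
    refine lt_of_le_of_lt h3.1 ?_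
    obtain ⟨q, rfl⟩ := Nat.exists_eq_add_of_le' hp
    simp only [show q + 2 - 1 = q + 1 by omega]; nlinarith

lemma isTop_T2 (p ν : ℕ) (hp : 2 ≤ p) (a s b : F) :
    IsTop (T2 p (ν + 1) a s b) (p ^ (ν + 1) + p ^ ν) (a ^ (p ^ ν)) := by
  have key : ∀ n ≤ ν, IsTop (X ^ (p ^ (ν + 1) - p ^ n) * (C a * X ^ 2 + C s * X + C b) ^ (p ^ n) : F[X])
      (p ^ (ν + 1) + p ^ n) (a ^ (p ^ n)) := by
    intro n hn
    have := (isTop_X_pow (R := F) (p ^ (ν + 1) - p ^ n)).mul ((isTop_quad a s b).pow (p ^ n))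
    rw [one_mul] at this
    have hle : p ^ n ≤ p ^ (ν + 1) := Nat.pow_le_pow_right (by omega) (by omega)
    rwa [show p ^ (ν + 1) - p ^ n + p ^ n * 2 = p ^ (ν + 1) + p ^ n by omega] at this
  unfold T2
  rw [Finset.sum_range_succ, add_comm]
  apply (key ν le_rfl).add_lt
  refine lt_of_le_of_lt (b := p ^ (ν + 1) + (p ^ ν - 1)) ?_ ?_
  · apply natDegree_sum_le_of_forall_le
    intro n hn
    rw [Finset.mem_range] at hn
    refine (key n hn.le).1.trans ?_
    have : p ^ n < p ^ ν := Nat.pow_lt_pow_right (by omega) hn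
    omega
  · have : 0 < p ^ ν := by positivity
    omega

lemma Wt_UP (p ν : ℕ) (hp : 2 ≤ p) (a s b : F) :
    Wt p ((p + 1) * p ^ (ν + 1)) (UP p (ν + 1) a s b) := by
  have h1 : 1 ≤ p ^ (ν + 1) := Nat.one_le_pow _ _ (by omega)
  have h2 : p ≤ p ^ (ν + 1) := Nat.le_self_pow (by omega) p
  unfold UP
  apply Wt.add
  · refine ((Wt.C (n := p ^ (ν + 1) - 1) (by simp)).mul Wt.X).mono ?_
    obtain ⟨q, hq⟩ := Nat.exists_eq_add_of_le' h1
    rw [hq] at h2 ⊢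
    simp only [Nat.add_sub_cancel]; nlinarith
  · refine (Wt.C (isTop_T2 p ν hp a s b).1).mono ?_
    apply le_of_eq; ring

lemma Wt_MP (p ν : ℕ) (hp : 2 ≤ p) (a s b : F) (n j l : ℕ) :
    Wt p (p * n + (p + 1) * p ^ (ν + 1) * j + (p + 1) * l) (MP p (ν + 1) a s b n j l) := by
  unfold MP
  refine (((Wt.C (n := n) (by simp)).mul ((Wt_UP p ν hp a s b).pow j)).mul (Wt.X.pow l)).mono ?_
  apply le_of_eq; ring

lemma isTop_Phi_UP (p ν : ℕ) (hp : 2 ≤ p) (a s b : F) :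
    IsTop (Phi p (UP p (ν + 1) a s b)) ((p + 1) * p ^ (ν + 1)) (C (a ^ (p ^ ν))) := by
  have h1 : 1 ≤ p ^ (ν + 1) := Nat.one_le_pow _ _ (by omega)
  have h2 : p ≤ p ^ (ν + 1) := Nat.le_self_pow (by omega) p
  unfold UP
  rw [map_add, map_mul, add_comm]
  apply IsTop.add_lt
  · have := isTop_Phi_C (p := p) (by omega) (isTop_T2 p ν hp a s b)
    rwa [show p * (p ^ (ν + 1) + p ^ ν) = (p + 1) * p ^ (ν + 1) by ring] at this
  · have h3 := (isTop_Phi_C (p := p) (by omega) (isTop_X_pow (R := F) (p ^ (ν + 1) - 1))).mul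
      (isTop_Phi_X (F := F) (p := p))
    refine lt_of_le_of_lt h3.1 ?_
    obtain ⟨q, hq⟩ := Nat.exists_eq_add_of_le' h1
    rw [hq] at h2 ⊢
    simp only [Nat.add_sub_cancel]; nlinarith

lemma isTop_Phi_MP (p ν : ℕ) (hp : 2 ≤ p) (a s b : F) (n j l : ℕ) :
    IsTop (Phi p (MP p (ν + 1) a s b n j l))
      (p * n + (p + 1) * p ^ (ν + 1) * j + (p + 1) * l) (C ((a ^ (p ^ ν)) ^ j) * X ^ l) := by
  unfold MP
  rw [map_mul, map_mul, map_pow (Phi p) (UP p (ν + 1) a s b) j, map_pow (Phi p) X l]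
  have := ((isTop_Phi_C (p := p) (by omega) (isTop_X_pow (R := F) n)).mul
    ((isTop_Phi_UP p ν hp a s b).pow j)).mul ((isTop_Phi_X (F := F) (p := p)).pow l)
  rw [C_1, one_mul, ← C_pow] at this
  have e : p * n + (p + 1) * p ^ (ν + 1) * j + (p + 1) * l
    = p * n + j * ((p + 1) * p ^ (ν + 1)) + l * (p + 1) := by ring
  rw [e]
  exact this

lemma not_dvd_of_tops {ι : Type*} [Fintype ι] (p : ℕ) (hp : 2 ≤ p) (a s b : F)
    (M : ι → F[X][X]) (δ : ι → ℕ) (hδ : Function.Injective δ) (α : ι → F) (l : ι → ℕ)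
    (hα : ∀ i, α i ≠ 0) (hl : ∀ i, l i < p)
    (hM : ∀ i, IsTop (Phi p (M i)) (δ i) (C (α i) * X ^ (l i)))
    (c : ι → F) (hc : c ≠ 0) : ¬ gP p a s b ∣ ∑ i, C (C (c i)) * M i := by
  classical
  obtain ⟨i1, hi1⟩ := Function.ne_iff.1 hc
  obtain ⟨i0, hi0, hmax⟩ := Finset.exists_max_image (Finset.univ.filter (fun i => c i ≠ 0)) δ
    ⟨i1, by simpa using hi1⟩
  have hc0 : c i0 ≠ 0 := by simpa using hi0
  have hC : ∀ i, IsTop (Phi p (C (C (c i)) * M i)) (δ i) (C (c i) * (C (α i) * X ^ (l i))) := by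
    intro i
    rw [map_mul]
    have := (isTop_Phi_C (p := p) (by omega) (isTop_C (c i))).mul (hM i)
    simpa using this
  have htop : IsTop (Phi p (∑ i, C (C (c i)) * M i)) (δ i0) (C (c i0) * (C (α i0) * X ^ (l i0))) := by
    rw [← Finset.add_sum_erase _ _ (Finset.mem_univ i0), map_add, map_sum]
    have hother : ∀ i ∈ Finset.univ.erase i0, (Phi p (C (C (c i)) * M i)) = 0 ∨
        (Phi p (C (C (c i)) * M i)).natDegree < δ i0 := by
      intro i hi
      by_cases hci : c i = 0
      · left; simp [hci]
      · right
        have h1 := hmax i (by simpa using hci)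
        have h2 : δ i ≠ δ i0 := fun h => (Finset.ne_of_mem_erase hi) (hδ h)
        have := (hC i).1
        omega
    constructor
    · refine natDegree_add_le_of_degree_le (hC i0).1 ?_
      apply natDegree_sum_le_of_forall_le
      intro i hi
      rcases hother i hi with h | h
      · simp [h]
      · exact h.le
    · rw [coeff_add, (hC i0).2, finsetSum_coeff, Finset.sum_eq_zero, add_zero]
      intro i hi
      rcases hother i hi with h | h
      · simp [h]
      · exact coeff_eq_zero_of_natDegree_lt h
  have hne : (C (c i0) * (C (α i0) * X ^ (l i0)) : F[X]) ≠ 0 := by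
    simp [hc0, hα i0]
  rintro ⟨V, hV⟩
  have hlc := htop.leadingCoeff_eq hne
  have hga : (X ^ p - C a : F[X]) ≠ 0 := X_pow_sub_C_ne_zero (by omega) a
  rw [hV, map_mul, leadingCoeff_mul, (isTop_Phi_gP p hp a s b).leadingCoeff_eq hga] at hlc
  have hV0 : (Phi p V).leadingCoeff ≠ 0 := by
    intro h; rw [h, mul_zero] at hlc; exact hne hlc.symm
  have := congrArg natDegree hlc
  rw [natDegree_mul hga hV0, natDegree_X_pow_sub_C, ← mul_assoc, ← C_mul,
    natDegree_C_mul_X_pow _ _ (mul_ne_zero hc0 (hα i0))] at this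
  have := hl i0
  omega

end phi
end Kl

namespace Kl
open Polynomial

section step
variable {F : Type*} [Field F]

noncomputable def ev (x y : F) : F[X][X] →+* F := eval₂RingHom (evalRingHom x) y

lemma ev_C (x y : F) (P : F[X]) : ev x y (C P) = P.eval x := by simp [ev]
lemma ev_X (x y : F) : ev x y X = y := by simp [ev]

lemma ev_gP {p : ℕ} {a s b x y : F} (hy : y ^ p = x ^ (p - 1) * y + x ^ (p - 1) * (a * x ^ 2 + s * x + b)) :
    ev x y (gP p a s b) = 0 := by
  unfold gP
  rw [map_sub, map_add, map_mul, map_pow (ev x y) X p, ev_C, ev_C, ev_X, hy]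
  simp

lemma pow_Q {p : ℕ} [Fact p.Prime] [CharP F p] {a s b x y : F}
    (hy : y ^ p = x ^ (p - 1) * y + x ^ (p - 1) * (a * x ^ 2 + s * x + b)) (m : ℕ) :
    y ^ (p ^ m) = x ^ (p ^ m - 1) * y
      + ∑ n ∈ Finset.range m, x ^ (p ^ m - p ^ n) * (a * x ^ 2 + s * x + b) ^ (p ^ n) := by
  have hp : 2 ≤ p := (Fact.out : p.Prime).two_le
  induction m with
  | zero => simp
  | succ m ih =>
    have h1 : 1 ≤ p ^ m := Nat.one_le_pow _ _ (by omega)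
    rw [pow_succ, pow_mul, ih, add_pow_char, mul_pow, hy, sum_pow_char, Finset.sum_range_succ']
    have e : ∀ n ∈ Finset.range m, (x ^ (p ^ m - p ^ n) * (a * x ^ 2 + s * x + b) ^ (p ^ n)) ^ p
        = x ^ (p ^ m * p - p ^ (n + 1)) * (a * x ^ 2 + s * x + b) ^ (p ^ (n + 1)) := by
      intro n hn
      rw [mul_pow, ← pow_mul, ← pow_mul, Nat.sub_mul, ← pow_succ, ← pow_succ]
    rw [Finset.sum_congr rfl e, ← pow_mul, Nat.sub_mul, one_mul]
    have h2 : p ≤ p ^ m * p := Nat.le_mul_of_pos_left p h1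
    have e2 : p ^ m * p - 1 = (p ^ m * p - p) + (p - 1) := by omega
    rw [pow_zero, pow_one, e2, pow_add]
    ring

lemma ev_UP {p μ : ℕ} [Fact p.Prime] [CharP F p] {a s b x y : F}
    (hy : y ^ p = x ^ (p - 1) * y + x ^ (p - 1) * (a * x ^ 2 + s * x + b)) :
    ev x y (UP p μ a s b) = y ^ (p ^ μ) := by
  rw [pow_Q hy μ]
  unfold UP T2
  rw [map_add, map_mul, ev_C, ev_C, ev_X]
  simp [eval_finsetSum]

lemma ev_MP {p μ : ℕ} [Fact p.Prime] [CharP F p] {a s b x y : F}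
    (hy : y ^ p = x ^ (p - 1) * y + x ^ (p - 1) * (a * x ^ 2 + s * x + b)) (n j l : ℕ) :
    ev x y (MP p μ a s b n j l) = x ^ n * (y ^ (p ^ μ)) ^ j * y ^ l := by
  unfold MP
  rw [map_mul, map_mul, map_pow (ev x y) X l, map_pow (ev x y) (UP p μ a s b) j, ev_UP hy, ev_C, ev_X]
  simp

lemma ev_mod {p : ℕ} {a s b x y : F}
    (hy : y ^ p = x ^ (p - 1) * y + x ^ (p - 1) * (a * x ^ 2 + s * x + b)) (P : F[X][X]) :
    ev x y (P %ₘ gP p a s b) = ev x y P := by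
  conv_rhs => rw [← modByMonic_add_div P (gP p a s b)]
  rw [map_add, map_mul, ev_gP hy]; simp

/-- the linear algebra step -/
lemma exists_coeffs (p ν A B D : ℕ) (hp : 2 ≤ p) (a s b : F)
    (hD : p ^ (ν + 1) * A + B + (p + 1) * (p ^ (ν + 1) + 1) < D) (hlt : D < p * A * B) :
    ∃ c : Fin A × Fin p × Fin B × Fin p → F, c ≠ 0 ∧
      ∑ i, C (C (c i)) * (MP p (ν + 1) a s b (p ^ (ν + 1) * i.1 + i.2.2.1) i.2.1 i.2.2.2
        %ₘ gP p a s b) = 0 := by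
  classical
  set g := gP p a s b with hg
  set M : Fin A × Fin p × Fin B × Fin p → F[X][X] := fun i =>
    MP p (ν + 1) a s b (p ^ (ν + 1) * i.1 + i.2.2.1) i.2.1 i.2.2.2 %ₘ g with hM
  let L : (Fin A × Fin p × Fin B × Fin p → F) →ₗ[F] (Fin p × Fin D → F) :=
    { toFun := fun c hd => ∑ i, c i * ((M i).coeff hd.1).coeff hd.2
      map_add' := by
        intro c c'; ext hd; simp [add_mul, Finset.sum_add_distrib]
      map_smul' := by
        intro r c; ext hd; simp [Finset.mul_sum, mul_assoc] }
  have hker : LinearMap.ker L ≠ ⊥ := by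
    apply LinearMap.ker_ne_bot_of_finrank_lt
    simp only [Module.finrank_fintype_fun_eq_card, Fintype.card_prod, Fintype.card_fin]
    calc p * D < p * (p * A * B) := Nat.mul_lt_mul_of_pos_left hlt (by omega)
      _ = _ := by ring
  obtain ⟨c, hc, hc0⟩ := (Submodule.ne_bot_iff _).1 hker
  refine ⟨c, hc0, ?_⟩
  have hmon := gP_monic p hp a s b
  ext h d
  simp only [finsetSum_coeff, coeff_C_mul, coeff_zero]
  by_cases hh : h < p
  · by_cases hdD : d < D
    · have := congrFun (LinearMap.mem_ker.1 hc) (⟨h, hh⟩, ⟨d, hdD⟩)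
      exact this
    · apply Finset.sum_eq_zero
      intro i _
      have hw : Wt p _ (M i) := Wt.modByMonic hmon (gP_natDegree p hp a s b) (by omega)
        (gP_Wt p hp a s b) _ _ (Nat.lt_succ_self _) (Wt_MP p ν hp a s b _ _ _)
      by_contra hne
      have h1 := hw h d (right_ne_zero_of_mul hne)
      have i1 : (i.1 : ℕ) + 1 ≤ A := i.1.2
      have i2 : (i.2.1 : ℕ) ≤ p := i.2.1.2.le
      have i3 : (i.2.2.1 : ℕ) ≤ B := i.2.2.1.2.le
      have i4 : (i.2.2.2 : ℕ) ≤ p := i.2.2.2.2.le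
      generalize p ^ (ν + 1) = Q at *
      push Not at hdD
      have e1 : p * D ≤ p * d := Nat.mul_le_mul_left _ hdD
      have e2 : p * (Q * A + B + (p + 1) * (Q + 1)) < p * D := Nat.mul_lt_mul_of_pos_left hD (by omega)
      have e3 : p * (Q * i.1 + i.2.2.1) ≤ p * (Q * A + B) := by
        apply Nat.mul_le_mul_left
        have : Q * i.1 ≤ Q * A := Nat.mul_le_mul_left _ (by omega)
        omega
      have e4 : (p + 1) * Q * i.2.1 ≤ (p + 1) * Q * p := Nat.mul_le_mul_left _ i2
      have e5 : (p + 1) * i.2.2.2 ≤ (p + 1) * p := Nat.mul_le_mul_left _ i4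
      have e6 : p * (Q * A + B + (p + 1) * (Q + 1)) = p * (Q * A + B) + (p + 1) * Q * p + (p + 1) * p := by ring
      omega
  · apply Finset.sum_eq_zero
    intro i _
    have : (M i).coeff h = 0 := by
      apply coeff_eq_zero_of_natDegree_lt
      have := natDegree_modByMonic_lt (MP p (ν + 1) a s b (p ^ (ν + 1) * i.1 + i.2.2.1) i.2.1 i.2.2.2)
        hmon (by intro h1; have := gP_natDegree p hp a s b; rw [h1] at this; simp at this; omega)
      rw [gP_natDegree p hp] at this
      have h2 : (M i).natDegree < p := this
      omega
    change c i * ((M i).coeff h).coeff d = 0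
    simp [this]

lemma inj_delta (p Q A B : ℕ) (hp : 2 ≤ p) (hA : p * A + p * p ≤ Q) :
    Function.Injective (fun i : Fin A × Fin p × Fin B × Fin p =>
      p * ((i.1 : ℕ) + Q * i.2.2.1) + (p + 1) * Q * i.2.2.2 + (p + 1) * i.2.1) := by
  have key : ∀ u v u' v' : ℕ, v < p → v' < p → p * u + (p + 1) * v = p * u' + (p + 1) * v' →
      u = u' ∧ v = v' := by
    intro u v u' v' hv hv' h
    have hvv : v = v' := by
      have := congrArg (· % p) h
      rw [show p * u + (p + 1) * v = v + p * (u + v) by ring,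
        show p * u' + (p + 1) * v' = v' + p * (u' + v') by ring, Nat.add_mul_mod_self_left,
        Nat.add_mul_mod_self_left, Nat.mod_eq_of_lt hv, Nat.mod_eq_of_lt hv'] at this
      exact this
    subst hvv
    exact ⟨Nat.eq_of_mul_eq_mul_left (by omega : 0 < p) (by omega), rfl⟩
  have small : ∀ u v : ℕ, u < A → v < p → p * u + (p + 1) * v < Q := by
    intro u v hu hv
    have h1 : p * (u + 1) ≤ p * A := Nat.mul_le_mul_left _ hu
    have h2 : (p + 1) * (v + 1) ≤ (p + 1) * p := Nat.mul_le_mul_left _ hv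
    nlinarith
  rintro ⟨i, j, k, l⟩ ⟨i', j', k', l'⟩ h
  simp only at h
  have h1 : (p * (i : ℕ) + (p + 1) * j) + Q * (p * (k : ℕ) + (p + 1) * l)
      = (p * (i' : ℕ) + (p + 1) * j') + Q * (p * (k' : ℕ) + (p + 1) * l') := by
    linarith
  have s1 := small i j i.2 j.2
  have s2 := small i' j' i'.2 j'.2
  have hmod := congrArg (· % Q) h1
  simp only [Nat.add_mul_mod_self_left, Nat.mod_eq_of_lt s1, Nat.mod_eq_of_lt s2] at hmod
  have hdiv : p * (k : ℕ) + (p + 1) * l = p * (k' : ℕ) + (p + 1) * l' :=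
    Nat.eq_of_mul_eq_mul_left (by omega : 0 < Q) (by omega)
  obtain ⟨a1, a2⟩ := key _ _ _ _ j.2 j'.2 hmod
  obtain ⟨a3, a4⟩ := key _ _ _ _ l.2 l'.2 hdiv
  simp only [Prod.mk.injEq]
  exact ⟨Fin.ext a1, Fin.ext a2, Fin.ext a3, Fin.ext a4⟩

theorem stepanov_aux (p ν A B : ℕ) [Fact p.Prime] [Fintype F] [DecidableEq F] [CharP F p]
    (hcard : Fintype.card F = p ^ (ν + 1) * p ^ (ν + 1)) (a s b : F) (ha : a ≠ 0)
    (hA : p * A + p * p ≤ p ^ (ν + 1))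
    (hAB : p ^ (ν + 1) * A + B + (p + 1) * (p ^ (ν + 1) + 1) + 1 < p * A * B) :
    (Finset.univ.filter (fun x : F => x ≠ 0 ∧ ∃ y, y ^ p - y = a * x + b / x + s)).card
      ≤ A + p ^ (ν + 1) * B + (p + 1) * (p ^ (ν + 1) + 1) := by
  classical
  have hp : 2 ≤ p := (Fact.out : p.Prime).two_le
  set Q := p ^ (ν + 1) with hQ
  obtain ⟨c, hc0, hc⟩ := exists_coeffs p ν A B _ hp a s b (Nat.lt_succ_self _) hAB
  have hroot : ∀ z : F, ∃ w, w ^ Q = z := by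
    intro z
    refine ⟨z ^ Q, ?_⟩
    rw [← pow_mul, ← hcard, FiniteField.pow_card]
  choose c' hc' using fun i => hroot (c i)
  have hc'0 : c' ≠ 0 := by
    intro h
    apply hc0
    ext i
    rw [← hc' i, h]
    simp [hQ]
    omega
  set M : Fin A × Fin p × Fin B × Fin p → F[X][X] := fun i =>
    MP p (ν + 1) a s b (i.1 + Q * i.2.2.1) i.2.2.2 i.2.1 with hM
  set H : F[X][X] := ∑ i, C (C (c' i)) * M i with hH
  have hnd : ¬ gP p a s b ∣ H := by
    refine not_dvd_of_tops p hp a s b M _ (inj_delta p Q A B hp hA) (fun i => (a ^ (p ^ ν)) ^ (i.2.2.2 : ℕ))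
      (fun i => i.2.1) (fun i => pow_ne_zero _ (pow_ne_zero _ ha)) (fun i => i.2.1.2) ?_ c' hc'0
    intro i
    exact isTop_Phi_MP p ν hp a s b _ _ _
  have hmon := gP_monic p hp a s b
  set R := H %ₘ gP p a s b with hR
  have hR0 : R ≠ 0 := by
    intro h
    exact hnd ((modByMonic_eq_zero_iff_dvd hmon).1 h)
  have hRdeg : R.natDegree < p := by
    have := natDegree_modByMonic_lt H
      hmon (by intro h1; have := gP_natDegree p hp a s b; rw [h1] at this; simp at this; omega)
    rwa [gP_natDegree p hp] at this
  set N := A + Q * B + (p + 1) * (Q + 1) with hN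
  have hwH : Wt p (p * N) H := by
    have : ∀ i ∈ (Finset.univ : Finset (Fin A × Fin p × Fin B × Fin p)), Wt p (p * N) (C (C (c' i)) * M i) := by
      intro i _
      refine ((Wt.C (n := 0) (by simp)).mul (Wt_MP p ν hp a s b _ _ _)).mono ?_
      have i1 : (i.1 : ℕ) ≤ A := i.1.2.le
      have i2 : (i.2.1 : ℕ) ≤ p := i.2.1.2.le
      have i3 : (i.2.2.1 : ℕ) ≤ B := i.2.2.1.2.le
      have i4 : (i.2.2.2 : ℕ) ≤ p := i.2.2.2.2.le
      have e3 : p * (i.1 + Q * i.2.2.1) ≤ p * (A + Q * B) := by gcongr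
      have e4 : (p + 1) * Q * i.2.2.2 ≤ (p + 1) * Q * p := Nat.mul_le_mul_left _ i4
      have e5 : (p + 1) * i.2.1 ≤ (p + 1) * p := Nat.mul_le_mul_left _ i2
      have e6 : p * N = p * (A + Q * B) + (p + 1) * Q * p + (p + 1) * p := by rw [hN]; ring
      rw [e6, mul_zero, zero_add]
      rw [← hQ]
      omega
    rw [hH]
    refine Finset.sum_induction _ (Wt p (p * N)) (fun _ _ => Wt.add) ?_ this
    intro h d hd; simp at hd
  have hwR : Wt p (p * N) R := Wt.modByMonic hmon (gP_natDegree p hp a s b) (by omega)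
        (gP_Wt p hp a s b) _ _ (Nat.lt_succ_self _) hwH
  obtain ⟨h, hh⟩ : ∃ h, R.coeff h ≠ 0 := by
    by_contra hcon
    push Not at hcon
    exact hR0 (by ext1 h; simp [hcon])
  have hdegh : (R.coeff h).natDegree ≤ N := Nat.le_of_mul_le_mul_left (hwR.natDegree h) (by omega)
  -- vanishing
  have hvanish : ∀ x y : F, y ^ p = x ^ (p - 1) * y + x ^ (p - 1) * (a * x ^ 2 + s * x + b) →
      ev x y R = 0 := by
    intro x y hy
    rw [hR, ev_mod hy]
    have h1 := congrArg (ev x y) hc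
    rw [map_sum, map_zero] at h1
    have h2 : (ev x y H) ^ Q = 0 := by
      rw [hH, map_sum, hQ, sum_pow_char_pow, ← hQ, ← h1]
      apply Finset.sum_congr rfl
      intro i _
      rw [map_mul, map_mul, ev_mod hy, ev_MP hy, ev_MP hy, ev_C, ev_C, eval_C, eval_C, mul_pow,
        hc' i]
      congr 1
      have hx : x ^ (Q * Q) = x := by rw [← hcard]; exact FiniteField.pow_card x
      have hy' : y ^ (Q * Q) = y := by rw [← hcard]; exact FiniteField.pow_card y
      rw [← hQ]
      generalize (i.1 : ℕ) = i1
      generalize (i.2.1 : ℕ) = i2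
      generalize (i.2.2.1 : ℕ) = i3
      generalize (i.2.2.2 : ℕ) = i4
      calc (x ^ (i1 + Q * i3) * (y ^ Q) ^ i4 * y ^ i2) ^ Q
          = x ^ (Q * i1) * (x ^ (Q * Q)) ^ i3 * ((y ^ (Q * Q)) ^ i4) * (y ^ Q) ^ i2 := by ring
        _ = _ := by rw [hx, hy']; ring
    exact eq_zero_of_pow_eq_zero h2
  have hsub : (Finset.univ.filter (fun x : F => x ≠ 0 ∧ ∃ y, y ^ p - y = a * x + b / x + s))
      ⊆ (R.coeff h).roots.toFinset := by
    intro x hx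
    rw [Finset.mem_filter] at hx
    obtain ⟨-, hx0, y, hy⟩ := hx
    rw [Multiset.mem_toFinset, mem_roots hh, IsRoot.def]
    have hz : R.map (evalRingHom x) = 0 := by
      refine eq_zero_of_natDegree_lt_card_of_eval_eq_zero (ι := ZMod p) _
        (f := fun t => x * (y + ZMod.castHom (dvd_refl p) F t)) ?_ ?_ ?_
      · intro t t' htt
        have := mul_left_cancel₀ hx0 htt
        exact (ZMod.castHom (dvd_refl p) F).injective (add_left_cancel this)
      · intro t
        rw [eval_map]
        apply hvanish x
        set u := ZMod.castHom (dvd_refl p) F t with hu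
        have hup : u ^ p = u := by rw [hu, ← map_pow, ZMod.pow_card]
        rw [mul_pow, add_pow_char, hup]
        have hyp : y ^ p = y + (a * x + b / x + s) := by rw [← hy]; ring
        rw [hyp]
        have : x ^ p = x ^ (p - 1) * x := by rw [← pow_succ]; congr 1; omega
        rw [this]
        field_simp
        ring
      · rw [ZMod.card]
        exact lt_of_le_of_lt natDegree_map_le hRdeg
    have := congrArg (fun P => P.coeff h) hz
    simpa using this
  calc _ ≤ (R.coeff h).roots.toFinset.card := Finset.card_le_card hsub
    _ ≤ _ := (Multiset.toFinset_card_le _).trans ((card_roots' _).trans hdegh)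

theorem stepanov (p ν : ℕ) [Fact p.Prime] [Fintype F] [DecidableEq F] [CharP F p] (hν : 4 ≤ ν)
    (hcard : Fintype.card F = p ^ (ν + 1) * p ^ (ν + 1)) (a s b : F) (ha : a ≠ 0) :
    (Finset.univ.filter (fun x : F => x ≠ 0 ∧ ∃ y, y ^ p - y = a * x + b / x + s)).card
      ≤ p ^ (ν + 1) * p ^ ν + (2 * p + 6) * p ^ (ν + 1) := by
  have hp : 2 ≤ p := (Fact.out : p.Prime).two_le
  have hr : p * p ^ 3 ≤ p ^ ν := by
    rw [← pow_succ']; exact Nat.pow_le_pow_right (by omega) hν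
  have hQ : p ^ (ν + 1) = p * p ^ ν := by ring
  have hpr : p ≤ p ^ ν := Nat.le_self_pow (by omega) p
  obtain ⟨A, hA⟩ := Nat.exists_eq_add_of_le' hpr
  have hbig : p ^ 3 + 3 * p ^ 2 + 2 * p + 5 ≤ p * p ^ ν := by
    have : p ^ 3 + 3 * p ^ 2 + 2 * p + 5 ≤ p * (p * p ^ 3) := by
      obtain ⟨k, rfl⟩ := Nat.exists_eq_add_of_le' hp
      ring_nf
      linarith [Nat.zero_le (k^2), Nat.zero_le (k^3), Nat.zero_le (k^4), Nat.zero_le (k^5), Nat.zero_le k]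
    exact this.trans (Nat.mul_le_mul_left _ hr)
  have := stepanov_aux p ν A (p ^ ν + p + 3) hcard a s b ha ?_ ?_
  · refine this.trans ?_
    rw [hQ]
    generalize p ^ ν = r at *
    subst hA
    nlinarith
  · rw [hQ, hA]; apply le_of_eq; ring
  · rw [hQ]
    generalize p ^ ν = r at *
    subst hA
    nlinarith

end step
end Kl

namespace Kl
open Polynomial

section charsum
variable {F : Type*} [Field F] [Fintype F] [DecidableEq F]

/-- Kloosterman sum over a finite field. -/
noncomputable def KS (χ : AddChar F ℂ) (a b : F) : ℂ :=
  ∑ x ∈ Finset.univ.filter (fun x : F => x ≠ 0), χ (a * x + b / x)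

theorem KS_bound_sq (p ν : ℕ) [Fact p.Prime] [CharP F p] (hν : 4 ≤ ν)
    (hcard : Fintype.card F = p ^ (ν + 1) * p ^ (ν + 1)) (a b : F) (ha : a ≠ 0)
    (χ : AddChar F ℂ) (hχ : χ ≠ 1) (hχp : ∀ y, χ (y ^ p - y) = 1) :
    ‖KS χ a b‖ ≤ p * (2 * p + 6) * (p : ℝ) ^ (ν + 1) + 1 := by
  have hp : 2 ≤ p := (Fact.out : p.Prime).two_le
  set q : ℝ := (Fintype.card F : ℝ) with hq
  set S := Finset.univ.filter (fun x : F => x ≠ 0) with hS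
  let f : F → F := fun x => a * x + b / x
  let N : F → ℝ := fun s => ∑ x ∈ S, ∑ y : F, if s = y ^ p - y - f x then 1 else 0
  set M : ℝ := p * ((p : ℝ) ^ (ν + 1) * (p : ℝ) ^ ν + (2 * p + 6) * (p : ℝ) ^ (ν + 1)) with hM
  have hN : ∀ s, N s ≤ M := by
    intro s
    have hst := stepanov p ν hν hcard a s b ha
    have h1 : ∀ x ∈ S, (∑ y : F, if s = y ^ p - y - f x then (1 : ℝ) else 0)
        ≤ if (∃ y, y ^ p - y = a * x + b / x + s) then (p : ℝ) else 0 := by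
      intro x hx
      split_ifs with hex
      · rw [Finset.sum_boole]
        have hPdeg : (X ^ p - (X + C (f x + s)) : F[X]).natDegree = p := by
          rw [natDegree_sub_eq_left_of_natDegree_lt]
          · simp
          · rw [natDegree_X_add_C, natDegree_X_pow]; omega
        have hP0 : (X ^ p - (X + C (f x + s)) : F[X]) ≠ 0 := by
          intro h; rw [h] at hPdeg; simp at hPdeg; omega
        have hsub : Finset.univ.filter (fun y : F => s = y ^ p - y - f x)
            ⊆ (X ^ p - (X + C (f x + s)) : F[X]).roots.toFinset := by
          intro y hy
          rw [Finset.mem_filter] at hy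
          rw [Multiset.mem_toFinset, mem_roots hP0, IsRoot.def]
          simp only [eval_sub, eval_pow, eval_X, eval_add, eval_C]
          rw [hy.2]; ring
        have := (Finset.card_le_card hsub).trans
          ((Multiset.toFinset_card_le _).trans ((card_roots' _).trans hPdeg.le))
        exact_mod_cast this
      · apply le_of_eq
        apply Finset.sum_eq_zero
        intro y _
        rw [if_neg]
        intro h
        exact hex ⟨y, by rw [h]; simp only [f]; ring⟩
    calc N s ≤ ∑ x ∈ S, if (∃ y, y ^ p - y = a * x + b / x + s) then (p : ℝ) else 0 :=
          Finset.sum_le_sum h1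
      _ = p * (Finset.univ.filter (fun x : F => x ≠ 0 ∧ ∃ y, y ^ p - y = a * x + b / x + s)).card := by
          rw [← Finset.sum_filter, Finset.sum_const, hS, Finset.filter_filter, nsmul_eq_mul, mul_comm]
      _ ≤ M := by
          rw [hM]
          apply mul_le_mul_of_nonneg_left _ (by positivity)
          exact_mod_cast hst
  have hsumN : ∑ s, N s = (q - 1) * q := by
    simp only [N]
    rw [Finset.sum_comm]
    have : ∀ x ∈ S, (∑ s, ∑ y : F, if s = y ^ p - y - f x then (1 : ℝ) else 0) = q := by
      intro x _
      rw [Finset.sum_comm]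
      simp [hq]
    rw [Finset.sum_congr rfl this, Finset.sum_const, nsmul_eq_mul]
    congr 1
    rw [hS, Finset.filter_ne', Finset.card_erase_of_mem (Finset.mem_univ _), Finset.card_univ]
    rw [Nat.cast_sub Fintype.card_pos]; simp [hq]
  have hsumχ : ∑ s, χ (-s) * (N s : ℂ) = q * KS χ a b := by
    simp only [N]
    push_cast
    simp_rw [Finset.mul_sum]
    rw [Finset.sum_comm, KS, Finset.mul_sum]
    apply Finset.sum_congr rfl
    intro x _
    rw [Finset.sum_comm]
    have : ∀ y : F, (∑ s, χ (-s) * (((if s = y ^ p - y - f x then (1 : ℝ) else 0) : ℝ) : ℂ)) = χ (f x) := by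
      intro y
      simp only [apply_ite Complex.ofReal, Complex.ofReal_one, Complex.ofReal_zero, mul_ite, mul_one, mul_zero, Finset.sum_ite_eq', Finset.mem_univ, if_true]
      rw [show -(y ^ p - y - f x) = f x - (y ^ p - y) by ring, AddChar.map_sub_eq_div, hχp]; simp
    refine (Finset.sum_congr rfl (fun y _ => this y)).trans ?_
    simp [hq, f]
  have hzero : ∑ s, χ (-s) = 0 := by
    have := Equiv.sum_comp (Equiv.neg F) (fun s => χ s)
    simp only [Equiv.neg_apply] at this
    rw [this]
    exact AddChar.sum_eq_zero_of_ne_one hχ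
  have h2 : q * KS χ a b = ∑ s, χ (-s) * ((N s : ℂ) - M) := by
    simp_rw [mul_sub]
    rw [Finset.sum_sub_distrib, hsumχ, ← Finset.sum_mul, hzero]; simp
  have hqpos : 0 < q := by rw [hq]; exact_mod_cast Fintype.card_pos
  have h3 : q * ‖KS χ a b‖ ≤ q * M - (q - 1) * q := by
    calc q * ‖KS χ a b‖ = ‖(q : ℂ) * KS χ a b‖ := by
          rw [norm_mul, Complex.norm_real, Real.norm_of_nonneg hqpos.le]
      _ ≤ ∑ s, ‖χ (-s) * ((N s : ℂ) - M)‖ := by rw [h2]; exact norm_sum_le _ _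
      _ = ∑ s, (M - N s) := by
          apply Finset.sum_congr rfl
          intro s _
          rw [norm_mul, AddChar.norm_apply, one_mul, ← Complex.ofReal_sub, Complex.norm_real,
            Real.norm_of_nonpos (by linarith [hN s])]
          ring
      _ = _ := by
          rw [Finset.sum_sub_distrib, hsumN, Finset.sum_const, nsmul_eq_mul, Finset.card_univ]
  have h4 : ‖KS χ a b‖ ≤ M - (q - 1) := by
    apply le_of_mul_le_mul_left _ hqpos
    linarith
  have hqv : q = (p : ℝ) ^ (ν + 1) * (p : ℝ) ^ (ν + 1) := by rw [hq, hcard]; push_cast; ring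
  have hMv : M = q + p * (2 * p + 6) * (p : ℝ) ^ (ν + 1) := by rw [hM, hqv]; ring
  rw [hMv] at h4
  linarith

end charsum
end Kl

namespace Kl
open Polynomial
section quad
variable {F : Type} [Field F] [Fintype F] [DecidableEq F]

lemma sum_sq_add_sum_nonsq (hF : ringChar F ≠ 2) (δ : F) (hδ : ¬ IsSquare δ) (h : F → ℂ) :
    ∑ w, h (w ^ 2) + ∑ v, h (δ * v ^ 2) = 2 * ∑ D, h D := by
  have hδ0 : δ ≠ 0 := by
    rintro rfl
    exact hδ (IsSquare.zero)
  have fib : ∀ g : F → F, ∑ w, h (g w) = ∑ D, ((Finset.univ.filter (fun w => g w = D)).card : ℂ) * h D := by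
    intro g
    rw [← Finset.sum_fiberwise Finset.univ g (fun w => h (g w))]
    refine Finset.sum_congr rfl fun D _ => ?_
    rw [Finset.sum_congr rfl (g := fun _ => h D)]
    · simp
    · intro x hx
      rw [(Finset.mem_filter.1 hx).2]
  rw [fib (fun w => w ^ 2), fib (fun v => δ * v ^ 2), ← Finset.sum_add_distrib, Finset.mul_sum]
  refine Finset.sum_congr rfl fun D _ => ?_
  rw [← add_mul]
  congr 1
  have h1 := quadraticChar_card_sqrts hF D
  have h2 := quadraticChar_card_sqrts hF (D * δ⁻¹)
  have h3 : quadraticChar F δ = -1 := quadraticChar_neg_one_iff_not_isSquare.2 hδ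
  have h4 : quadraticChar F δ⁻¹ = -1 := by
    have : quadraticChar F δ * quadraticChar F δ⁻¹ = 1 := by
      rw [← map_mul, mul_inv_cancel₀ hδ0, map_one]
    rw [h3] at this
    linarith
  rw [map_mul, h4] at h2
  have e1 : (Finset.univ.filter (fun w : F => w ^ 2 = D)).card = ({x : F | x ^ 2 = D}.toFinset).card := by
    congr 1; ext; simp
  have e2 : (Finset.univ.filter (fun w : F => δ * w ^ 2 = D)).card = ({x : F | x ^ 2 = D * δ⁻¹}.toFinset).card := by
    congr 1; ext x; simp
    rw [eq_mul_inv_iff_mul_eq₀ hδ0, mul_comm]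
  rw [e1, e2]
  have : ((({x : F | x ^ 2 = D}.toFinset).card : ℤ) : ℂ) + ((({x : F | x ^ 2 = D * δ⁻¹}.toFinset).card : ℤ) : ℂ) = 2 := by
    rw [h1, h2]; push_cast; ring
  exact_mod_cast this

noncomputable def Gf (χ : AddChar F ℂ) (a b u D : F) : ℂ :=
  if u ^ 2 - D = 0 then 0 else χ (u * (2 * a + 2 * b / (u ^ 2 - D)))

lemma KS_eq_ite (χ : AddChar F ℂ) (a b : F) :
    KS χ a b = ∑ x, if x ≠ 0 then χ (a * x + b / x) else 0 := by
  rw [KS, Finset.sum_filter]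

lemma KS_sq (h2 : (2 : F) ≠ 0) (χ : AddChar F ℂ) (a b : F) :
    KS χ a b ^ 2 = ∑ u, ∑ w, Gf χ a b u (w ^ 2) := by
  rw [KS_eq_ite, sq, Finset.sum_mul_sum, ← Fintype.sum_prod_type', ← Fintype.sum_prod_type']
  symm
  refine Fintype.sum_bijective (fun x : F × F => (x.1 + x.2, x.1 - x.2)) ?_ _ _ ?_
  · rw [← Finite.injective_iff_bijective]
    rintro ⟨u, w⟩ ⟨u', w'⟩ h
    simp only [Prod.mk.injEq] at h
    obtain ⟨hx, hy⟩ := h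
    have e1 : 2 * u = 2 * u' := by linear_combination hx + hy
    have e2 : 2 * w = 2 * w' := by linear_combination hx - hy
    rw [mul_left_cancel₀ h2 e1, mul_left_cancel₀ h2 e2]
  · rintro ⟨u, w⟩
    simp only [Gf]
    have : u ^ 2 - w ^ 2 = (u + w) * (u - w) := by ring
    rw [this]
    by_cases h1 : u + w = 0
    · simp [h1]
    by_cases h3 : u - w = 0
    · simp [h3]
    rw [if_neg (mul_ne_zero h1 h3), if_pos h1, if_pos h3, ← AddChar.map_add_eq_mul]
    congr 1
    field_simp
    ring

lemma sum_Gf (h2 : (2 : F) ≠ 0) (χ : AddChar F ℂ) (hχ : χ ≠ 1) (a b : F) (ha : a ≠ 0) (hb : b ≠ 0) :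
    ∑ u, ∑ D, Gf χ a b u D = Fintype.card F := by
  have e : ∀ u, ∑ D, Gf χ a b u D = ∑ n, if n = 0 then 0 else χ (u * (2 * a + 2 * b / n)) := by
    intro u
    exact Fintype.sum_equiv (Equiv.subLeft (u ^ 2)) _ _ (fun D => by simp only [Gf, Equiv.subLeft_apply])
  simp_rw [e]
  rw [Finset.sum_comm]
  have hp : χ.IsPrimitive := AddChar.IsPrimitive.of_ne_one hχ
  rw [Finset.sum_eq_single (-b / a)]
  · have : -b / a ≠ 0 := by simp [ha, hb]
    simp only [this, if_false]
    rw [show 2 * a + 2 * b / (-b / a) = 0 by field_simp; ring]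
    simp
  · intro n _ hn
    by_cases h : n = 0
    · simp [h]
    simp only [h, if_false]
    rw [AddChar.sum_mulShift _ hp, if_neg]
    · simp
    · intro h0
      apply hn
      field_simp at h0
      have : 2 * (a * n + b) = 0 := by linear_combination h0
      rcases mul_eq_zero.1 this with h' | h'
      · exact absurd h' h2
      · field_simp
        linear_combination h'
  · simp

theorem quad_step (p : ℕ) [Fact p.Prime] [CharP F p] (hp2 : p ≠ 2) (χ : AddChar F ℂ) (hχ : χ ≠ 1)
    (hχp : ∀ y, χ (y ^ p - y) = 1) (a b : F) (ha : a ≠ 0) (hb : b ≠ 0) :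
    ∃ (E : Type) (_ : Field E) (_ : Fintype E) (_ : DecidableEq E) (_ : CharP E p)
      (χ' : AddChar E ℂ) (a' b' : E), a' ≠ 0 ∧ b' ≠ 0 ∧ χ' ≠ 1 ∧ (∀ y, χ' (y ^ p - y) = 1) ∧
      Fintype.card E = Fintype.card F ^ 2 ∧
      KS χ' a' b' = 2 * Fintype.card F - KS χ a b ^ 2 := by
  have hF : ringChar F ≠ 2 := by
    rw [ringChar.eq F p]; exact hp2
  have h2 : (2 : F) ≠ 0 := Ring.two_ne_zero hF
  obtain ⟨δ, hδ⟩ := FiniteField.exists_nonsquare hF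
  have : Fact (∀ r : F, r ^ 2 ≠ δ + 0 * r) := ⟨by
    intro r h
    apply hδ
    exact ⟨r, by rw [← sq, h]; ring⟩⟩
  let _ : Fintype (QuadraticAlgebra F δ 0) := Fintype.ofEquiv _ (QuadraticAlgebra.equivProd δ 0).symm
  let _ : DecidableEq (QuadraticAlgebra F δ 0) := Classical.decEq _
  have : CharP (QuadraticAlgebra F δ 0) p := charP_of_injective_algebraMap (QuadraticAlgebra.algebraMap_injective (R := F) (a := δ) (b := 0)) p
  let χ' : AddChar (QuadraticAlgebra F δ 0) ℂ :=
    { toFun := fun z => χ (2 * z.re)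
      map_zero_eq_one' := by simp
      map_add_eq_mul' := by
        intro x y
        rw [QuadraticAlgebra.re_add, mul_add, AddChar.map_add_eq_mul] }
  have hχ' : ∀ z : (QuadraticAlgebra F δ 0), χ' z = χ (2 * z.re) := fun z => rfl
  have hmk : ∀ x : F, (algebraMap F (QuadraticAlgebra F δ 0) x).re = x := fun x => rfl
  refine ⟨(QuadraticAlgebra F δ 0), inferInstance, inferInstance, inferInstance, inferInstance, χ', algebraMap F (QuadraticAlgebra F δ 0) a,
    algebraMap F (QuadraticAlgebra F δ 0) b, ?_, ?_, ?_, ?_, ?_, ?_⟩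
  · simpa using ha
  · simpa using hb
  · intro h
    apply hχ
    ext y
    have := hχ' (algebraMap F (QuadraticAlgebra F δ 0) (y / 2))
    rw [h, hmk, mul_div_cancel₀ _ h2] at this
    simpa using this.symm
  · have hre : ∀ z : (QuadraticAlgebra F δ 0), (z ^ p).re = z.re ^ p := by
      intro z
      have hz : z = QuadraticAlgebra.C z.re + (⟨0, z.im⟩ : (QuadraticAlgebra F δ 0)) := by
        ext <;> simp [-QuadraticAlgebra.C_eq_algebraMap]
      conv_lhs => rw [hz]
      rw [add_pow_char, ← QuadraticAlgebra.C_pow, QuadraticAlgebra.re_add, QuadraticAlgebra.re_C]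
      obtain ⟨k, hk⟩ : Odd p := (Fact.out : p.Prime).odd_of_ne_two hp2
      have : ((⟨0, z.im⟩ : (QuadraticAlgebra F δ 0)) ^ p).re = 0 := by
        rw [hk, pow_succ, pow_mul]
        have : (⟨0, z.im⟩ : (QuadraticAlgebra F δ 0)) ^ 2 = QuadraticAlgebra.C (δ * z.im * z.im) := by
          rw [sq]; ext <;> simp [-QuadraticAlgebra.C_eq_algebraMap, mul_assoc]
        rw [this, ← QuadraticAlgebra.C_pow, QuadraticAlgebra.re_mul]
        simp only [QuadraticAlgebra.re_C, QuadraticAlgebra.im_C, mul_zero, zero_mul, add_zero]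
      rw [this, add_zero]
    intro y
    rw [hχ', QuadraticAlgebra.re_sub, hre, two_mul, AddChar.map_add_eq_mul, hχp, one_mul]
  · rw [Fintype.card_congr (QuadraticAlgebra.equivProd δ 0), Fintype.card_prod, sq]
  · have hKS' : KS χ' (algebraMap F (QuadraticAlgebra F δ 0) a) (algebraMap F (QuadraticAlgebra F δ 0) b) = ∑ u, ∑ v, Gf χ a b u (δ * v ^ 2) := by
      rw [KS_eq_ite, ← Fintype.sum_prod_type']
      refine Fintype.sum_equiv (QuadraticAlgebra.equivProd δ 0) _ _ ?_
      intro z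
      have hn : QuadraticAlgebra.norm z = z.re ^ 2 - δ * z.im ^ 2 := by
        rw [QuadraticAlgebra.norm_def]; ring
      change _ = Gf χ a b z.re (δ * z.im ^ 2)
      rw [Gf, ← hn]
      by_cases hz : z = 0
      · simp [hz]
      have hn0 : QuadraticAlgebra.norm z ≠ 0 := by
        rwa [Ne, QuadraticAlgebra.norm_eq_zero_iff_eq_zero]
      rw [if_pos hz, if_neg hn0, hχ']
      congr 1
      rw [div_eq_mul_inv, QuadraticAlgebra.inv_def]
      simp only [QuadraticAlgebra.re_add, QuadraticAlgebra.re_mul, QuadraticAlgebra.re_smul, QuadraticAlgebra.im_smul, QuadraticAlgebra.re_star, QuadraticAlgebra.im_star, QuadraticAlgebra.algebraMap_re, QuadraticAlgebra.algebraMap_im, smul_eq_mul]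
      field_simp
      ring
    have hq := sum_Gf h2 χ hχ a b ha hb
    have : ∑ u, ∑ w, Gf χ a b u (w ^ 2) + ∑ u, ∑ v, Gf χ a b u (δ * v ^ 2) = 2 * ∑ u, ∑ D, Gf χ a b u D := by
      rw [← Finset.sum_add_distrib, Finset.mul_sum]
      exact Finset.sum_congr rfl fun u _ => sum_sq_add_sum_nonsq hF δ hδ _
    rw [hKS', KS_sq h2, ← hq]
    linear_combination this
end quad
end Kl

namespace Kl
open Polynomial

theorem weil_iter (p : ℕ) [Fact p.Prime] (hp2 : p ≠ 2) (χ : AddChar (ZMod p) ℂ) (hχ : χ ≠ 1)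
    (a b : ZMod p) (ha : a ≠ 0) (hb : b ≠ 0) (η : ℝ) (hη : 0 < η)
    (h : (2 + η) * Real.sqrt p ≤ ‖KS χ a b‖) (j : ℕ) :
    ∃ (E : Type) (_ : Field E) (_ : Fintype E) (_ : DecidableEq E) (_ : CharP E p)
      (χ' : AddChar E ℂ) (a' b' : E), a' ≠ 0 ∧ b' ≠ 0 ∧ χ' ≠ 1 ∧ (∀ y, χ' (y ^ p - y) = 1) ∧
      Fintype.card E = p ^ (2 ^ j) ∧
      (2 + 4 ^ j * η) * Real.sqrt (p ^ (2 ^ j) : ℕ) ≤ ‖KS χ' a' b'‖ := by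
  induction j with
  | zero =>
    refine ⟨ZMod p, inferInstance, inferInstance, inferInstance, inferInstance, χ, a, b, ha, hb, hχ, ?_, ?_, ?_⟩
    · intro y
      rw [ZMod.pow_card, sub_self, AddChar.map_zero_eq_one]
    · simp
    · simpa using h
  | succ j ih =>
    obtain ⟨E, i1, i2, i3, i4, χ', a', b', ha', hb', hχ', hp', hc, hk⟩ := ih
    obtain ⟨E2, j1, j2, j3, j4, χ2, a2, b2, ha2, hb2, hχ2, hp2, hc2, hk2⟩ :=
      quad_step p hp2 χ' hχ' hp' a' b' ha' hb'
    have hcard : Fintype.card E2 = p ^ (2 ^ (j + 1)) := by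
      rw [hc2, hc, ← pow_mul, pow_succ]
    refine ⟨E2, j1, j2, j3, j4, χ2, a2, b2, ha2, hb2, hχ2, hp2, hcard, ?_⟩
    set q : ℝ := ((p ^ (2 ^ j) : ℕ) : ℝ) with hq
    have hq0 : 0 ≤ q := Nat.cast_nonneg _
    have e1 : (((p ^ (2 ^ (j + 1)) : ℕ)) : ℝ) = q ^ 2 := by
      rw [hq, ← Nat.cast_pow, ← pow_mul, pow_succ]
    rw [e1, Real.sqrt_sq hq0, hk2, hc]
    have hs : Real.sqrt q ^ 2 = q := Real.sq_sqrt hq0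
    have n1 : ‖KS χ' a' b'‖ ^ 2 - 2 * q ≤ ‖2 * ((p ^ (2 ^ j) : ℕ) : ℂ) - KS χ' a' b' ^ 2‖ := by
      have := norm_sub_norm_le (KS χ' a' b' ^ 2) (2 * ((p ^ (2 ^ j) : ℕ) : ℂ))
      rw [norm_sub_rev, norm_pow, norm_mul, Complex.norm_natCast, Complex.norm_ofNat] at this
      exact this
    have h4 : (0 : ℝ) < 4 ^ j * η := by positivity
    have n2 : (2 + 4 ^ j * η) ^ 2 * q ≤ ‖KS χ' a' b'‖ ^ 2 := by
      have := pow_le_pow_left₀ (by positivity) hk 2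
      rwa [mul_pow, hs] at this
    refine le_trans ?_ n1
    rw [pow_succ]
    nlinarith [mul_nonneg (sq_nonneg (4 ^ j * η)) hq0]

theorem weil (p : ℕ) [Fact p.Prime] (hp2 : p ≠ 2) (χ : AddChar (ZMod p) ℂ) (hχ : χ ≠ 1)
    (a b : ZMod p) (ha : a ≠ 0) (hb : b ≠ 0) : ‖KS χ a b‖ ≤ 2 * Real.sqrt p := by
  by_contra! hlt
  have hp0 : (0 : ℝ) < p := by exact_mod_cast (Fact.out : p.Prime).pos
  have hs : 0 < Real.sqrt p := Real.sqrt_pos.2 hp0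
  set η := ‖KS χ a b‖ / Real.sqrt p - 2 with hηd
  have hη : 0 < η := by
    rw [hηd, sub_pos, lt_div_iff₀ hs]; exact hlt
  have h0 : (2 + η) * Real.sqrt p ≤ ‖KS χ a b‖ := by
    rw [hηd]
    rw [add_sub_cancel, div_mul_cancel₀ _ hs.ne']
  obtain ⟨i, hi⟩ := pow_unbounded_of_one_lt ((p * (2 * p + 6) + 1 : ℝ) / η) (show (1 : ℝ) < 4 by norm_num)
  rw [div_lt_iff₀ hη] at hi
  obtain ⟨E, i1, i2, i3, i4, χ', a', b', ha', hb', hχ', hp', hc, hk⟩ :=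
    weil_iter p hp2 χ hχ a b ha hb η hη h0 (i + 4)
  obtain ⟨ν, hν⟩ : ∃ ν, 2 ^ (i + 3) = ν + 1 := Nat.exists_eq_succ_of_ne_zero (by positivity)
  have hν4 : 4 ≤ ν := by
    have : 8 ≤ 2 ^ (i + 3) := by rw [pow_add]; nlinarith [Nat.one_le_two_pow (n := i)]
    omega
  have e : 2 ^ (i + 4) = (ν + 1) + (ν + 1) := by rw [← hν]; ring
  have hb := KS_bound_sq p ν hν4 (by rw [hc, e, pow_add]) a' b' ha' χ' hχ' hp'
  have hQ : (1 : ℝ) ≤ (p : ℝ) ^ (ν + 1) := one_le_pow₀ (by exact_mod_cast (Fact.out : p.Prime).one_lt.le)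
  rw [e, pow_add p, Nat.cast_mul, Real.sqrt_mul_self (Nat.cast_nonneg _), Nat.cast_pow] at hk
  have h44 : (4 : ℝ) ^ i ≤ 4 ^ (i + 4) := pow_le_pow_right₀ (by norm_num) (by omega)
  have h5 : (p * (2 * p + 6) + 1 : ℝ) < 4 ^ (i + 4) * η := lt_of_lt_of_le hi (by gcongr)
  have h6 : (p * (2 * p + 6) + 1 + 2 : ℝ) * (p : ℝ) ^ (ν + 1) ≤ (2 + 4 ^ (i + 4) * η) * (p : ℝ) ^ (ν + 1) := by
    apply mul_le_mul_of_nonneg_right _ (by positivity)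
    linarith
  nlinarith
end Kl

namespace Kl
open scoped Classical
section zm
variable {N : ℕ} [NeZero N]

noncomputable def Kz (m b : ZMod N) : ℂ :=
  ∑ x ∈ Finset.univ.filter (fun x : ZMod N => IsUnit x), ZMod.stdAddChar (m * x + b * x⁻¹)

noncomputable def Sz (n m k : ZMod N) : ℂ :=
  ∑ x : ZMod N, ∑ y : ZMod N, if x * y = n then ZMod.stdAddChar (m * x + k * y) else 0

lemma zinv_eq {x y : ZMod N} (h : x * y = 1) : x⁻¹ = y := by
  have hx : IsUnit x := IsUnit.of_mul_eq_one y h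
  calc x⁻¹ = x⁻¹ * (x * y) := by rw [h, mul_one]
    _ = y := by rw [← mul_assoc, ZMod.inv_mul_of_unit x hx, one_mul]

lemma norm_std (x : ZMod N) : ‖(ZMod.stdAddChar x : ℂ)‖ = 1 := by
  exact AddChar.norm_apply _ _

lemma sum_std (b : ZMod N) : ∑ x : ZMod N, (ZMod.stdAddChar (x * b) : ℂ) = if b = 0 then (N : ℂ) else 0 := by
  rw [AddChar.sum_mulShift b (ZMod.isPrimitive_stdAddChar N), ZMod.card]
  split_ifs <;> simp

/-- averaging over a family of substitutions `x ↦ x * u t`. -/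
lemma avg (X : Finset (ZMod N)) (f : ZMod N → ℂ) (u v : ZMod N → ZMod N) (huv : ∀ t, u t * v t = 1)
    (hX : ∀ t, ∀ x, x ∈ X ↔ x * u t ∈ X) :
    (N : ℂ) * ∑ x ∈ X, f x = ∑ x ∈ X, ∑ t : ZMod N, f (x * u t) := by
  rw [Finset.sum_comm]
  have : ∀ t, ∑ x ∈ X, f (x * u t) = ∑ x ∈ X, f x := by
    intro t
    refine Finset.sum_bij' (fun x _ => x * u t) (fun x _ => x * v t) ?_ ?_ ?_ ?_ ?_
    · intro x hx; exact (hX t x).1 hx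
    · intro x hx
      rw [hX t, mul_assoc, mul_comm (v t), huv, mul_one]; exact hx
    · intro x hx; simp only [mul_assoc, huv, mul_one]
    · intro x hx; simp only [mul_assoc, mul_comm (v t), huv, mul_one]
    · intro x hx; rfl
  rw [Finset.sum_congr rfl (fun t _ => this t)]
  simp

lemma K_stat (P : ZMod N) (hP : P * P = 0) (m b : ZMod N) :
    Kz m b = ∑ x ∈ Finset.univ.filter (fun x : ZMod N => IsUnit x ∧ P * (m * x - b * x⁻¹) = 0),
      ZMod.stdAddChar (m * x + b * x⁻¹) := by
  have hN : (N : ℂ) ≠ 0 := by exact_mod_cast NeZero.ne N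
  apply mul_left_cancel₀ hN
  have huv : ∀ t : ZMod N, (1 + P * t) * (1 - P * t) = 1 := by
    intro t
    linear_combination (- t * t) * hP
  rw [Kz, avg _ _ (fun t => 1 + P * t) (fun t => 1 - P * t) huv]
  · rw [← Finset.filter_filter, Finset.sum_filter (p := fun x => P * (m * x - b * x⁻¹) = 0), Finset.mul_sum]
    refine Finset.sum_congr rfl fun x hx => ?_
    have hx : IsUnit x := by simpa using hx
    have hxx := ZMod.mul_inv_of_unit x hx
    have e : ∀ t : ZMod N, (ZMod.stdAddChar (m * (x * (1 + P * t)) + b * (x * (1 + P * t))⁻¹) : ℂ)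
        = ZMod.stdAddChar (m * x + b * x⁻¹) * ZMod.stdAddChar (t * (P * (m * x - b * x⁻¹))) := by
      intro t
      rw [← AddChar.map_add_eq_mul]
      congr 1
      rw [zinv_eq (y := x⁻¹ * (1 - P * t)) (by linear_combination hxx + (- t * t * x * x⁻¹) * hP)]
      ring
    rw [Finset.sum_congr rfl fun t _ => e t, ← Finset.mul_sum, sum_std]
    split_ifs
    · ring
    · simp
  · intro t x
    have : IsUnit (1 + P * t) := IsUnit.of_mul_eq_one _ (huv t)
    simp [IsUnit.mul_iff, this]

/-- Weyl squaring for quadratic sums. -/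
lemma weyl (A B : ZMod N) (c : ℕ)
    (hc : (Finset.univ.filter (fun h : ZMod N => 2 * B * h = 0)).card ≤ c) :
    ‖∑ t : ZMod N, (ZMod.stdAddChar (A * t + B * t ^ 2) : ℂ)‖ ^ 2 ≤ N * c := by
  set G := ∑ t : ZMod N, (ZMod.stdAddChar (A * t + B * t ^ 2) : ℂ) with hG
  have h1 : G * (starRingEnd ℂ) G =
      ∑ h : ZMod N, ZMod.stdAddChar (A * h + B * h ^ 2) * (if 2 * B * h = 0 then (N : ℂ) else 0) := by
    have : (starRingEnd ℂ) G = ∑ t : ZMod N, (ZMod.stdAddChar (-(A * t + B * t ^ 2)) : ℂ) := by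
      rw [hG, map_sum]
      refine Finset.sum_congr rfl fun t _ => ?_
      rw [AddChar.map_neg_eq_conj]
    rw [this, hG, Finset.sum_mul_sum, Finset.sum_comm]
    have e : ∀ t : ZMod N, ∑ s : ZMod N, (ZMod.stdAddChar (A * s + B * s ^ 2) : ℂ) * ZMod.stdAddChar (-(A * t + B * t ^ 2))
        = ∑ h : ZMod N, ZMod.stdAddChar (A * h + B * h ^ 2) * ZMod.stdAddChar (t * (2 * B * h)) := by
      intro t
      refine Fintype.sum_equiv (Equiv.subRight t) _ _ ?_
      intro s
      rw [← AddChar.map_add_eq_mul, ← AddChar.map_add_eq_mul, Equiv.subRight_apply]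
      congr 1
      ring
    rw [Finset.sum_congr rfl fun t _ => e t, Finset.sum_comm]
    refine Finset.sum_congr rfl fun h _ => ?_
    rw [← Finset.mul_sum, sum_std]
  have h2 : ‖G‖ ^ 2 = ‖G * (starRingEnd ℂ) G‖ := by
    rw [norm_mul, RCLike.norm_conj, sq]
  rw [h2, h1]
  refine (norm_sum_le _ _).trans ?_
  have : ∀ h : ZMod N, ‖(ZMod.stdAddChar (A * h + B * h ^ 2) : ℂ) * (if 2 * B * h = 0 then (N : ℂ) else 0)‖
      = if 2 * B * h = 0 then (N : ℝ) else 0 := by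
    intro h
    rw [norm_mul, norm_std, one_mul]
    split_ifs <;> simp
  rw [Finset.sum_congr rfl fun h _ => this h, ← Finset.sum_filter, Finset.sum_const, nsmul_eq_mul, mul_comm]
  gcongr

lemma K_stat2 (P R : ZMod N) (hP : P * P = 0) (hPR : P * R = 0) (hR : R * R * R = 0) (m b : ZMod N) (X c : ℕ)
    (hX : (Finset.univ.filter (fun x : ZMod N => IsUnit x ∧ P * (m * x - b * x⁻¹) = 0)).card ≤ X)
    (hc : ∀ u : ZMod N, IsUnit u → (Finset.univ.filter (fun h : ZMod N => 2 * (R * R * b * u) * h = 0)).card ≤ c) :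
    N * ‖Kz m b‖ ≤ X * Real.sqrt (N * c) := by
  have huv : ∀ t : ZMod N, (1 + R * t) * (1 - R * t + R * R * t ^ 2) = 1 := by
    intro t
    linear_combination (t ^ 3) * hR
  have hinv : ∀ x : ZMod N, IsUnit x → ∀ t, (x * (1 + R * t))⁻¹ = x⁻¹ * (1 - R * t + R * R * t ^ 2) := by
    intro x hx t
    have hxx := ZMod.mul_inv_of_unit x hx
    exact zinv_eq (by linear_combination hxx + (t ^ 3 * x * x⁻¹) * hR)
  have h1 : (N : ℝ) * ‖Kz m b‖ = ‖(N : ℂ) * Kz m b‖ := by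
    rw [norm_mul, Complex.norm_natCast]
  rw [h1, K_stat P hP, avg _ _ (fun t => 1 + R * t) (fun t => 1 - R * t + R * R * t ^ 2) huv]
  · refine (norm_sum_le _ _).trans ?_
    calc _ ≤ ∑ x ∈ Finset.univ.filter (fun x : ZMod N => IsUnit x ∧ P * (m * x - b * x⁻¹) = 0), Real.sqrt (N * c) := by
            refine Finset.sum_le_sum fun x hx => ?_
            have hx : IsUnit x := (Finset.mem_filter.1 hx).2.1
            have e : ∀ t : ZMod N, (ZMod.stdAddChar (m * (x * (1 + R * t)) + b * (x * (1 + R * t))⁻¹) : ℂ)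
              = ZMod.stdAddChar (m * x + b * x⁻¹) * ZMod.stdAddChar ((R * (m * x - b * x⁻¹)) * t + (R * R * b * x⁻¹) * t ^ 2) := by
              intro t
              rw [← AddChar.map_add_eq_mul, hinv x hx]
              congr 1
              ring
            rw [Finset.sum_congr rfl fun t _ => e t, ← Finset.mul_sum, norm_mul, norm_std, one_mul]
            apply Real.le_sqrt_of_sq_le
            apply weyl
            exact hc _ (IsUnit.of_mul_eq_one _ (ZMod.inv_mul_of_unit x hx))
      _ ≤ _ := by
            rw [Finset.sum_const, nsmul_eq_mul]
            gcongr
  · intro t x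
    have hu : IsUnit (1 + R * t) := IsUnit.of_mul_eq_one _ (huv t)
    simp only [Finset.mem_filter, Finset.mem_univ, true_and, IsUnit.mul_iff, hu, and_true]
    refine and_congr_right fun hx => ?_
    rw [hinv x hx]
    have : P * (m * (x * (1 + R * t)) - b * (x⁻¹ * (1 - R * t + R * R * t ^ 2))) = P * (m * x - b * x⁻¹) := by
      linear_combination (m * x * t + b * x⁻¹ * t - b * x⁻¹ * R * t ^ 2) * hPR
    rw [this]
end zm
end Kl

namespace Kl
open scoped Classical
section pp
variable {N : ℕ} [NeZero N] {p α : ℕ} [Fact p.Prime]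

lemma not_unit_iff (hN : N = p ^ α) (hα : α ≠ 0) (z : ZMod N) : ¬ IsUnit z ↔ ∃ w, z = p * w := by
  subst hN
  have hp : p.Prime := Fact.out
  constructor
  · intro h
    rw [← ZMod.natCast_zmod_val z, ZMod.isUnit_iff_coprime, Nat.coprime_pow_right_iff (Nat.pos_of_ne_zero hα),
      Nat.coprime_comm, hp.coprime_iff_not_dvd, not_not] at h
    obtain ⟨w, hw⟩ := h
    refine ⟨(w : ZMod (p ^ α)), ?_⟩
    rw [← ZMod.natCast_zmod_val z, hw]; push_cast; rfl
  · rintro ⟨w, rfl⟩ h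
    have h1 : IsUnit ((p : ℕ) : ZMod (p ^ α)) := isUnit_of_mul_isUnit_left h
    rw [ZMod.isUnit_iff_coprime, Nat.coprime_pow_right_iff (Nat.pos_of_ne_zero hα), Nat.coprime_self] at h1
    exact hp.one_lt.ne' h1

lemma unit_of_add (hN : N = p ^ α) (hα : α ≠ 0) {x y : ZMod N} (h : IsUnit (x + y)) : IsUnit x ∨ IsUnit y := by
  by_contra! hh
  obtain ⟨a, rfl⟩ := (not_unit_iff hN hα _).1 hh.1
  obtain ⟨b, rfl⟩ := (not_unit_iff hN hα _).1 hh.2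
  exact (not_unit_iff hN hα _).2 ⟨a + b, by ring⟩ h

lemma card_ann (hN : N = p ^ α) {i : ℕ} (hi : i ≤ α) :
    (Finset.univ.filter (fun z : ZMod N => (p : ZMod N) ^ i * z = 0)).card ≤ p ^ i := by
  subst hN
  have hp : p.Prime := Fact.out
  calc _ ≤ ((Finset.range (p ^ i)).image (fun w : ℕ => ((p ^ (α - i) * w : ℕ) : ZMod (p ^ α)))).card := by
        apply Finset.card_le_card
        intro z hz
        simp only [Finset.mem_filter, Finset.mem_univ, true_and] at hz
        rw [← ZMod.natCast_zmod_val z] at hz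
        have h1 : ((p ^ i * z.val : ℕ) : ZMod (p ^ α)) = 0 := by push_cast at hz ⊢; exact hz
        rw [ZMod.natCast_eq_zero_iff] at h1
        have e : p ^ α = p ^ i * p ^ (α - i) := by rw [← pow_add]; congr 1; omega
        have h2 : p ^ (α - i) ∣ z.val := by
          exact Nat.dvd_of_mul_dvd_mul_left (pow_pos hp.pos i) (e.symm.dvd.trans h1)
        obtain ⟨w, hw⟩ := h2
        simp only [Finset.mem_image, Finset.mem_range]
        refine ⟨w, ?_, ?_⟩
        · have := ZMod.val_lt z
          rw [hw] at this
          have e' : p ^ α = p ^ (α - i) * p ^ i := by rw [e, mul_comm]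
          exact Nat.lt_of_mul_lt_mul_left (this.trans_eq e')
        · rw [← hw, ZMod.natCast_zmod_val]
    _ ≤ _ := by
        refine Finset.card_image_le.trans ?_
        simp

lemma pow_zero_of_le (hN : N = p ^ α) {i : ℕ} (hi : α ≤ i) : (p : ZMod N) ^ i = 0 := by
  subst hN
  have : ((p ^ i : ℕ) : ZMod (p ^ α)) = 0 := by
    rw [ZMod.natCast_eq_zero_iff]; exact pow_dvd_pow _ hi
  exact_mod_cast this

lemma pow_ne_zero_of_lt (hN : N = p ^ α) {i : ℕ} (hi : i < α) : (p : ZMod N) ^ i ≠ 0 := by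
  subst hN
  intro h
  have : ((p ^ i : ℕ) : ZMod (p ^ α)) = 0 := by exact_mod_cast h
  rw [ZMod.natCast_eq_zero_iff] at this
  have := (Nat.pow_dvd_pow_iff_le_right (Fact.out : p.Prime).one_lt).1 this
  omega

lemma two_unit (hN : N = p ^ α) (hα : α ≠ 0) (hp2 : p ≠ 2) : IsUnit (2 : ZMod N) := by
  subst hN
  have : ((2 : ℕ) : ZMod (p ^ α)) = 2 := by norm_cast
  rw [← this, ZMod.isUnit_iff_coprime, Nat.coprime_pow_right_iff (Nat.pos_of_ne_zero hα)]
  rw [Nat.coprime_primes Nat.prime_two Fact.out]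
  exact hp2.symm

abbrev Xs (P m b : ZMod N) : Finset (ZMod N) :=
  Finset.univ.filter (fun x : ZMod N => IsUnit x ∧ P * (m * x - b * x⁻¹) = 0)

lemma X_unit (hN : N = p ^ α) {i : ℕ} (hi : i < α) (m b : ZMod N) (hmb : IsUnit m ∨ IsUnit b)
    (x : ZMod N) (hx : x ∈ Xs ((p : ZMod N) ^ i) m b) : IsUnit m ∧ IsUnit b := by
  have hα : α ≠ 0 := by omega
  obtain ⟨hx, h⟩ := (Finset.mem_filter.1 hx).2
  have hxi : IsUnit x⁻¹ := IsUnit.of_mul_eq_one _ (ZMod.inv_mul_of_unit x hx)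
  have hnu : ¬ IsUnit (m * x - b * x⁻¹) := by
    intro hu
    rw [hu.mul_left_eq_zero] at h
    exact pow_ne_zero_of_lt hN hi h
  rcases hmb with hm | hb
  · refine ⟨hm, ?_⟩
    have : IsUnit ((m * x - b * x⁻¹) + b * x⁻¹) := by rw [sub_add_cancel]; exact hm.mul hx
    rcases unit_of_add hN hα this with h' | h'
    · exact absurd h' hnu
    · exact isUnit_of_mul_isUnit_left h'
  · refine ⟨?_, hb⟩
    have : IsUnit (-(m * x - b * x⁻¹) + m * x) := by
      rw [show -(m * x - b * x⁻¹) + m * x = b * x⁻¹ by ring]; exact hb.mul hxi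
    rcases unit_of_add hN hα this with h' | h'
    · exact absurd (by simpa using h'.neg) hnu
    · exact isUnit_of_mul_isUnit_left h'

lemma X_card (hN : N = p ^ α) {i : ℕ} (hi : i < α) (m b : ZMod N) (hmb : IsUnit m ∨ IsUnit b) :
    (Xs ((p : ZMod N) ^ i) m b).card ≤ if p = 2 then 4 * p ^ i else 2 * p ^ i := by
  have hα : α ≠ 0 := by omega
  by_cases hne : (Xs ((p : ZMod N) ^ i) m b).Nonempty
  swap
  · rw [Finset.not_nonempty_iff_eq_empty.1 hne]; simp
  obtain ⟨x₀, hx₀⟩ := hne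
  obtain ⟨hm, hb⟩ := X_unit hN hi m b hmb x₀ hx₀
  obtain ⟨ux₀, h₀⟩ := (Finset.mem_filter.1 hx₀).2
  have key : ∀ x ∈ Xs ((p : ZMod N) ^ i) m b, (p : ZMod N) ^ i * ((x - x₀) * (x + x₀)) = 0 := by
    intro x hx
    obtain ⟨ux, h⟩ := (Finset.mem_filter.1 hx).2
    have e := ZMod.mul_inv_of_unit x ux
    have e₀ := ZMod.mul_inv_of_unit x₀ ux₀
    rw [← hm.mul_right_eq_zero]
    linear_combination x * h - x₀ * h₀ + (p : ZMod N) ^ i * b * e - (p : ZMod N) ^ i * b * e₀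
  have main : ∀ j, j ≤ α → (∀ x ∈ Xs ((p : ZMod N) ^ i) m b, (p : ZMod N) ^ j * (x - x₀) = 0 ∨ (p : ZMod N) ^ j * (x + x₀) = 0) →
      (Xs ((p : ZMod N) ^ i) m b).card ≤ 2 * p ^ j := by
    intro j hj h
    set A := Finset.univ.filter (fun z : ZMod N => (p : ZMod N) ^ j * z = 0)
    calc _ ≤ (A.image (fun z => z + x₀) ∪ A.image (fun z => z - x₀)).card := by
          apply Finset.card_le_card
          intro x hx
          rw [Finset.mem_union, Finset.mem_image, Finset.mem_image]
          rcases h x hx with h' | h'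
          · exact Or.inl ⟨x - x₀, by simp [A, h'], by ring⟩
          · exact Or.inr ⟨x + x₀, by simp [A, h'], by ring⟩
      _ ≤ A.card + A.card := (Finset.card_union_le _ _).trans (add_le_add Finset.card_image_le Finset.card_image_le)
      _ ≤ _ := by have := card_ann hN hj; change A.card ≤ _ at this; omega
  split_ifs with hp2
  · have : (4 : ℕ) * p ^ i = 2 * p ^ (i + 1) := by rw [pow_succ, hp2]; ring
    rw [this]
    apply main (i + 1) hi
    intro x hx
    have ux := (Finset.mem_filter.1 hx).2.1
    have hk := key x hx
    have n2 : ¬ IsUnit (2 : ZMod N) := by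
      rw [not_unit_iff hN hα]; exact ⟨1, by rw [hp2]; norm_num⟩
    have hnu : ¬ IsUnit (x - x₀) := by
      -- x, x₀ odd
      intro hu
      have h1 : ∀ z : ZMod N, IsUnit z → ¬ IsUnit (z - 1) := by
        intro z hz
        rw [not_unit_iff hN hα]
        have hz' : Odd z.val := by
          subst hN
          rw [← ZMod.natCast_zmod_val z, ZMod.isUnit_iff_coprime, Nat.coprime_pow_right_iff (Nat.pos_of_ne_zero hα)] at hz
          generalize z.val = v at hz
          rw [hp2, Nat.coprime_two_right] at hz
          exact hz
        obtain ⟨w, hw⟩ := hz'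
        refine ⟨w, ?_⟩
        rw [← ZMod.natCast_zmod_val z, hw, hp2]; push_cast; ring
      have : IsUnit ((x - 1) + -(x₀ - 1)) := by rw [show (x - 1) + -(x₀ - 1) = x - x₀ by ring]; exact hu
      rcases unit_of_add hN hα this with h' | h'
      · exact h1 x ux h'
      · exact h1 x₀ ux₀ (by simpa using h'.neg)
    obtain ⟨c, hc⟩ := (not_unit_iff hN hα _).1 hnu
    have hpp : (p : ZMod N) = 2 := by rw [hp2]; norm_num
    have hx' : x = x₀ + p * c := by linear_combination hc
    have hu : IsUnit (c + x₀ + -c) := by simpa using ux₀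
    have hx'' : x + x₀ = p * (c + x₀) := by rw [hx', hpp]; ring
    rw [hc, hx''] at hk
    rw [hc, hx'']
    rcases unit_of_add hN hα hu with h' | h'
    · left
      rw [← h'.mul_left_eq_zero]
      rw [← hk]; ring
    · right
      rw [IsUnit.neg_iff] at h'
      rw [← h'.mul_left_eq_zero]
      rw [← hk]; ring
  · apply main i hi.le
    intro x hx
    have hk := key x hx
    have hu : IsUnit ((x + x₀) + -(x - x₀)) := by
      rw [show (x + x₀) + -(x - x₀) = 2 * x₀ by ring]
      exact (two_unit hN hα hp2).mul ux₀
    rcases unit_of_add hN hα hu with h' | h'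
    · left
      rw [← h'.mul_left_eq_zero, ← hk]; ring
    · right
      rw [IsUnit.neg_iff] at h'
      rw [← h'.mul_left_eq_zero, ← hk]; ring

lemma K_norm_le_card (P : ZMod N) (hP : P * P = 0) (m b : ZMod N) : ‖Kz m b‖ ≤ (Xs P m b).card := by
  rw [K_stat P hP]
  refine (norm_sum_le _ _).trans ?_
  simp

theorem K_unit_bound (hN : N = p ^ α) (hα : 2 ≤ α) (m b : ZMod N) (hmb : IsUnit m ∨ IsUnit b) :
    ‖Kz m b‖ ≤ 8 * Real.sqrt N := by
  have hp : p.Prime := Fact.out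
  have hp0 : (0 : ℝ) < p := by exact_mod_cast hp.pos
  have hs0 := Real.sqrt_nonneg (p : ℝ)
  have hs : Real.sqrt p * Real.sqrt p = p := Real.mul_self_sqrt hp0.le
  have hα0 : α ≠ 0 := by omega
  obtain ⟨γ, hγ | hγ⟩ := Nat.even_or_odd' α
  · have h1 := K_norm_le_card ((p : ZMod N) ^ γ) (by rw [← pow_add]; exact pow_zero_of_le hN (by omega)) m b
    have h2 : ((Xs ((p : ZMod N) ^ γ) m b).card : ℝ) ≤ 4 * p ^ γ := by
      have := X_card hN (i := γ) (by omega) m b hmb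
      have h3 : (Xs ((p : ZMod N) ^ γ) m b).card ≤ 4 * p ^ γ := by
        refine this.trans ?_
        split_ifs <;> omega
      exact_mod_cast h3
    have h3 : Real.sqrt N = (p : ℝ) ^ γ := by
      rw [hN, hγ]; push_cast
      rw [mul_comm, pow_mul, Real.sqrt_sq (by positivity)]
    rw [h3]
    have : (0 : ℝ) ≤ (p : ℝ) ^ γ := by positivity
    linarith
  · have h3 : Real.sqrt N = (p : ℝ) ^ γ * Real.sqrt p := by
      rw [hN, hγ]; push_cast
      rw [pow_succ, mul_comm 2, pow_mul, Real.sqrt_mul (by positivity), Real.sqrt_sq (by positivity)]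
    have hX := X_card hN (i := γ + 1) (by omega) m b hmb
    have hPP : (p : ZMod N) ^ (γ + 1) * (p : ZMod N) ^ (γ + 1) = 0 := by
      rw [← pow_add]; exact pow_zero_of_le hN (by omega)
    have hg0 : (0 : ℝ) ≤ (p : ℝ) ^ γ := by positivity
    by_cases hp2 : p = 2
    · rw [if_pos hp2] at hX
      have h1 := K_norm_le_card _ hPP m b
      have h2 : ((Xs ((p : ZMod N) ^ (γ + 1)) m b).card : ℝ) ≤ 4 * p ^ (γ + 1) := by exact_mod_cast hX
      rw [h3]
      have h4 : (1 : ℝ) ≤ Real.sqrt p := by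
        rw [Real.one_le_sqrt]; exact_mod_cast hp.one_lt.le
      have h5 : (p : ℝ) = 2 := by exact_mod_cast hp2
      have h6 : (4 : ℝ) * p ^ (γ + 1) = 8 * p ^ γ := by rw [pow_succ]; nth_rw 2 [h5]; ring
      nlinarith
    · rw [if_neg hp2] at hX
      by_cases hb : IsUnit b
      swap
      · have : (Xs ((p : ZMod N) ^ (γ + 1)) m b).card = 0 := by
          rw [Finset.card_eq_zero, Finset.eq_empty_iff_forall_notMem]
          intro x hx
          exact hb (X_unit hN (by omega) m b hmb x hx).2
        have h1 := K_norm_le_card _ hPP m b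
        rw [this] at h1
        refine h1.trans ?_
        rw [Nat.cast_zero]
        positivity
      have hc : ∀ u : ZMod N, IsUnit u → (Finset.univ.filter (fun h : ZMod N =>
          2 * ((p : ZMod N) ^ γ * (p : ZMod N) ^ γ * b * u) * h = 0)).card ≤ p ^ (2 * γ) := by
        intro u hu
        refine le_trans (Finset.card_le_card ?_) (card_ann hN (i := 2 * γ) (by omega))
        intro h hh
        simp only [Finset.mem_filter, Finset.mem_univ, true_and] at hh ⊢
        have : IsUnit (2 * b * u) := ((two_unit hN hα0 hp2).mul hb).mul hu
        rw [← this.mul_right_eq_zero, ← hh]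
        ring
      have hK := K_stat2 ((p : ZMod N) ^ (γ + 1)) ((p : ZMod N) ^ γ) hPP
        (by rw [← pow_add]; exact pow_zero_of_le hN (by omega))
        (by rw [← pow_add, ← pow_add]; exact pow_zero_of_le hN (by omega)) m b _ _ hX hc
      have e1 : Real.sqrt (N * (p ^ (2 * γ) : ℕ)) = (p : ℝ) ^ γ * (p : ℝ) ^ γ * Real.sqrt p := by
        rw [Real.sqrt_mul (by positivity), h3]; push_cast
        rw [mul_comm 2, pow_mul, Real.sqrt_sq (by positivity)]; ring
      have e2 : (N : ℝ) = (p : ℝ) ^ γ * (p : ℝ) ^ γ * p := by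
        rw [hN, hγ]; push_cast; ring
      rw [e1, e2] at hK
      push_cast at hK
      have hG : (0 : ℝ) < (p : ℝ) ^ γ * (p : ℝ) ^ γ * p := by positivity
      have : ‖Kz m b‖ ≤ 2 * (p : ℝ) ^ γ * Real.sqrt p := by
        refine le_of_mul_le_mul_left (hK.trans (le_of_eq ?_)) hG
        rw [pow_succ]; ring
      rw [h3]
      nlinarith [mul_nonneg hg0 hs0]
end pp
end Kl

namespace Kl
open scoped Classical

lemma hom_sum {G H : Type*} [AddCommGroup G] [Fintype G] [AddCommGroup H] [Fintype H] [DecidableEq H] (f : G →+ H)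
    (g : H → ℂ) : ∑ x, g (f x) = ((Finset.univ.filter (fun x => f x = 0)).card : ℂ) *
      ∑ y ∈ Finset.univ.image f, g y := by
  rw [Finset.sum_comp g f, Finset.mul_sum]
  refine Finset.sum_congr rfl fun y hy => ?_
  rw [nsmul_eq_mul]
  congr 2
  obtain ⟨x₀, -, hx₀⟩ := Finset.mem_image.1 hy
  refine Finset.card_bij' (fun x _ => x - x₀) (fun x _ => x + x₀) ?_ ?_ ?_ ?_
  · intro x hx; simp only [Finset.mem_filter, Finset.mem_univ, true_and] at hx ⊢; rw [map_sub, hx, hx₀, sub_self]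
  · intro x hx; simp only [Finset.mem_filter, Finset.mem_univ, true_and] at hx ⊢; rw [map_add, hx, hx₀, zero_add]
  · intro x hx; simp
  · intro x hx; simp

section red
variable {N M : ℕ} [NeZero N] [NeZero M] {p α : ℕ} [Fact p.Prime]

noncomputable def red (hN : N = p * M) : ZMod N →+* ZMod M := ZMod.castHom (hN ▸ Dvd.intro_left p rfl) (ZMod M)

lemma red_surj (hN : N = p * M) : Function.Surjective (red hN) := ZMod.castHom_surjective _

lemma red_zero (hN : N = p * M) (z : ZMod N) : red hN z = 0 ↔ (p : ZMod N) * z = 0 := by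
  have hp : 0 < p := (Fact.out : p.Prime).pos
  obtain ⟨v, rfl⟩ := ZMod.natCast_zmod_surjective z
  rw [map_natCast, ZMod.natCast_eq_zero_iff, ← Nat.cast_mul, ZMod.natCast_eq_zero_iff]
  subst hN
  exact (Nat.mul_dvd_mul_iff_left hp).symm

lemma std_red (hN : N = p * M) (z : ZMod N) :
    (ZMod.stdAddChar ((p : ZMod N) * z) : ℂ) = ZMod.stdAddChar (red hN z) := by
  obtain ⟨v, rfl⟩ := ZMod.intCast_surjective z
  have : (p : ZMod N) * (v : ZMod N) = ((p * v : ℤ) : ZMod N) := by push_cast; ring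
  rw [this, map_intCast (red hN), ZMod.stdAddChar_coe, ZMod.stdAddChar_coe]
  subst hN
  have hp : (p : ℂ) ≠ 0 := by exact_mod_cast (Fact.out : p.Prime).ne_zero
  have hM : (M : ℂ) ≠ 0 := by exact_mod_cast NeZero.ne M
  congr 1
  push_cast
  field_simp

lemma card_red (hN : N = p * M) : (Finset.univ.filter (fun z : ZMod N => red hN z = 0)).card = p := by
  have h := hom_sum (red hN).toAddMonoidHom (fun _ => (1 : ℂ))
  have him : Finset.univ.image (red hN).toAddMonoidHom = Finset.univ := by
    ext y; simp; exact red_surj hN y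
  rw [him] at h
  simp only [Finset.sum_const, Finset.card_univ, ZMod.card, nsmul_eq_mul, mul_one] at h
  have h' : N = (Finset.univ.filter (fun z : ZMod N => red hN z = 0)).card * M := by exact_mod_cast h
  have : p * M = (Finset.univ.filter (fun z : ZMod N => red hN z = 0)).card * M := hN ▸ h'
  exact (Nat.eq_of_mul_eq_mul_right (Nat.pos_of_ne_zero (NeZero.ne M)) this).symm

lemma sum_red (hN : N = p * M) (g : ZMod M → ℂ) : ∑ z, g (red hN z) = p * ∑ z, g z := by
  have h := hom_sum (red hN).toAddMonoidHom g
  have him : Finset.univ.image (red hN).toAddMonoidHom = Finset.univ := by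
    ext y; simp; exact red_surj hN y
  rw [him] at h
  refine h.trans ?_
  congr 2
  exact card_red hN

lemma sum_nonunit (hN : N = p * M) (hM : M = p ^ α) (g : ZMod N → ℂ) :
    ∑ z : ZMod N, g (p * z) = p * ∑ z ∈ Finset.univ.filter (fun z : ZMod N => ¬ IsUnit z), g z := by
  have hN' : N = p ^ (α + 1) := by rw [hN, hM, pow_succ, mul_comm]
  have h := hom_sum (AddMonoidHom.mulLeft (p : ZMod N)) g
  refine h.trans ?_
  congr 2
  · refine Eq.trans ?_ (card_red hN)
    congr 1
    refine Finset.filter_congr fun z _ => ?_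
    rw [red_zero]
    rfl
  · ext z
    simp only [Finset.mem_image, Finset.mem_filter, Finset.mem_univ, true_and, AddMonoidHom.coe_mulLeft]
    rw [not_unit_iff hN' (by omega)]
    simp only [eq_comm]

lemma unit_red (hN : N = p * M) (hM : M = p ^ α) (hα : α ≠ 0) (x : ZMod N) : IsUnit (red hN x) ↔ IsUnit x := by
  have hN' : N = p ^ (α + 1) := by rw [hN, hM, pow_succ, mul_comm]
  refine ⟨fun h => ?_, fun h => h.map _⟩
  by_contra hx
  obtain ⟨w, rfl⟩ := (not_unit_iff hN' (by omega) _).1 hx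
  exact (not_unit_iff hM hα _).2 ⟨red hN w, by rw [map_mul, map_natCast]⟩ h

lemma K_red (hN : N = p * M) (hM : M = p ^ α) (hα : α ≠ 0) (m b : ZMod N) :
    Kz ((p : ZMod N) * m) (p * b) = p * Kz (red hN m) (red hN b) := by
  rw [Kz, Kz, Finset.sum_filter, Finset.sum_filter, ← sum_red hN]
  refine Finset.sum_congr rfl fun x _ => ?_
  have hu := unit_red hN hM hα x
  by_cases hx : IsUnit x
  · rw [if_pos hx, if_pos (hu.2 hx)]
    rw [show (p : ZMod N) * m * x + p * b * x⁻¹ = p * (m * x + b * x⁻¹) by ring, std_red hN]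
    congr 1
    rw [map_add, map_mul, map_mul]
    congr 2
    symm
    apply zinv_eq
    rw [← map_mul, ZMod.mul_inv_of_unit x hx, map_one]
  · rw [if_neg hx, if_neg (fun h => hx (hu.1 h))]

noncomputable def NU (n m k : ZMod N) : ℂ := ∑ x ∈ Finset.univ.filter (fun x : ZMod N => ¬ IsUnit x),
  ∑ y : ZMod N, if x * y = n then ZMod.stdAddChar (m * x + k * y) else 0

lemma S_split (n m k : ZMod N) : Sz n m k = Kz m (k * n) + NU n m k := by
  rw [Sz, Kz, NU, ← Finset.sum_filter_add_sum_filter_not Finset.univ (fun x : ZMod N => IsUnit x)]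
  congr 1
  refine Finset.sum_congr rfl fun x hx => ?_
  have hx : IsUnit x := (Finset.mem_filter.1 hx).2
  have hxx := ZMod.mul_inv_of_unit x hx
  rw [Finset.sum_eq_single (x⁻¹ * n)]
  · rw [if_pos (by rw [← mul_assoc, hxx, one_mul])]
    congr 1; ring
  · intro y _ hy
    rw [if_neg]
    rintro rfl
    apply hy
    rw [← mul_assoc, mul_comm x⁻¹, hxx, one_mul]
  · simp

lemma NU_k (hN : N = p ^ α) (hα : α ≠ 0) (n m k : ZMod N) (hk : IsUnit k) : NU n m k = 0 := by
  rw [NU]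
  refine Finset.sum_eq_zero fun x hx => ?_
  have hx : ¬ IsUnit x := (Finset.mem_filter.1 hx).2
  obtain ⟨w, hw⟩ := (not_unit_iff hN hα _).1 hx
  set T := ∑ y : ZMod N, if x * y = n then (ZMod.stdAddChar (m * x + k * y) : ℂ) else 0 with hT
  have hx0 : x * (p : ZMod N) ^ (α - 1) = 0 := by
    have : (p : ZMod N) * p ^ (α - 1) = 0 := by
      rw [← pow_succ']; exact pow_zero_of_le hN (by omega)
    rw [hw]; linear_combination w * this
  -- the character value at a suitable shift
  have hT2 : ∀ s : ZMod N, x * s = 0 → T = ZMod.stdAddChar (k * s) * T := by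
    intro s hs
    rw [hT, Finset.mul_sum]
    refine (Fintype.sum_equiv (Equiv.addRight s) _ _ ?_).symm
    intro y
    rw [Equiv.coe_addRight, mul_add, hs, add_zero]
    split_ifs
    · rw [← AddChar.map_add_eq_mul]; congr 1; ring
    · simp
  have hne : (ZMod.stdAddChar (k * (p : ZMod N) ^ (α - 1)) : ℂ) ≠ 1 := by
    intro h1
    rw [← AddChar.map_zero_eq_one (ZMod.stdAddChar (N := N)), ZMod.injective_stdAddChar.eq_iff,
      hk.mul_right_eq_zero] at h1
    exact pow_ne_zero_of_lt hN (by omega) h1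
  have h2 := hT2 _ hx0
  by_contra hne0
  exact hne (mul_right_cancel₀ hne0 (h2.symm.trans (one_mul T).symm))

lemma NU_n (n m k : ZMod N) (hn : IsUnit n) : NU n m k = 0 := by
  rw [NU]
  refine Finset.sum_eq_zero fun x hx => Finset.sum_eq_zero fun y _ => ?_
  have hx : ¬ IsUnit x := (Finset.mem_filter.1 hx).2
  rw [if_neg]
  rintro rfl
  exact hx (isUnit_of_mul_isUnit_left hn)

lemma NU_red (hN : N = p * M) (hM : M = p ^ α) (n m k : ZMod N) :
    NU ((p : ZMod N) * n) m (p * k) = p * Sz (red hN n) (red hN m) (red hN k) := by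
  have hp : (p : ℂ) ≠ 0 := by exact_mod_cast (Fact.out : p.Prime).ne_zero
  apply mul_left_cancel₀ hp
  rw [NU, ← sum_nonunit hN hM (fun x => ∑ y : ZMod N, if x * y = (p : ZMod N) * n then (ZMod.stdAddChar (m * x + (p : ZMod N) * k * y) : ℂ) else 0)]
  rw [Sz, ← sum_red hN (fun x => ∑ y, if x * y = red hN n then (ZMod.stdAddChar (red hN m * x + red hN k * y) : ℂ) else 0),
    Finset.mul_sum]
  refine Finset.sum_congr rfl fun x _ => ?_
  rw [← sum_red hN (fun y => if red hN x * y = red hN n then (ZMod.stdAddChar (red hN m * red hN x + red hN k * y) : ℂ) else 0)]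
  refine Finset.sum_congr rfl fun y _ => ?_
  have e : (p : ZMod N) * x * y = p * n ↔ red hN x * red hN y = red hN n := by
    rw [← sub_eq_zero, ← sub_eq_zero (a := red hN x * red hN y), ← map_mul, ← map_sub, red_zero]
    rw [show (p : ZMod N) * x * y - p * n = p * (x * y - n) by ring]
  by_cases hc : (p : ZMod N) * x * y = p * n
  · rw [if_pos hc, if_pos (e.1 hc)]
    rw [show m * (p * x) + p * k * y = p * (m * x + k * y) by ring, std_red hN]
    simp only [map_add, map_mul]
  · rw [if_neg hc, if_neg (fun h => hc (e.2 h))]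
end red
end Kl

namespace Kl
open scoped Classical
section fin
variable {p : ℕ} [Fact p.Prime]

lemma Kz_symm {N : ℕ} [NeZero N] (m b : ZMod N) : Kz m b = Kz b m := by
  have hi : ∀ x : ZMod N, IsUnit x → IsUnit x⁻¹ := fun x hx =>
    IsUnit.of_mul_eq_one _ (ZMod.inv_mul_of_unit x hx)
  have hii : ∀ x : ZMod N, IsUnit x → x⁻¹⁻¹ = x := fun x hx => zinv_eq (ZMod.inv_mul_of_unit x hx)
  rw [Kz, Kz]
  refine Finset.sum_bij' (fun x _ => x⁻¹) (fun x _ => x⁻¹) ?_ ?_ ?_ ?_ ?_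
  · intro x hx; simp only [Finset.mem_filter, Finset.mem_univ, true_and] at hx ⊢; exact hi x hx
  · intro x hx; simp only [Finset.mem_filter, Finset.mem_univ, true_and] at hx ⊢; exact hi x hx
  · intro x hx; simp only [Finset.mem_filter, Finset.mem_univ, true_and] at hx ⊢; exact hii x hx
  · intro x hx; simp only [Finset.mem_filter, Finset.mem_univ, true_and] at hx ⊢; exact hii x hx
  · intro x hx
    simp only [Finset.mem_filter, Finset.mem_univ, true_and] at hx
    rw [hii x hx, add_comm]

lemma Kz_triv {N : ℕ} [NeZero N] (m b : ZMod N) : ‖Kz m b‖ ≤ N := by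
  rw [Kz]
  refine (norm_sum_le _ _).trans ?_
  simp only [norm_std, Finset.sum_const, nsmul_eq_mul, mul_one]
  have := Finset.card_filter_le (Finset.univ : Finset (ZMod N)) (fun x => IsUnit x)
  rw [Finset.card_univ, ZMod.card] at this
  exact_mod_cast this

lemma filter_unit : (Finset.univ.filter (fun x : ZMod p => IsUnit x)) = Finset.univ.filter (fun x : ZMod p => x ≠ 0) := by
  refine Finset.filter_congr fun x _ => isUnit_iff_ne_zero

lemma Kz_zero (m : ZMod p) (hm : m ≠ 0) : ‖Kz m 0‖ ≤ 1 := by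
  rw [Kz, filter_unit, Finset.filter_ne']
  have h := sum_std m
  rw [if_neg hm, ← Finset.add_sum_erase _ _ (Finset.mem_univ (0 : ZMod p))] at h
  rw [zero_mul, AddChar.map_zero_eq_one] at h
  have e : ∑ x ∈ Finset.univ.erase (0 : ZMod p), (ZMod.stdAddChar (m * x + 0 * x⁻¹) : ℂ)
      = ∑ x ∈ Finset.univ.erase (0 : ZMod p), (ZMod.stdAddChar (x * m) : ℂ) :=
    Finset.sum_congr rfl fun x _ => by congr 1; ring
  rw [e, eq_neg_of_add_eq_zero_right h]
  simp

lemma Kz_weil (hp2 : p ≠ 2) (m b : ZMod p) (hm : m ≠ 0) (hb : b ≠ 0) : ‖Kz m b‖ ≤ 2 * Real.sqrt p := by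
  have h1 : (ZMod.stdAddChar (N := p)) ≠ 1 := by
    intro h
    have := ZMod.injective_stdAddChar (N := p) (a₁ := 0) (a₂ := 1) (by rw [h]; simp)
    exact zero_ne_one this
  have h := weil p hp2 ZMod.stdAddChar h1 m b hm hb
  have e : Kz m b = KS ZMod.stdAddChar m b := by
    rw [Kz, KS, filter_unit]
    refine Finset.sum_congr ?_ fun x _ => by rw [div_eq_mul_inv]
    congr
  rw [e]; exact h

lemma unit_of_not_dvd {N α : ℕ} [NeZero N] (hN : N = p ^ α) (hα : α ≠ 0) (m : ℤ) (hm : ¬ (p : ℤ) ∣ m) :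
    IsUnit (m : ZMod N) := by
  by_contra h
  obtain ⟨w, hw⟩ := (not_unit_iff hN hα _).1 h
  obtain ⟨v, rfl⟩ := ZMod.intCast_surjective w
  have h1 : ((m - p * v : ℤ) : ZMod N) = 0 := by push_cast; rw [hw]; ring
  rw [ZMod.intCast_zmod_eq_zero_iff_dvd] at h1
  have h2 : (p : ℤ) ∣ N := by rw [hN]; push_cast; exact dvd_pow_self _ hα
  have h3 := (h2.trans h1).add (dvd_mul_right (p : ℤ) v)
  rw [sub_add_cancel] at h3
  exact hm h3

lemma one_le_sqrt_gcd {N : ℕ} [NeZero N] (m : ℤ) : 1 ≤ Real.sqrt (Int.gcd (N : ℤ) m) := by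
  rw [Real.one_le_sqrt]
  have : 0 < Int.gcd (N : ℤ) m := Int.gcd_pos_of_ne_zero_left _ (by exact_mod_cast NeZero.ne N)
  exact_mod_cast this

theorem K_bound (α : ℕ) : ∀ (N : ℕ) [NeZero N], N = p ^ α → ∀ m b : ℤ,
    ‖Kz (m : ZMod N) (b : ZMod N)‖ ≤ 8 * Real.sqrt N * Real.sqrt (Int.gcd (N : ℤ) m) := by
  have hp : p.Prime := Fact.out
  have hp0 : (0 : ℝ) ≤ p := by positivity
  induction α with
  | zero =>
    intro N _ hN m b
    have h := Kz_triv (m : ZMod N) (b : ZMod N)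
    have h1 := one_le_sqrt_gcd (N := N) m
    have : (N : ℝ) = 1 := by rw [hN]; simp
    rw [this] at h ⊢
    rw [Real.sqrt_one]
    linarith
  | succ α ih =>
    intro N _ hN m b
    have h1 := one_le_sqrt_gcd (N := N) m
    have hs0 := Real.sqrt_nonneg (N : ℝ)
    have hN1 : (1 : ℝ) ≤ N := by exact_mod_cast NeZero.one_le
    have hs1 : 1 ≤ Real.sqrt N := by rw [Real.one_le_sqrt]; exact hN1
    by_cases hα : α = 0
    · obtain rfl : N = p := by rw [hN, hα]; simp
      by_cases hm : (m : ZMod N) = 0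
      · by_cases hb : (b : ZMod N) = 0
        · have hg : Int.gcd (N : ℤ) m = N := by
            rw [ZMod.intCast_zmod_eq_zero_iff_dvd] at hm
            rw [Int.gcd_eq_natAbs_left hm]
            simp
          rw [hg, mul_assoc, Real.mul_self_sqrt (by positivity)]
          have := Kz_triv (m : ZMod N) (b : ZMod N)
          linarith
        · rw [hm, Kz_symm]
          have := Kz_zero (b : ZMod N) hb
          nlinarith
      · by_cases hb : (b : ZMod N) = 0
        · rw [hb]
          have := Kz_zero (m : ZMod N) hm
          nlinarith
        · by_cases hp2 : N = 2
          · have := Kz_triv (m : ZMod N) (b : ZMod N)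
            have h2 : (N : ℝ) = 2 := by exact_mod_cast hp2
            nlinarith
          · have := Kz_weil hp2 (m : ZMod N) (b : ZMod N) hm hb
            nlinarith
    · by_cases hd : (p : ℤ) ∣ m ∧ (p : ℤ) ∣ b
      · obtain ⟨⟨m', rfl⟩, ⟨b', rfl⟩⟩ := hd
        obtain ⟨M, hM⟩ : ∃ M, M = p ^ α := ⟨_, rfl⟩
        have : NeZero M := ⟨by rw [hM]; exact pow_ne_zero _ hp.ne_zero⟩
        have hNM : N = p * M := by rw [hN, hM, pow_succ, mul_comm]
        have hk := K_red hNM hM hα (m' : ZMod N) (b' : ZMod N)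
        have hI := ih M hM m' b'
        have e : Kz ((p * m' : ℤ) : ZMod N) ((p * b' : ℤ) : ZMod N) = Kz ((p : ZMod N) * (m' : ZMod N)) ((p : ZMod N) * (b' : ZMod N)) := by
          push_cast; rfl
        rw [e, hk, map_intCast, map_intCast, norm_mul, Complex.norm_natCast]
        have e2 : Int.gcd (N : ℤ) (p * m') = p * Int.gcd (M : ℤ) m' := by
          rw [hNM]; push_cast; rw [Int.gcd_mul_left]; simp
        rw [e2, hNM]
        push_cast
        rw [Real.sqrt_mul hp0, Real.sqrt_mul hp0]
        have hpp : Real.sqrt p * Real.sqrt p = p := Real.mul_self_sqrt hp0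
        calc _ ≤ (p : ℝ) * (8 * Real.sqrt M * Real.sqrt (Int.gcd (M : ℤ) m')) := by gcongr
          _ = _ := by nth_rw 1 [← hpp]; ring
      · have : IsUnit (m : ZMod N) ∨ IsUnit (b : ZMod N) := by
          by_contra! hh
          apply hd
          constructor
          · by_contra h; exact hh.1 (unit_of_not_dvd hN (by omega) _ h)
          · by_contra h; exact hh.2 (unit_of_not_dvd hN (by omega) _ h)
        have := K_unit_bound hN (by omega) (m : ZMod N) (b : ZMod N) this
        nlinarith

theorem S_bound (α : ℕ) : ∀ (N : ℕ) [NeZero N], N = p ^ α → ∀ n m k : ℤ,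
    ‖Sz (n : ZMod N) (m : ZMod N) (k : ZMod N)‖ ≤ (8 * α + 1) * Real.sqrt N * Real.sqrt (Int.gcd (N : ℤ) k)
      * Real.sqrt (Int.gcd (N : ℤ) m) := by
  have hp : p.Prime := Fact.out
  have hp0 : (0 : ℝ) ≤ p := by positivity
  induction α with
  | zero =>
    intro N _ hN n m k
    obtain rfl : N = 1 := by rw [hN]; simp
    simp [Sz]
    split_ifs <;> simp
  | succ α ih =>
    intro N _ hN n m k
    obtain ⟨M, hM⟩ : ∃ M, M = p ^ α := ⟨_, rfl⟩
    have : NeZero M := ⟨by rw [hM]; exact pow_ne_zero _ hp.ne_zero⟩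
    have hNM : N = p * M := by rw [hN, hM, pow_succ, mul_comm]
    have h1 := one_le_sqrt_gcd (N := N) m
    have h2 := one_le_sqrt_gcd (N := N) k
    have hs0 := Real.sqrt_nonneg (N : ℝ)
    have hK := K_bound (α + 1) N hN m (k * n)
    push_cast at hK
    rw [S_split]
    refine (norm_add_le _ _).trans ?_
    set A := Real.sqrt N * Real.sqrt (Int.gcd (N : ℤ) k) * Real.sqrt (Int.gcd (N : ℤ) m) with hA
    have hA0 : 0 ≤ A := by positivity
    have hK' : ‖Kz (m : ZMod N) (k * n : ZMod N)‖ ≤ 8 * A := by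
      refine hK.trans ?_
      have : Real.sqrt N * 1 ≤ Real.sqrt N * Real.sqrt (Int.gcd (N : ℤ) k) := by gcongr
      rw [hA]
      nlinarith
    have hNU : ‖NU (n : ZMod N) (m : ZMod N) (k : ZMod N)‖ ≤ (8 * α + 1) * A := by
      by_cases hk : (p : ℤ) ∣ k
      swap
      · rw [NU_k hN (by omega) _ _ _ (unit_of_not_dvd hN (by omega) _ hk), norm_zero]; positivity
      by_cases hn : (p : ℤ) ∣ n
      swap
      · rw [NU_n _ _ _ (unit_of_not_dvd hN (by omega) _ hn), norm_zero]; positivity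
      obtain ⟨k', rfl⟩ := hk
      obtain ⟨n', rfl⟩ := hn
      have e : NU ((p * n' : ℤ) : ZMod N) (m : ZMod N) ((p * k' : ℤ) : ZMod N) = NU ((p : ZMod N) * (n' : ZMod N)) (m : ZMod N) ((p : ZMod N) * (k' : ZMod N)) := by
        push_cast; rfl
      rw [e, NU_red hNM hM, map_intCast, map_intCast, map_intCast, norm_mul, Complex.norm_natCast]
      have e2 : Int.gcd (N : ℤ) (p * k') = p * Int.gcd (M : ℤ) k' := by
        rw [hNM]; push_cast; rw [Int.gcd_mul_left]; simp
      have e3 : (Int.gcd (M : ℤ) m : ℝ) ≤ Int.gcd (N : ℤ) m := by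
        have : Int.gcd (M : ℤ) m ∣ Int.gcd (N : ℤ) m := Int.gcd_dvd_gcd_of_dvd_left _ (by rw [hNM]; push_cast; exact dvd_mul_left _ _)
        exact_mod_cast Nat.le_of_dvd (Int.gcd_pos_of_ne_zero_left _ (by exact_mod_cast NeZero.ne N)) this
      have hI := ih M hM n' m k'
      have hpp : Real.sqrt p * Real.sqrt p = p := Real.mul_self_sqrt hp0
      have e4 : (N : ℝ) = p * M := by rw [hNM]; push_cast; rfl
      rw [hA, e2, e4]
      push_cast
      rw [Real.sqrt_mul hp0, Real.sqrt_mul hp0]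
      calc _ ≤ (p : ℝ) * ((8 * α + 1) * Real.sqrt M * Real.sqrt (Int.gcd (M : ℤ) k')
              * Real.sqrt (Int.gcd (M : ℤ) m)) := by gcongr
        _ ≤ (p : ℝ) * ((8 * α + 1) * Real.sqrt M * Real.sqrt (Int.gcd (M : ℤ) k')
              * Real.sqrt (Int.gcd (N : ℤ) m)) := by gcongr
        _ = _ := by nth_rw 1 [← hpp]; ring
    have : ((8 : ℝ) * ((α + 1 : ℕ) : ℝ) + 1) * Real.sqrt N * Real.sqrt (Int.gcd (N : ℤ) k)
      * Real.sqrt (Int.gcd (N : ℤ) m) = 8 * A + (8 * α + 1) * A := by rw [hA]; push_cast; ring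
    rw [this]
    exact add_le_add hK' hNU
end fin
end Kl

namespace Kl
open scoped Classical

lemma sum_zmod_range {d : ℕ} [NeZero d] (f : ZMod d → ℂ) : ∑ x, f x = ∑ i ∈ Finset.range d, f (i : ZMod d) := by
  refine Finset.sum_bij' (fun x _ => x.val) (fun i _ => (i : ZMod d)) ?_ ?_ ?_ ?_ ?_
  · intro x _; exact Finset.mem_range.2 (ZMod.val_lt x)
  · intro i _; exact Finset.mem_univ _
  · intro x _; exact ZMod.natCast_zmod_val x
  · intro i hi; exact ZMod.val_cast_of_lt (Finset.mem_range.1 hi)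
  · intro x _; rw [ZMod.natCast_zmod_val]

lemma std_crt {a b : ℕ} [NeZero a] [NeZero b] [NeZero (a * b)] (u v : ℤ) (h : u * b + v * a = 1) (j : ℤ) :
    (ZMod.stdAddChar (j : ZMod (a * b)) : ℂ) =
      ZMod.stdAddChar ((u * j : ℤ) : ZMod a) * ZMod.stdAddChar ((v * j : ℤ) : ZMod b) := by
  rw [ZMod.stdAddChar_coe, ZMod.stdAddChar_coe, ZMod.stdAddChar_coe, ← Complex.exp_add]
  have ha : (a : ℂ) ≠ 0 := by exact_mod_cast NeZero.ne a
  have hb : (b : ℂ) ≠ 0 := by exact_mod_cast NeZero.ne b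
  have h' : (u : ℂ) * b + v * a = 1 := by exact_mod_cast h
  congr 1
  push_cast
  field_simp
  linear_combination (-(j : ℂ)) * h'

lemma S_mul {a b : ℕ} [NeZero a] [NeZero b] [NeZero (a * b)] (hab : a.Coprime b) (u v : ℤ)
    (h : u * b + v * a = 1) (n m k : ℤ) :
    Sz (n : ZMod (a * b)) (m : ZMod (a * b)) (k : ZMod (a * b)) =
      Sz (n : ZMod a) ((u * m : ℤ) : ZMod a) ((u * k : ℤ) : ZMod a) *
        Sz (n : ZMod b) ((v * m : ℤ) : ZMod b) ((v * k : ℤ) : ZMod b) := by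
  let φ := ZMod.chineseRemainder hab
  have hφ : ∀ j : ℤ, φ (j : ZMod (a * b)) = ((j : ZMod a), (j : ZMod b)) := by
    intro j
    rw [map_intCast]; rfl
  let f : ZMod a → ZMod a → ℂ := fun x y =>
    if x * y = (n : ZMod a) then ZMod.stdAddChar (((u * m : ℤ) : ZMod a) * x + ((u * k : ℤ) : ZMod a) * y) else 0
  let g : ZMod b → ZMod b → ℂ := fun x y =>
    if x * y = (n : ZMod b) then ZMod.stdAddChar (((v * m : ℤ) : ZMod b) * x + ((v * k : ℤ) : ZMod b) * y) else 0
  have h1 : ∀ x y : ZMod (a * b), (if x * y = (n : ZMod (a * b)) then (ZMod.stdAddChar ((m : ZMod (a * b)) * x + (k : ZMod (a * b)) * y) : ℂ) else 0)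
      = f (φ x).1 (φ y).1 * g (φ x).2 (φ y).2 := by
    intro x y
    obtain ⟨i, rfl⟩ := ZMod.intCast_surjective x
    obtain ⟨j, rfl⟩ := ZMod.intCast_surjective y
    rw [hφ, hφ]
    have e : ((i : ZMod (a * b)) * (j : ZMod (a * b)) = (n : ZMod (a * b))) ↔
        ((i : ZMod a) * (j : ZMod a) = (n : ZMod a)) ∧ ((i : ZMod b) * (j : ZMod b) = (n : ZMod b)) := by
      rw [← φ.injective.eq_iff, map_mul, hφ, hφ, hφ, Prod.mk_mul_mk, Prod.mk.injEq]
    by_cases hc : ((i : ZMod a) * (j : ZMod a) = (n : ZMod a)) ∧ ((i : ZMod b) * (j : ZMod b) = (n : ZMod b))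
    · rw [if_pos (e.2 hc)]
      simp only [f, g]
      rw [if_pos hc.1, if_pos hc.2]
      have := std_crt (a := a) (b := b) u v h (m * i + k * j)
      push_cast at this ⊢
      rw [this]
      congr 2 <;> ring
    · rw [if_neg (fun h => hc (e.1 h))]
      simp only [f, g]
      rw [not_and_or] at hc
      rcases hc with hc | hc
      · rw [if_neg hc, zero_mul]
      · rw [if_neg hc, mul_zero]
  have h2 : ∀ F : ZMod a × ZMod b → ℂ, ∑ x : ZMod (a * b), F (φ x) = ∑ z, F z := fun F => φ.toEquiv.sum_comp F
  calc Sz (n : ZMod (a * b)) (m : ZMod (a * b)) (k : ZMod (a * b))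
      = ∑ x, ∑ y, f (φ x).1 (φ y).1 * g (φ x).2 (φ y).2 :=
        Finset.sum_congr rfl fun x _ => Finset.sum_congr rfl fun y _ => h1 x y
    _ = ∑ z : ZMod a × ZMod b, ∑ w : ZMod a × ZMod b, f z.1 w.1 * g z.2 w.2 := by
        rw [← h2 (fun z => ∑ w : ZMod a × ZMod b, f z.1 w.1 * g z.2 w.2)]
        refine Finset.sum_congr rfl fun x _ => ?_
        exact h2 (fun w => f (φ x).1 w.1 * g (φ x).2 w.2)
    _ = (∑ x, ∑ y, f x y) * (∑ x, ∑ y, g x y) := by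
        rw [Finset.sum_mul_sum]
        rw [Fintype.sum_prod_type]
        refine Finset.sum_congr rfl fun x _ => Finset.sum_congr rfl fun y _ => ?_
        rw [Finset.sum_mul_sum]
        exact Fintype.sum_prod_type (fun w : ZMod a × ZMod b => f x w.1 * g y w.2)

lemma gcd_mul_unit {a : ℕ} (u m c : ℤ) (h : u * c + m * a = 1) (x : ℤ) : Int.gcd (a : ℤ) (u * x) = Int.gcd (a : ℤ) x := by
  have : IsCoprime (a : ℤ) u := ⟨m, c, by linear_combination h⟩
  exact Int.gcd_mul_right_right_of_gcd_eq_one (Int.isCoprime_iff_gcd_eq_one.1 this) 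

lemma gcd_coprime_mul {a b : ℕ} (hab : a.Coprime b) (x : ℤ) :
    Int.gcd ((a * b : ℕ) : ℤ) x = Int.gcd (a : ℤ) x * Int.gcd (b : ℤ) x := by
  rw [Int.gcd_eq_natAbs, Int.gcd_eq_natAbs, Int.gcd_eq_natAbs]
  simp only [Int.natAbs_natCast]
  rw [Nat.gcd_comm, Nat.Coprime.gcd_mul _ hab, Nat.gcd_comm, Nat.gcd_comm _ b]

theorem S_global (d : ℕ) : ∀ [NeZero d] (n m k : ℤ),
    ‖Sz (n : ZMod d) (m : ZMod d) (k : ZMod d)‖ ≤ (d.divisors.card : ℝ) ^ 4 * Real.sqrt d * Real.sqrt (Int.gcd (d : ℤ) k)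
      * Real.sqrt (Int.gcd (d : ℤ) m) := by
  induction d using Nat.recOnPosPrimePosCoprime with
  | zero => intro h; exact absurd rfl h.1
  | one =>
    intro _ n m k
    simp [Sz]
    split_ifs <;> simp
  | prime_pow p α hp hα =>
    intro _ n m k
    have : Fact p.Prime := ⟨hp⟩
    have h := S_bound (p := p) α (p ^ α) rfl n m k
    refine h.trans ?_
    have : (8 * α + 1 : ℝ) ≤ ((p ^ α).divisors.card : ℝ) ^ 4 := by
      rw [Nat.divisors_prime_pow hp, Finset.card_map, Finset.card_range]
      have : 8 * α + 1 ≤ (α + 1) ^ 4 := by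
        obtain ⟨c, rfl⟩ : ∃ c, α = c + 1 := ⟨α - 1, by omega⟩
        ring_nf; nlinarith [sq_nonneg c, Nat.zero_le (c ^ 3), Nat.zero_le (c ^ 4)]
      exact_mod_cast this
    gcongr
  | coprime a b ha hb hab iha ihb =>
    intro _ n m k
    have : NeZero a := ⟨by omega⟩
    have : NeZero b := ⟨by omega⟩
    obtain ⟨v, u, h⟩ : IsCoprime (a : ℤ) (b : ℤ) := Nat.isCoprime_iff_coprime.2 hab
    have h' : u * b + v * a = 1 := by linear_combination h
    rw [S_mul hab u v h', norm_mul]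
    have h1 := iha n (u * m) (u * k)
    have h2 := ihb n (v * m) (v * k)
    rw [gcd_mul_unit u v b h', gcd_mul_unit u v b h'] at h1
    rw [gcd_mul_unit v u a (by linear_combination h), gcd_mul_unit v u a (by linear_combination h)] at h2
    refine (mul_le_mul h1 h2 (norm_nonneg _) (by positivity)).trans (le_of_eq ?_)
    rw [gcd_coprime_mul hab, gcd_coprime_mul hab, hab.card_divisors_mul]
    push_cast
    rw [Real.sqrt_mul (by positivity), Real.sqrt_mul (by positivity), Real.sqrt_mul (by positivity)]
    ring

theorem divisor_bound (η : ℝ) (hη : 0 < η) : ∃ C : ℝ, 0 < C ∧ ∀ d : ℕ, 0 < d → (d.divisors.card : ℝ) ≤ C * (d : ℝ) ^ η := by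
  set L := η * Real.log 2 with hL
  have hL0 : 0 < L := mul_pos hη (Real.log_pos (by norm_num))
  set D : ℝ := max 1 (1 / L) with hD
  have hD1 : 1 ≤ D := le_max_left _ _
  have hDL : 1 ≤ D * L := by
    have := le_max_right 1 (1 / L)
    rwa [div_le_iff₀ hL0] at this
  have key : ∀ (p a : ℕ), 2 ≤ p → ((a : ℝ) + 1) ≤ D * ((p : ℝ) ^ a) ^ η := by
    intro p a hp
    have h1 : ((2 : ℝ) ^ a) ^ η ≤ ((p : ℝ) ^ a) ^ η := by
      have : (2 : ℝ) ≤ p := by exact_mod_cast hp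
      gcongr
    have h2 : a * L + 1 ≤ ((2 : ℝ) ^ a) ^ η := by
      rw [Real.rpow_def_of_pos (by positivity), Real.log_pow]
      refine le_trans (le_of_eq ?_) (Real.add_one_le_exp _)
      rw [hL]; ring
    calc (a : ℝ) + 1 ≤ D * (a * L + 1) := by
          have : (a : ℝ) * 1 ≤ a * (D * L) := by gcongr
          nlinarith
      _ ≤ D * ((p : ℝ) ^ a) ^ η := by
          have := h2.trans h1
          gcongr
  obtain ⟨B, hB⟩ := exists_nat_ge ((2 : ℝ) ^ (1 / η))
  have key2 : ∀ (p a : ℕ), B ≤ p → ((a : ℝ) + 1) ≤ ((p : ℝ) ^ a) ^ η := by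
    intro p a hp
    have hp' : (2 : ℝ) ^ (1 / η) ≤ p := hB.trans (by exact_mod_cast hp)
    have h1 : (2 : ℝ) ≤ (p : ℝ) ^ η := by
      calc (2 : ℝ) = ((2 : ℝ) ^ (1 / η)) ^ η := by
            rw [← Real.rpow_mul (by norm_num), one_div_mul_cancel hη.ne', Real.rpow_one]
        _ ≤ _ := by gcongr
    have h2 : ((p : ℝ) ^ a) ^ η = ((p : ℝ) ^ η) ^ a := by
      rw [← Real.rpow_natCast, ← Real.rpow_mul (by positivity), mul_comm, Real.rpow_mul (by positivity), Real.rpow_natCast]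
    rw [h2]
    calc (a : ℝ) + 1 ≤ 2 ^ a := by exact_mod_cast Nat.lt_two_pow_self
      _ ≤ _ := by gcongr
  refine ⟨D ^ B, by positivity, ?_⟩
  intro d hd
  rw [Nat.card_divisors hd.ne']
  have hprod : (d : ℝ) ^ η = ∏ p ∈ d.primeFactors, (((p : ℝ) ^ (d.factorization p)) ^ η) := by
    rw [Real.finsetProd_rpow _ _ (by intros; positivity)]
    congr 1
    have := Nat.prod_factorization_pow_eq_self hd.ne'
    nth_rw 1 [← this]
    rw [Finsupp.prod]
    push_cast
    rfl
  rw [hprod]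
  push_cast
  calc ∏ p ∈ d.primeFactors, ((d.factorization p : ℝ) + 1)
      ≤ ∏ p ∈ d.primeFactors, ((if p < B then D else 1) * (((p : ℝ) ^ (d.factorization p)) ^ η)) := by
        refine Finset.prod_le_prod (fun _ _ => by positivity) fun p hp => ?_
        split_ifs with h
        · exact key p _ (Nat.prime_of_mem_primeFactors hp).two_le
        · rw [one_mul]; exact key2 p _ (not_lt.1 h)
    _ = D ^ ((d.primeFactors.filter (fun p => p < B)).card) * ∏ p ∈ d.primeFactors, (((p : ℝ) ^ (d.factorization p)) ^ η) := by
        rw [Finset.prod_mul_distrib, Finset.prod_ite, Finset.prod_const, Finset.prod_const_one, mul_one]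
    _ ≤ _ := by
        have : (d.primeFactors.filter (fun p => p < B)).card ≤ B := by
          calc _ ≤ (Finset.range B).card := Finset.card_le_card (fun p hp => by
                rw [Finset.mem_range]; exact (Finset.mem_filter.1 hp).2)
            _ = B := Finset.card_range B
        gcongr
end Kl

namespace Kl

lemma expSum_eq (n m k : ℤ) (d : ℕ) [NeZero d] :
    expSum n m k d = Sz (n : ZMod d) (m : ZMod d) (k : ZMod d) := by
  rw [expSum, Finset.sum_filter, Finset.sum_product, Sz, sum_zmod_range]
  refine Finset.sum_congr rfl fun i _ => ?_
  rw [sum_zmod_range]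
  refine Finset.sum_congr rfl fun j _ => ?_
  have hc : ((i : ZMod d) * (j : ZMod d) = (n : ZMod d)) ↔ ((i * j : ℤ) ≡ n [ZMOD (d : ℤ)]) := by
    rw [← ZMod.intCast_eq_intCast_iff]
    push_cast
    rfl
  by_cases h : ((i * j : ℤ) ≡ n [ZMOD (d : ℤ)])
  · rw [if_pos h, if_pos (hc.2 h)]
    have h2 : (m : ZMod d) * (i : ZMod d) + (k : ZMod d) * (j : ZMod d) = ((m * i + k * j : ℤ) : ZMod d) := by
      push_cast
      rfl
    rw [h2, ZMod.stdAddChar_coe, eexp]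
    congr 1
    push_cast
    ring
  · rw [if_neg h, if_neg (fun h' => h (hc.1 h'))]

end Kl

theorem stmt11 :
    ∀ ε > (0 : ℝ), ∃ C : ℝ, ∀ d : ℕ, 0 < d → ∀ m k n : ℤ,
      ‖expSum n m k d‖
        ≤ C * (d : ℝ) ^ ((1 : ℝ) / 2 + ε) * (Int.gcd (d : ℤ) k : ℝ) ^ ((1 : ℝ) / 2)
            * (Int.gcd (d : ℤ) m : ℝ) ^ ((1 : ℝ) / 2) := by
  intro ε hε
  obtain ⟨C, hC, h⟩ := Kl.divisor_bound (ε / 4) (by positivity)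
  refine ⟨C ^ 4, fun d hd m k n => ?_⟩
  have : NeZero d := ⟨hd.ne'⟩
  have hd' : (0 : ℝ) < d := by exact_mod_cast hd
  rw [Kl.expSum_eq]
  refine (Kl.S_global d n m k).trans ?_
  rw [← Real.sqrt_eq_rpow, ← Real.sqrt_eq_rpow]
  have h4 : (d.divisors.card : ℝ) ^ 4 * Real.sqrt d ≤ C ^ 4 * (d : ℝ) ^ ((1 : ℝ) / 2 + ε) := by
    rw [Real.rpow_add hd', ← Real.sqrt_eq_rpow]
    have h5 : (d.divisors.card : ℝ) ^ 4 ≤ C ^ 4 * (d : ℝ) ^ ε := by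
      calc (d.divisors.card : ℝ) ^ 4 ≤ (C * (d : ℝ) ^ (ε / 4)) ^ 4 := by
            have := h d hd
            gcongr
        _ = C ^ 4 * (d : ℝ) ^ ε := by
            rw [mul_pow, ← Real.rpow_natCast ((d : ℝ) ^ (ε / 4)), ← Real.rpow_mul hd'.le]
            congr 2
            push_cast
            ring
    calc _ ≤ (C ^ 4 * (d : ℝ) ^ ε) * Real.sqrt d := by gcongr
      _ = _ := by ring
  gcongr
end
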